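/- Every simply connected, compact topological 2-manifold without boundary is homeomorphic to the 2-sphere. -/

import Mathlib

open Set Filter Topology Metric

namespace PlanarTopology

/-- The set `J` is locally flat at `p`: some open embedding of the plane centred at `p` pulls `J`
back to the real axis. -/
def Flat {X : Type*} [TopologicalSpace X] (J : Set X) (p : X) : Prop :=
  ∃ ψ : ℂ → X, IsOpenEmbedding ψ ∧ ψ 0 = p ∧ ∀ z, ψ z ∈ J ↔ z.im = 0

/-- A space every point of which is the centre of an embedded open plane. -/
class Surface (X : Type*) [TopologicalSpace X] : Prop where
  exists_chart : ∀ p : X, ∃ ψ : ℂ → X, IsOpenEmbedding ψ ∧ ψ 0 = p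

/-- The sign function `f` has a constant germ at `p` off the set `J`. -/
def GC {X : Type*} [TopologicalSpace X] (f : X → ℤˣ) (J : Set X) (p : X) : Prop :=
  ∃ c, ∀ᶠ y in 𝓝[Jᶜ] p, f y = c

/-- A closed set which is locally flat away from finitely many points. -/
def Thin {X : Type*} [TopologicalSpace X] (J : Set X) : Prop :=
  IsClosed J ∧ {p ∈ J | ¬ Flat J p}.Finite

theorem exists_radial_embedding {r : ℝ} (hr : 0 < r) :
    ∃ σ : ℂ → ℂ, IsOpenEmbedding σ ∧ σ 0 = 0 ∧ range σ = ball 0 r ∧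
      ∀ z, ∃ c : ℝ, 0 < c ∧ σ z = c * z := by
  refine ⟨OpenPartialHomeomorph.univBall 0 r, ?_, ?_, ?_, ?_⟩
  · exact OpenPartialHomeomorph.isOpenEmbedding _ (OpenPartialHomeomorph.univBall_source _ _)
  · simp
  · rw [← image_univ, ← OpenPartialHomeomorph.univBall_source (0 : ℂ) r,
      OpenPartialHomeomorph.image_source_eq_target, OpenPartialHomeomorph.univBall_target _ hr]
  · intro z
    refine ⟨r * (√(1 + ‖z‖ ^ 2))⁻¹, by positivity, ?_⟩
    rw [OpenPartialHomeomorph.univBall, dif_pos hr]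
    simp [OpenPartialHomeomorph.unitBallBall, OpenPartialHomeomorph.univUnitBall, mul_assoc]

theorem exists_small_chart {X : Type*} [TopologicalSpace X] {ψ : ℂ → X} (hψ : IsOpenEmbedding ψ)
    {W : Set X} (hW : W ∈ 𝓝 (ψ 0)) :
    ∃ σ : ℂ → ℂ, IsOpenEmbedding (ψ ∘ σ) ∧ σ 0 = 0 ∧ range (ψ ∘ σ) ⊆ W ∧
      ∀ z, ∃ c : ℝ, 0 < c ∧ σ z = c * z := by
  have : ψ ⁻¹' W ∈ 𝓝 (0 : ℂ) := hψ.continuous.continuousAt.preimage_mem_nhds hW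
  obtain ⟨r, hr, hrW⟩ := Metric.mem_nhds_iff.1 this
  obtain ⟨σ, hσ, h0, hrange, hc⟩ := exists_radial_embedding hr
  refine ⟨σ, hψ.comp hσ, h0, ?_, hc⟩
  rw [range_comp, hrange]
  exact image_subset_iff.2 hrW

section basic
variable {X : Type*} [TopologicalSpace X] {J : Set X} {p : X}

theorem Flat.mem (h : Flat J p) : p ∈ J := by
  obtain ⟨ψ, -, h0, hJ⟩ := h
  rw [← h0, hJ]; simp

theorem Flat.exists_small (h : Flat J p) {W : Set X} (hW : W ∈ 𝓝 p) :
    ∃ ψ : ℂ → X, IsOpenEmbedding ψ ∧ ψ 0 = p ∧ (∀ z, ψ z ∈ J ↔ z.im = 0) ∧ range ψ ⊆ W := by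
  obtain ⟨ψ, hψ, h0, hJ⟩ := h
  obtain ⟨σ, h1, h2, h3, h4⟩ := exists_small_chart hψ (h0 ▸ hW)
  refine ⟨ψ ∘ σ, h1, by simp [h2, h0], fun z => ?_, h3⟩
  obtain ⟨c, hc, hz⟩ := h4 z
  simp [hJ, hz, hc.ne']

theorem Surface.exists_small [Surface X] {W : Set X} (hW : W ∈ 𝓝 p) :
    ∃ ψ : ℂ → X, IsOpenEmbedding ψ ∧ ψ 0 = p ∧ range ψ ⊆ W := by
  obtain ⟨ψ, hψ, h0⟩ := Surface.exists_chart p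
  obtain ⟨σ, h1, h2, h3, h4⟩ := exists_small_chart hψ (h0 ▸ hW)
  exact ⟨ψ ∘ σ, h1, by simp [h2, h0], h3⟩

theorem Flat.congr (h : Flat J p) {J' : Set X} (hJ : ∀ᶠ q in 𝓝 p, q ∈ J ↔ q ∈ J') :
    Flat J' p := by
  obtain ⟨ψ, h1, h2, h3, h4⟩ := h.exists_small hJ
  exact ⟨ψ, h1, h2, fun z => by rw [← h3]; exact (h4 (mem_range_self z)).symm⟩

theorem Flat.preimage {Y : Type*} [TopologicalSpace Y] {J : Set Y} {Φ : X → Y}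
    (e : OpenPartialHomeomorph X Y) (he : EqOn Φ e e.source) (hp : p ∈ e.source)
    (h : Flat J (Φ p)) : Flat (Φ ⁻¹' J) p := by
  rw [he hp] at h
  obtain ⟨ψ, h1, h2, h3, h4⟩ := h.exists_small (e.open_target.mem_nhds (e.map_source hp))
  refine ⟨e.symm ∘ ψ, ?_, by simp [h2, hp], fun z => ?_⟩
  · refine .of_continuous_injective_isOpenMap ?_ ?_ ?_
    · exact e.continuousOn_symm.comp_continuous h1.continuous fun z => h4 (mem_range_self z)
    · exact fun a b hab => h1.injective <|
        e.symm.injOn (h4 (mem_range_self a)) (h4 (mem_range_self b)) hab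
    · intro U hU
      rw [image_comp]
      exact e.isOpen_image_symm_of_subset_target (h1.isOpenMap U hU)
        ((image_subset_range _ _).trans h4)
  · have hz := h4 (mem_range_self z)
    rw [← h3, mem_preimage, Function.comp_apply, he (e.map_target hz), e.right_inv hz]

theorem Flat.preimage_embedding {Y : Type*} [TopologicalSpace Y] {J : Set Y} {Φ : X → Y}
    (hΦ : IsOpenEmbedding Φ) (h : Flat J (Φ p)) : Flat (Φ ⁻¹' J) p := by
  have : Nonempty X := ⟨p⟩
  exact Flat.preimage (hΦ.toOpenPartialHomeomorph Φ) (fun _ _ => rfl) (by simp) h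

theorem Flat.image_embedding {Y : Type*} [TopologicalSpace Y] {Φ : X → Y}
    (hΦ : IsOpenEmbedding Φ) (h : Flat J p) : Flat (Φ '' J) (Φ p) := by
  obtain ⟨ψ, h1, h2, h3⟩ := h
  exact ⟨Φ ∘ ψ, hΦ.comp h1, by simp [h2], fun z => by
    rw [← h3, Function.comp_apply, hΦ.injective.mem_set_image]⟩

theorem map_nhdsWithin_preimage {Y : Type*} [TopologicalSpace Y] {Φ : X → Y}
    (h : map Φ (𝓝 p) = 𝓝 (Φ p)) (s : Set Y) :
    map Φ (𝓝[Φ ⁻¹' s] p) = 𝓝[s] (Φ p) := by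
  rw [nhdsWithin, nhdsWithin, map_inf_principal_preimage, h]

theorem gc_comp_iff {Y : Type*} [TopologicalSpace Y] {Φ : X → Y} {J : Set Y} {f : Y → ℤˣ}
    (h : map Φ (𝓝 p) = 𝓝 (Φ p)) : GC (f ∘ Φ) (Φ ⁻¹' J) p ↔ GC f J (Φ p) := by
  unfold GC
  rw [← map_nhdsWithin_preimage h, preimage_compl]
  rfl

theorem GC.eventually {f : X → ℤˣ} (h : GC f J p) : ∀ᶠ q in 𝓝 p, GC f J q := by
  obtain ⟨c, hc⟩ := h
  filter_upwards [eventually_nhds_nhdsWithin.2 hc] with q hq using ⟨c, hq⟩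

theorem GC.mul {f g : X → ℤˣ} (hf : GC f J p) (hg : GC g J p) :
    GC (fun x => f x * g x) J p := by
  obtain ⟨c, hc⟩ := hf
  obtain ⟨d, hd⟩ := hg
  exact ⟨c * d, by filter_upwards [hc, hd] with y h1 h2; rw [h1, h2]⟩

theorem GC.congr {f g : X → ℤˣ} (hf : GC f J p) (h : ∀ᶠ y in 𝓝[Jᶜ] p, f y = g y) :
    GC g J p := by
  obtain ⟨c, hc⟩ := hf
  exact ⟨c, by filter_upwards [hc, h] with y h1 h2; rw [← h2, h1]⟩

theorem gc_of_eventually {f : X → ℤˣ} {c : ℤˣ} (h : ∀ᶠ y in 𝓝 p, f y = c) : GC f J p :=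
  ⟨c, h.filter_mono nhdsWithin_le_nhds⟩

theorem GC.mono {f : X → ℤˣ} {J' : Set X} (hJ : J ⊆ J') (h : GC f J p) : GC f J' p := by
  obtain ⟨c, hc⟩ := h
  exact ⟨c, hc.filter_mono (nhdsWithin_mono _ (compl_subset_compl.2 hJ))⟩

theorem exists_germ_of_isPreconnected {f : X → ℤˣ} {S : Set X} (hS : IsPreconnected S)
    (hJ : Dense Jᶜ) (h : ∀ q ∈ S, GC f J q) :
    ∃ c, ∀ q ∈ S, ∀ᶠ y in 𝓝[Jᶜ] q, f y = c := by
  rcases S.eq_empty_or_nonempty with rfl | ⟨q0, hq0⟩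
  · exact ⟨1, by simp⟩
  obtain ⟨c, hc⟩ := h q0 hq0
  refine ⟨c, ?_⟩
  set U := {q : X | ∀ᶠ y in 𝓝[Jᶜ] q, f y = c}
  set V := {q : X | ∀ᶠ y in 𝓝[Jᶜ] q, f y = -c}
  have hU : IsOpen U := isOpen_iff_mem_nhds.2 fun q hq => eventually_nhds_nhdsWithin.2 hq
  have hV : IsOpen V := isOpen_iff_mem_nhds.2 fun q hq => eventually_nhds_nhdsWithin.2 hq
  have hUV : S ⊆ U ∪ V := by
    intro q hq
    obtain ⟨d, hd⟩ := h q hq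
    rcases Int.units_eq_one_or d with rfl | rfl <;> rcases Int.units_eq_one_or c with rfl | rfl <;>
      simp_all [U, V]
  have hdisj : Disjoint U V := by
    rw [Set.disjoint_left]
    intro q hqU hqV
    have : (𝓝[Jᶜ] q).NeBot := mem_closure_iff_nhdsWithin_neBot.1 (hJ q)
    have hqU : ∀ᶠ y in 𝓝[Jᶜ] q, f y = c := hqU
    have hqV : ∀ᶠ y in 𝓝[Jᶜ] q, f y = -c := hqV
    obtain ⟨y, h1, h2⟩ := (hqU.and hqV).exists
    rw [h1] at h2
    rcases Int.units_eq_one_or c with rfl | rfl <;> simp at h2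
  exact hS.subset_left_of_subset_union hU hV hdisj hUV ⟨q0, hq0, hc⟩

theorem eq_of_isPreconnected {f : X → ℤˣ} {S : Set X} (hS : IsPreconnected S)
    (hJ : Dense Jᶜ) (h : ∀ q ∈ S, GC f J q) {x y : X} (hx : x ∈ S \ J) (hy : y ∈ S \ J) :
    f x = f y := by
  obtain ⟨c, hc⟩ := exists_germ_of_isPreconnected hS hJ h
  rw [(hc x hx.1).self_of_nhdsWithin hx.2, (hc y hy.1).self_of_nhdsWithin hy.2]

theorem isPreconnected_im_pos : IsPreconnected {z : ℂ | 0 < z.im} :=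
  (convex_halfSpace_im_gt 0).isPreconnected

theorem isPreconnected_im_neg : IsPreconnected {z : ℂ | z.im < 0} :=
  (convex_halfSpace_im_lt 0).isPreconnected

theorem eq_on_half {f : X → ℤˣ} {ψ : ℂ → X} (hψ : IsOpenEmbedding ψ) (hJ : ∀ z, ψ z ∈ J ↔ z.im = 0)
    (h : ∀ z : ℂ, z.im ≠ 0 → GC f J (ψ z)) {S : Set ℂ} (hS : IsPreconnected S) (hSo : IsOpen S)
    (hS0 : ∀ z ∈ S, z.im ≠ 0) {z w : ℂ} (hz : z ∈ S) (hw : w ∈ S) : f (ψ z) = f (ψ w) := by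
  refine eq_of_isPreconnected (X := ℂ) (J := ∅) (f := f ∘ ψ) hS (by simp) (fun q hq => ?_)
    ⟨hz, by simp⟩ ⟨hw, by simp⟩
  have h1 := (gc_comp_iff (hψ.map_nhds_eq q)).2 (h q (hS0 q hq))
  obtain ⟨c, hc⟩ := h1
  refine ⟨c, ?_⟩
  rw [compl_empty, nhdsWithin_univ]
  rw [eventually_nhdsWithin_iff] at hc
  filter_upwards [hc, hSo.mem_nhds hq] with y hy hyS
  exact hy (by simpa [hJ] using hS0 y hyS)

theorem exists_halves {f : X → ℤˣ} {ψ : ℂ → X} (h1 : IsOpenEmbedding ψ)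
    (h3 : ∀ z, ψ z ∈ J ↔ z.im = 0) (hg : ∀ z : ℂ, z.im ≠ 0 → GC f J (ψ z)) :
    ∃ a b, (∀ z : ℂ, 0 < z.im → f (ψ z) = a) ∧ (∀ z : ℂ, z.im < 0 → f (ψ z) = b) ∧
      ∀ z : ℂ, z.im = 0 → (GC f J (ψ z) ↔ a = b) := by
  have ha : ∀ z : ℂ, 0 < z.im → f (ψ z) = f (ψ Complex.I) := fun z hz =>
    eq_on_half h1 h3 hg isPreconnected_im_pos (isOpen_lt continuous_const Complex.continuous_im)
      (fun w hw => (ne_of_gt hw)) hz (by simp)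
  have hb : ∀ z : ℂ, z.im < 0 → f (ψ z) = f (ψ (-Complex.I)) := fun z hz =>
    eq_on_half h1 h3 hg isPreconnected_im_neg (isOpen_lt Complex.continuous_im continuous_const)
      (fun w hw => (ne_of_lt hw)) hz (by simp)
  refine ⟨_, _, ha, hb, fun z hz => ?_⟩
  rw [← gc_comp_iff (h1.map_nhds_eq z)]
  have hJ : ψ ⁻¹' J = {z : ℂ | z.im = 0} := by ext; simp [h3]
  constructor
  · rintro ⟨c, hc⟩
    rw [hJ, eventually_nhdsWithin_iff, Metric.eventually_nhds_iff] at hc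
    obtain ⟨ε, hε, hc⟩ := hc
    have e1 := @hc (z + (ε / 2 : ℝ) * Complex.I) (by
      simp [abs_of_pos hε]; linarith) (by simp [hz, hε.ne'])
    have e2 := @hc (z - (ε / 2 : ℝ) * Complex.I) (by
      simp [abs_of_pos hε]; linarith) (by simp [hz, hε.ne'])
    rw [Function.comp_apply, ha _ (by simp [hz, hε])] at e1
    rw [Function.comp_apply, hb _ (by simp [hz, hε])] at e2
    rw [e1, e2]
  · intro hab
    refine ⟨f (ψ Complex.I), ?_⟩
    rw [hJ]
    filter_upwards [self_mem_nhdsWithin] with y hy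
    rcases lt_or_gt_of_ne (show y.im ≠ 0 from hy) with h | h
    · exact (hb y h).trans hab.symm
    · exact ha y h

theorem Flat.exists_chart {P : X → Prop} (h : Flat J p) (hf : ∀ᶠ q in 𝓝 p, q ∉ J → P q) :
    ∃ ψ : ℂ → X, IsOpenEmbedding ψ ∧ ψ 0 = p ∧ (∀ z, ψ z ∈ J ↔ z.im = 0) ∧
      ∀ z : ℂ, z.im ≠ 0 → P (ψ z) := by
  obtain ⟨ψ, h1, h2, h3, h4⟩ := h.exists_small hf
  exact ⟨ψ, h1, h2, h3, fun z hz => h4 (mem_range_self z) (by rwa [h3])⟩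

theorem Flat.gc_dichotomy {f : X → ℤˣ} (h : Flat J p) (hf : ∀ᶠ q in 𝓝 p, q ∉ J → GC f J q) :
    ∀ᶠ q in 𝓝 p, q ∈ J → (GC f J q ↔ GC f J p) := by
  obtain ⟨ψ, h1, h2, h3, h4⟩ := h.exists_chart hf
  obtain ⟨a, b, -, -, hab⟩ := exists_halves h1 h3 h4
  have : range ψ ∈ 𝓝 p := h2 ▸ h1.isOpen_range.mem_nhds (mem_range_self 0)
  filter_upwards [this]
  rintro - ⟨z, rfl⟩ hz
  rw [hab z ((h3 z).1 hz), ← h2, hab 0 (by simp)]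

theorem Flat.gc_mul {f g : X → ℤˣ} (h : Flat J p) (hf : ∀ᶠ q in 𝓝 p, q ∉ J → GC f J q)
    (hg : ∀ᶠ q in 𝓝 p, q ∉ J → GC g J q) (hfp : ¬ GC f J p) (hgp : ¬ GC g J p) :
    GC (fun x => f x * g x) J p := by
  have hfg : ∀ᶠ q in 𝓝 p, q ∉ J → GC f J q ∧ GC g J q ∧ GC (fun x => f x * g x) J q := by
    filter_upwards [hf, hg] with q h1 h2 h3 using ⟨h1 h3, h2 h3, (h1 h3).mul (h2 h3)⟩
  obtain ⟨ψ, h1, h2, h3, h4⟩ := h.exists_chart hfg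
  obtain ⟨a, b, ha, hb, hab⟩ := exists_halves h1 h3 fun z hz => (h4 z hz).1
  obtain ⟨a', b', ha', hb', hab'⟩ := exists_halves h1 h3 fun z hz => (h4 z hz).2.1
  obtain ⟨c, d, hc, hd, hcd⟩ := exists_halves h1 h3 fun z hz => (h4 z hz).2.2
  rw [← h2, hab 0 rfl] at hfp
  rw [← h2, hab' 0 rfl] at hgp
  rw [← h2, hcd 0 rfl, ← hc Complex.I (by simp), ← hd (-Complex.I) (by simp), ha _ (by simp),
    ha' _ (by simp), hb _ (by simp), hb' _ (by simp), (Int.units_ne_iff_eq_neg.1 hfp),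
    (Int.units_ne_iff_eq_neg.1 hgp), neg_mul_neg]

theorem Flat.mem_closure (h : Flat J p) : p ∈ closure Jᶜ := by
  obtain ⟨ψ, h1, h2, h3⟩ := h
  have hlim : Tendsto (fun t : ℝ => ψ (t * Complex.I)) (𝓝[≠] 0) (𝓝 p) := by
    have : Continuous fun t : ℝ => ψ (t * Complex.I) := by
      have := h1.continuous; fun_prop
    have h := this.tendsto 0
    simp only [Complex.ofReal_zero, zero_mul, h2] at h
    exact h.mono_left nhdsWithin_le_nhds
  refine mem_closure_of_tendsto hlim ?_
  filter_upwards [self_mem_nhdsWithin] with t ht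
  simpa [h3] using ht

theorem Surface.nhdsNE_neBot [Surface X] (p : X) : (𝓝[≠] p).NeBot := by
  obtain ⟨ψ, h1, h2⟩ := Surface.exists_chart p
  have : Tendsto ψ (𝓝[≠] 0) (𝓝[≠] p) := by
    rw [← h2]
    exact tendsto_nhdsWithin_iff.2 ⟨
      (h1.continuous.tendsto 0 |>.mono_left nhdsWithin_le_nhds), by
      filter_upwards [self_mem_nhdsWithin] with z hz h using hz (h1.injective h)⟩
  exact this.neBot

theorem Thin.eventually_flat [T1Space X] (h : Thin J) (p : X) :
    ∀ᶠ q in 𝓝[≠] p, q ∈ J → Flat J q := by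
  have h1 : ({q ∈ J | ¬ Flat J q} \ {p})ᶜ ∈ 𝓝 p :=
    (h.2.subset sdiff_subset).isClosed.isOpen_compl.mem_nhds (by simp)
  rw [eventually_nhdsWithin_iff]
  filter_upwards [h1] with q hq hqp hqJ
  by_contra hc
  exact hq ⟨⟨hqJ, hc⟩, hqp⟩

theorem Thin.dense [T1Space X] [Surface X] (h : Thin J) : Dense Jᶜ := by
  intro p
  have : p ∈ closure (closure Jᶜ) := by
    have := Surface.nhdsNE_neBot p
    refine mem_closure_of_tendsto (f := id) (b := 𝓝[≠] p) (tendsto_id'.2 nhdsWithin_le_nhds) ?_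
    filter_upwards [h.eventually_flat p] with q hq
    by_cases hqJ : q ∈ J
    · exact (hq hqJ).mem_closure
    · exact subset_closure hqJ
  rwa [closure_closure] at this

theorem gc_of_punctured [Surface X] {f : X → ℤˣ} (hJ : Dense Jᶜ) (hp : p ∈ J)
    (h : ∀ᶠ q in 𝓝[≠] p, GC f J q) : GC f J p := by
  rw [eventually_nhdsWithin_iff] at h
  obtain ⟨ψ, h1, h2, h3⟩ := Surface.exists_small h
  have hconn : IsPreconnected (ψ '' {0}ᶜ) :=
    (isConnected_compl_singleton_of_one_lt_rank (by simp) 0).isPreconnected.image ψ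
      h1.continuous.continuousOn
  have hg : ∀ q ∈ ψ '' {0}ᶜ, GC f J q := by
    rintro - ⟨z, hz, rfl⟩
    exact h3 (mem_range_self z) (by rw [← h2]; exact fun h => hz (h1.injective h))
  obtain ⟨c, hc⟩ := exists_germ_of_isPreconnected hconn hJ hg
  refine ⟨c, ?_⟩
  rw [eventually_nhdsWithin_iff]
  have : range ψ ∈ 𝓝 p := h2 ▸ h1.isOpen_range.mem_nhds (mem_range_self 0)
  filter_upwards [this]
  rintro - ⟨z, rfl⟩ hz
  have hz0 : z ≠ 0 := by rintro rfl; exact hz (h2 ▸ hp)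
  exact (hc _ ⟨z, hz0, rfl⟩).self_of_nhdsWithin hz

end basic

theorem exists_sqrt {a : ℝ → ℂ} (ha : ContinuousOn a (Icc 0 1)) (h0 : a 0 = 0) (h1 : a 1 ≠ 0) :
    ∃ h : ℂ → ℂ, ContinuousOn h (ball 0 ‖a 1‖ \ a '' Icc 0 1) ∧
      ∀ z ∈ ball 0 ‖a 1‖ \ a '' Icc 0 1, h z ^ 2 = z := by
  set A := a '' Icc 0 1
  have hA : ∀ (t : unitInterval) (z : (Aᶜ : Set ℂ)), (z : ℂ) - a t ≠ 0 := fun t z h =>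
    z.2 ⟨t, t.2, (sub_eq_zero.1 h).symm⟩
  have hz0 : ∀ z : (Aᶜ : Set ℂ), (z : ℂ) ≠ 0 := fun z h => z.2 ⟨0, by simp, by rw [h0, h]⟩
  have hac : Continuous fun t : unitInterval => a t := ha.domRestrict
  let H : C(unitInterval × (Aᶜ : Set ℂ), {x : ℂ // x ≠ 0}) :=
    ⟨fun q => ⟨q.2 / (q.2 - a q.1), div_ne_zero (hz0 _) (hA _ _)⟩, by
      refine Continuous.subtype_mk (Continuous.div (by fun_prop) ?_ fun q => hA _ _) _
      exact (continuous_subtype_val.comp continuous_snd).sub (hac.comp continuous_fst)⟩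
  have cov := isCoveringMap_npow (𝕜 := ℂ) 2 (by simp)
  let F : C((Aᶜ : Set ℂ), {x : ℂ // x ≠ 0}) := .const _ ⟨1, one_ne_zero⟩
  have H0 : ∀ z : (Aᶜ : Set ℂ), H (0, z) = ⟨(F z : ℂ) ^ 2, pow_ne_zero 2 (F z).2⟩ := by
    intro z
    ext
    simp [H, F, h0, hz0]
  obtain ⟨G, hG⟩ : ∃ G : C(unitInterval × (Aᶜ : Set ℂ), {x : ℂ // x ≠ 0}),
      ∀ z : (Aᶜ : Set ℂ), (G (1, z) : ℂ) ^ 2 = z / (z - a 1) :=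
    ⟨cov.liftHomotopy H F H0, fun z =>
      (congrArg Subtype.val (congrFun (cov.liftHomotopy_lifts H F H0) (1, z))).trans
        (by simp [H])⟩
  classical
  let g : ℂ → ℂ := fun z => if hz : z ∈ Aᶜ then G (1, ⟨z, hz⟩) else 0
  have hg : ContinuousOn g Aᶜ := by
    rw [continuousOn_iff_continuous_domRestrict]
    have : (Aᶜ).domRestrict g = fun z => (G (1, z) : ℂ) := by
      ext z
      rw [domRestrict_apply]
      exact dif_pos z.2
    rw [this]
    fun_prop
  have hre : ∀ z ∈ ball (0 : ℂ) ‖a 1‖, 1 - z / a 1 ∈ Complex.slitPlane := by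
    intro z hz
    left
    have : ‖z / a 1‖ < 1 := by
      rw [norm_div, div_lt_one (norm_pos_iff.2 h1)]
      simpa using hz
    have := (Complex.re_le_norm (z / a 1)).trans_lt this
    simpa using this
  refine ⟨fun z => g z * ((-a 1) ^ ((2 : ℕ) : ℂ)⁻¹ * (1 - z / a 1) ^ ((2 : ℕ) : ℂ)⁻¹), ?_, ?_⟩
  · refine (hg.mono fun z hz => hz.2).mul (continuousOn_const.mul ?_)
    refine ContinuousOn.cpow_const (by fun_prop) fun z hz => hre z hz.1
  · rintro z ⟨hz, hzA⟩
    have h2 : z - a 1 ≠ 0 := hA 1 ⟨z, hzA⟩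
    have : g z ^ 2 = z / (z - a 1) := by
      simp only [g, dif_pos (show z ∈ Aᶜ from hzA)]
      exact hG ⟨z, hzA⟩
    rw [mul_pow, mul_pow, Complex.cpow_nat_inv_pow _ two_ne_zero,
      Complex.cpow_nat_inv_pow _ two_ne_zero, this]
    field_simp
    ring

/-- The arc `a` issues from `v` and `J` is locally flat at all its other points. -/
structure Branch {X : Type*} [TopologicalSpace X] (J : Set X) (v : X) (a : ℝ → X) : Prop where
  cont : ContinuousOn a (Icc 0 1)
  inj : InjOn a (Icc 0 1)
  zero : a 0 = v
  flat : ∀ t ∈ Ioc (0 : ℝ) 1, Flat J (a t)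

section branch
variable {X : Type*} [TopologicalSpace X] {J : Set X} {v : X} {a : ℝ → X}

theorem Branch.exists_small [T2Space X] (h : Branch J v a) {W : Set X} (hW : W ∈ 𝓝 v) :
    ∃ t₀ ∈ Ioc (0 : ℝ) 1, a '' Icc 0 t₀ ⊆ W ∧
      ∀ᶠ q in 𝓝 v, q ∈ a '' Icc 0 1 → q ∈ a '' Ico 0 t₀ := by
  have h0 : a ⁻¹' W ∈ 𝓝[Icc 0 1] 0 :=
    (h.cont 0 (by simp)).preimage_mem_nhdsWithin (by rwa [h.zero])
  rw [mem_nhdsWithin_iff] at h0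
  obtain ⟨ε, hε, h0⟩ := h0
  refine ⟨min (ε / 2) 1, ⟨by positivity, min_le_right _ _⟩, ?_, ?_⟩
  · rintro - ⟨t, ht, rfl⟩
    refine h0 ⟨?_, ht.1, ht.2.trans (min_le_right _ _)⟩
    have := ht.2.trans (min_le_left _ _)
    rw [mem_ball, Real.dist_eq, sub_zero, abs_of_nonneg ht.1]
    linarith
  · have hc : IsCompact (a '' Icc (min (ε / 2) 1) 1) :=
      isCompact_Icc.image_of_continuousOn (h.cont.mono (Icc_subset_Icc_left (by positivity)))
    have hv : v ∉ a '' Icc (min (ε / 2) 1) 1 := by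
      rintro ⟨t, ht, htv⟩
      have h1 : 0 < min (ε / 2) 1 := by positivity
      have : t = 0 := h.inj ⟨h1.le.trans ht.1, ht.2⟩ (by simp) (htv.trans h.zero.symm)
      linarith [ht.1]
    filter_upwards [hc.isClosed.isOpen_compl.mem_nhds hv]
    rintro - hq ⟨t, ht, rfl⟩
    refine ⟨t, ⟨ht.1, ?_⟩, rfl⟩
    by_contra hc
    exact hq ⟨t, ⟨not_lt.1 hc, ht.2⟩, rfl⟩

theorem Branch.subset (h : Branch J v a) {t : ℝ} (ht : t ∈ Ioc (0 : ℝ) 1) : a t ∈ J :=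
  (h.flat t ht).mem

theorem Branch.mem (h : Branch J v a) (hJ : IsClosed J) : v ∈ J := by
  have : Tendsto a (𝓝[Ioc 0 1] 0) (𝓝 v) := by
    rw [← h.zero]
    exact (h.cont 0 (by simp)).mono_left (nhdsWithin_mono _ Ioc_subset_Icc_self)
  have hne : (𝓝[Ioc (0 : ℝ) 1] 0).NeBot := by
    rw [← mem_closure_iff_nhdsWithin_neBot, closure_Ioc (by norm_num)]
    simp
  exact hJ.mem_of_tendsto this (by
    filter_upwards [self_mem_nhdsWithin] with t ht using h.subset ht)

theorem Branch.image_subset (h : Branch J v a) (hJ : IsClosed J) : a '' Icc 0 1 ⊆ J := by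
  rintro - ⟨t, ht, rfl⟩
  rcases ht.1.eq_or_lt with rfl | h0
  · rw [h.zero]; exact h.mem hJ
  · exact h.subset ⟨h0, ht.2⟩

/-- Along a flat piece of `J` the germ of `f` is either everywhere or nowhere constant. -/
theorem gc_iff_of_isPreconnected {f : X → ℤˣ} {S : Set ℝ} (hS : IsPreconnected S)
    (ha : ContinuousOn a S) (hflat : ∀ t ∈ S, Flat J (a t))
    (hf : ∀ t ∈ S, ∀ᶠ q in 𝓝 (a t), q ∉ J → GC f J q) {t t' : ℝ} (ht : t ∈ S) (ht' : t' ∈ S) :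
    GC f J (a t) ↔ GC f J (a t') := by
  refine hS.induction₂ (fun t t' => GC f J (a t) ↔ GC f J (a t')) (fun x hx => ?_)
    (fun _ _ _ _ _ _ h1 h2 => h1.trans h2) (fun _ _ _ _ h => h.symm) ht ht'
  have := (ha x hx).eventually ((hflat x hx).gc_dichotomy (hf x hx))
  filter_upwards [this, self_mem_nhdsWithin] with y hy hyS
  exact (hy (hflat y hyS).mem).symm

end branch

theorem map_sq_nhds {u : ℂ} (hu : u ≠ 0) : map (fun z : ℂ => z ^ 2) (𝓝 u) = 𝓝 (u ^ 2) := by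
  have := (hasStrictDerivAt_pow 2 u).map_nhds_eq (by simpa using hu)
  simpa using this

theorem Flat.sq {J : Set ℂ} {u : ℂ} (hu : u ≠ 0) (h : Flat J (u ^ 2)) :
    Flat ((fun z : ℂ => z ^ 2) ⁻¹' J) u := by
  have hd := (hasStrictDerivAt_pow 2 u).hasStrictFDerivAt_equiv (by simpa using hu)
  exact Flat.preimage (Φ := fun z : ℂ => z ^ 2) (hd.toOpenPartialHomeomorph _)
    (fun _ _ => rfl) hd.mem_toOpenPartialHomeomorph_source h

theorem dense_sq {J : Set ℂ} (hJ : Dense Jᶜ) : Dense ((fun z : ℂ => z ^ 2) ⁻¹' J)ᶜ := by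
  have h1 : ∀ u : ℂ, u ≠ 0 → u ∈ closure ((fun z : ℂ => z ^ 2) ⁻¹' J)ᶜ := fun u hu => by
    rw [mem_closure_iff_nhdsWithin_neBot, ← preimage_compl]
    have h := map_nhdsWithin_preimage (map_sq_nhds hu) Jᶜ
    have := mem_closure_iff_nhdsWithin_neBot.1 (hJ (u ^ 2))
    rw [← h] at this
    exact this.of_map
  intro u
  have : closure ({0}ᶜ : Set ℂ) ⊆ closure ((fun z : ℂ => z ^ 2) ⁻¹' J)ᶜ :=
    closure_minimal (fun u hu => h1 u hu) isClosed_closure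
  exact this (dense_compl_singleton 0 u)

theorem isPreconnected_punctured_ball (r : ℝ) : IsPreconnected (ball (0 : ℂ) r \ {0}) := by
  rcases le_or_gt r 0 with hr | hr
  · rw [ball_eq_empty.2 hr]; simp [isPreconnected_empty]
  obtain ⟨σ, h1, h2, h3, h4⟩ := exists_radial_embedding hr
  have : ball (0 : ℂ) r \ {0} = σ '' {0}ᶜ := by
    rw [image_compl_eq_range_sdiff_image h1.injective, h3, image_singleton, h2]
  rw [this]
  exact (isConnected_compl_singleton_of_one_lt_rank (by simp) 0).isPreconnected.image σ
      h1.continuous.continuousOn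

/-- An odd sign function on a punctured disc has a nonconstant germ somewhere. -/
theorem not_forall_gc_of_odd {J : Set ℂ} (hJ : Dense Jᶜ) {s : ℂ → ℤˣ} {r : ℝ} (hr : 0 < r)
    (hsym : ∀ u, u ∈ J ↔ -u ∈ J) (hodd : ∀ u ∈ ball (0 : ℂ) r, u ∉ J → s (-u) = - s u)
    (h : ∀ u ∈ ball (0 : ℂ) r, u ≠ 0 → GC s J u) : False := by
  obtain ⟨u, hu, huJ⟩ := (hJ.sdiff_singleton 0).inter_open_nonempty (ball 0 r) isOpen_ball
    ⟨0, by simpa⟩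
  have := eq_of_isPreconnected (isPreconnected_punctured_ball r) hJ (fun q hq => h q hq.1 hq.2)
    (x := u) (y := -u) ⟨⟨hu, huJ.2⟩, huJ.1⟩
    ⟨⟨by simpa using hu, by simpa using huJ.2⟩, fun h => huJ.1 ((hsym u).2 h)⟩
  rw [hodd u hu huJ.1] at this
  rcases Int.units_eq_one_or (s u) with h | h <;> rw [h] at this <;> simp at this

theorem Branch.exists_double {J : Set ℂ} {a : ℝ → ℂ} (ha : Branch J 0 a) (hJc : IsClosed J)
    (hJ : Dense Jᶜ) : ∃ s : ℂ → ℤˣ, ∃ r > 0,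
      (∀ u ∈ ball (0 : ℂ) r, u ^ 2 ∉ J → s (-u) = - s u) ∧
      (∀ u ∈ ball (0 : ℂ) r, u ≠ 0 → (GC s ((fun z : ℂ => z ^ 2) ⁻¹' J) u ↔
        u ^ 2 ∉ a '' Icc 0 1)) := by
  set A := a '' Icc 0 1
  have hA : A ⊆ J := ha.image_subset hJc
  have h0J : (0 : ℂ) ∈ A := ⟨0, by simp, ha.zero⟩
  have ha1 : a 1 ≠ 0 := fun h => by
    have : (1 : ℝ) = 0 := ha.inj (by simp) (by simp) (h.trans ha.zero.symm)
    norm_num at this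
  obtain ⟨h, hc, hsq⟩ := exists_sqrt ha.cont ha.zero ha1
  set R := ball (0 : ℂ) ‖a 1‖ \ A
  have hAc : IsClosed A := (isCompact_Icc.image_of_continuousOn ha.cont).isClosed
  have hRo : IsOpen R := isOpen_ball.sdiff hAc
  let s : ℂ → ℤˣ := fun u => if 0 < (h (u ^ 2) / u).re then 1 else -1
  have hR0 : ∀ u : ℂ, u ^ 2 ∈ R → u ≠ 0 := by
    rintro u hu rfl
    exact hu.2 (by simpa using h0J)
  have hpm : ∀ u, u ^ 2 ∈ R → h (u ^ 2) / u = 1 ∨ h (u ^ 2) / u = -1 := fun u hu => by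
    refine sq_eq_sq_iff_eq_or_eq_neg.1 ?_
    rw [div_pow, hsq _ hu, div_self (pow_ne_zero 2 (hR0 u hu)), one_pow]
  have hodd : ∀ u, u ^ 2 ∈ R → s (-u) = - s u := fun u hu => by
    simp only [s, neg_sq, div_neg]
    rcases hpm u hu with h | h <;> rw [h] <;> norm_num
  have hsq_cont : Continuous fun z : ℂ => z ^ 2 := by fun_prop
  have hloc : ∀ u, u ^ 2 ∈ R → ∀ᶠ w in 𝓝 u, s w = s u := fun u hu => by
    have hcont : ContinuousAt (fun w => h (w ^ 2) / w) u :=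
      (ContinuousAt.comp (f := fun z : ℂ => z ^ 2) (hc.continuousAt (hRo.mem_nhds hu))
        hsq_cont.continuousAt).div continuousAt_id (hR0 u hu)
    have hev := hcont.eventually (Metric.ball_mem_nhds _ one_pos)
    filter_upwards [hev, hsq_cont.continuousAt.eventually (hRo.mem_nhds hu)] with w hw hwR
    simp only [s]
    rw [dist_eq_norm] at hw
    rcases hpm u hu with h1 | h1 <;> rcases hpm w hwR with h2 | h2 <;> rw [h1, h2] at hw <;>
      rw [h1, h2] <;> norm_num at hw
  obtain ⟨t₀, ht₀, hsub, hev⟩ := ha.exists_small (ball_mem_nhds (0 : ℂ) (norm_pos_iff.2 ha1))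
  have hball : ∀ᶠ u in 𝓝 (0 : ℂ), u ^ 2 ∈ ball (0 : ℂ) ‖a 1‖ ∧ (u ^ 2 ∈ A → u ^ 2 ∈ a '' Ico 0 t₀) :=
    (hsq_cont.tendsto' 0 0 (by simp)).eventually
      (Eventually.and (ball_mem_nhds (0 : ℂ) (norm_pos_iff.2 ha1)) hev)
  obtain ⟨r, hr, hball⟩ := Metric.eventually_nhds_iff_ball.1 hball
  set J' := (fun z : ℂ => z ^ 2) ⁻¹' J
  have hsymJ : ∀ u, u ∈ J' ↔ -u ∈ J' := fun u => by simp [J']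
  have hoff : ∀ u, u ^ 2 ∈ R → GC s J' u := fun u hu => gc_of_eventually (hloc u hu)
  have hnear : ∀ u : ℂ, u ^ 2 ∈ ball (0 : ℂ) ‖a 1‖ → ∀ᶠ w in 𝓝 u, w ∉ J' → w ^ 2 ∈ R := fun u hu => by
    filter_upwards [hsq_cont.continuousAt.eventually (isOpen_ball.mem_nhds hu)] with w hw hwJ
    exact ⟨hw, fun h => hwJ (hA h)⟩
  have hneg1 : ∀ u : ℂ, u ^ 2 ∈ ball (0 : ℂ) ‖a 1‖ → GC s J' (-u) → GC s J' u := by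
    rintro u hu hgc
    obtain ⟨c, hc⟩ : GC (s ∘ Homeomorph.neg ℂ) (Homeomorph.neg ℂ ⁻¹' J') u :=
      (gc_comp_iff ((Homeomorph.neg ℂ).map_nhds_eq u)).2 hgc
    have hJ'' : Homeomorph.neg ℂ ⁻¹' J' = J' := ext fun u => (hsymJ u).symm
    rw [hJ''] at hc
    refine ⟨-c, ?_⟩
    rw [eventually_nhdsWithin_iff] at hc ⊢
    filter_upwards [hc, hnear u hu] with w hw hwR hwJ
    rw [← hw hwJ, ← neg_eq_iff_eq_neg, ← hodd w (hwR hwJ)]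
    rfl
  have hneg : ∀ u u' : ℂ, u ^ 2 ∈ ball (0 : ℂ) ‖a 1‖ → u ^ 2 = u' ^ 2 → (GC s J' u → GC s J' u') := by
    intro u u' hu huu hgc
    rcases sq_eq_sq_iff_eq_or_eq_neg.1 huu with rfl | rfl
    · exact hgc
    · exact hneg1 u' (huu ▸ hu) hgc
  have hconst : ∀ t ∈ Ioo 0 t₀, ∀ t' ∈ Ioo 0 t₀, ∀ u u' : ℂ, u ^ 2 = a t → u' ^ 2 = a t' →
      (GC s J' u → GC s J' u') := by
    intro t ht t' ht'
    have hS : ∀ t ∈ Ioo 0 t₀, a t ∈ ball (0 : ℂ) ‖a 1‖ := fun t ht =>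
      hsub ⟨t, Ioo_subset_Icc_self ht, rfl⟩
    have hIoo : ∀ t ∈ Ioo 0 t₀, t ∈ Ioc (0 : ℝ) 1 := fun t ht => ⟨ht.1, ht.2.le.trans ht₀.2⟩
    have key := isPreconnected_Ioo.induction₂ (s := Ioo 0 t₀) (fun t t' => ∀ u u' : ℂ, u ^ 2 = a t → u' ^ 2 = a t' →
      (GC s J' u ↔ GC s J' u')) (fun t ht => ?_) ?_ ?_ ht ht'
    · exact fun u u' h1 h2 => (key u u' h1 h2).1
    · obtain ⟨u, hu⟩ := IsAlgClosed.exists_pow_nat_eq (a t) (n := 2) (by norm_num)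
      have hu0 : u ≠ 0 := by
        rintro rfl
        have : t = 0 := ha.inj ⟨ht.1.le, (hIoo t ht).2⟩ (by simp) (by rw [← hu, ha.zero]; simp)
        exact ht.1.ne' this
      have hflat : Flat J' u := Flat.sq hu0 (hu ▸ ha.flat t (hIoo t ht))
      have hN := hflat.gc_dichotomy (f := s) (by
        filter_upwards [hnear u (hu ▸ hS t ht)] with w hw hwJ using hoff w (hw hwJ))
      have hN' : (fun z : ℂ => z ^ 2) '' {q | q ∈ J' → (GC s J' q ↔ GC s J' u)} ∈ 𝓝 (a t) := by
        rw [← hu, ← map_sq_nhds hu0]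
        exact image_mem_map hN
      have hat : ContinuousWithinAt a (Ioo 0 t₀) t :=
        (ha.cont t ⟨ht.1.le, (hIoo t ht).2⟩).mono fun t ht => ⟨ht.1.le, (hIoo t ht).2⟩
      filter_upwards [hat.preimage_mem_nhdsWithin hN', self_mem_nhdsWithin] with t' ht' htS u1 u2 h1 h2
      obtain ⟨w, hw, hwt⟩ := ht'
      simp only at hwt
      have hwJ : w ∈ J' := by
        simp only [J', mem_preimage, hwt]
        exact ha.subset (hIoo t' htS)
      have e1 : GC s J' u1 ↔ GC s J' u :=
        ⟨hneg _ _ (h1 ▸ hS t ht) (h1.trans hu.symm), hneg _ _ (hu ▸ hS t ht) (hu.trans h1.symm)⟩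
      have e2 : GC s J' u2 ↔ GC s J' w :=
        ⟨hneg _ _ (h2 ▸ hS t' htS) (h2.trans hwt.symm), hneg _ _ (hwt ▸ hS t' htS) (hwt.trans h2.symm)⟩
      rw [e1, e2, hw hwJ]
    · intro x y z _ _ _ h1 h2 u u' hu hu'
      obtain ⟨w, hw⟩ := IsAlgClosed.exists_pow_nat_eq (a y) (n := 2) (by norm_num)
      exact (h1 u w hu hw).trans (h2 w u' hw hu')
    · intro x y _ _ h u u' hu hu'
      exact (h u' u hu' hu).symm
  have hpar : ∀ u ∈ ball (0 : ℂ) r, u ≠ 0 → u ^ 2 ∈ A → ∃ t ∈ Ioo 0 t₀, u ^ 2 = a t := by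
    intro u hu hu0 huA
    obtain ⟨t, ht, htu⟩ := (hball u hu).2 huA
    refine ⟨t, ⟨ht.1.lt_of_ne ?_, ht.2⟩, htu.symm⟩
    rintro rfl
    rw [ha.zero] at htu
    exact pow_ne_zero 2 hu0 htu.symm
  refine ⟨s, r, hr, fun u hu huJ => hodd u ⟨(hball u hu).1, fun h => huJ (hA h)⟩,
    fun u hu hu0 => ⟨fun hgc huA => ?_, fun huA => hoff u ⟨(hball u hu).1, huA⟩⟩⟩
  refine not_forall_gc_of_odd (dense_sq hJ) hr hsymJ (s := s)
    (fun u hu huJ => hodd u ⟨(hball u hu).1, fun h => huJ (hA h)⟩) fun w hw hw0 => ?_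
  by_cases hwA : w ^ 2 ∈ A
  · obtain ⟨t, ht, htu⟩ := hpar u hu hu0 huA
    obtain ⟨t', ht', htw⟩ := hpar w hw hw0 hwA
    exact hconst t ht t' ht' u w htu htw hgc
  · exact hoff w ⟨(hball w hw).1, hwA⟩

instance : Surface ℂ :=
  ⟨fun p => ⟨fun z => p + z, (Homeomorph.addLeft p).isOpenEmbedding, add_zero p⟩⟩

theorem GC.not_mul {X : Type*} [TopologicalSpace X] {J : Set X} {p : X} {f g : X → ℤˣ}
    (hf : GC f J p) (hg : ¬ GC g J p) : ¬ GC (fun x => f x * g x) J p := fun h =>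
  hg <| (hf.mul h).congr <| Eventually.of_forall fun x => by
    rw [← mul_assoc, Int.units_mul_self, one_mul]

theorem Branch.gc_endpoint_complex {J : Set ℂ} {a : ℝ → ℂ} (ha : Branch J 0 a) (hJc : IsClosed J)
    (hJ : Dense Jᶜ) {f : ℂ → ℤˣ} (hf : ∀ᶠ z in 𝓝 0, z ∉ a '' Icc 0 1 → GC f J z) :
    GC f J 0 := by
  set A := a '' Icc 0 1
  have hA : A ⊆ J := ha.image_subset hJc
  obtain ⟨s, r, hr, hodd, hs⟩ := ha.exists_double hJc hJ
  obtain ⟨W, hW, hWo, h0W⟩ := _root_.mem_nhds_iff.1 hf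
  obtain ⟨t₀, ht₀, hsub, hev⟩ := ha.exists_small (hWo.mem_nhds h0W)
  have hIoo : ∀ t ∈ Ioo 0 t₀, t ∈ Ioc (0 : ℝ) 1 := fun t ht => ⟨ht.1, ht.2.le.trans ht₀.2⟩
  have hfJ : ∀ z ∈ W, ∀ᶠ q in 𝓝 z, q ∉ J → GC f J q := fun z hz => by
    filter_upwards [hWo.mem_nhds hz] with q hq hqJ using hW hq fun h => hqJ (hA h)
  have hstat : ∀ t ∈ Ioo 0 t₀, ∀ t' ∈ Ioo 0 t₀, (GC f J (a t) ↔ GC f J (a t')) := fun t ht t' ht' =>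
    gc_iff_of_isPreconnected isPreconnected_Ioo
      (ha.cont.mono fun t ht => Ioc_subset_Icc_self (hIoo t ht))
      (fun t ht => ha.flat t (hIoo t ht))
      (fun t ht => hfJ _ (hsub ⟨t, Ioo_subset_Icc_self ht, rfl⟩)) ht ht'
  have hpar : ∀ z, z ∈ a '' Ico 0 t₀ → z ≠ 0 → ∃ t ∈ Ioo 0 t₀, a t = z := by
    rintro - ⟨t, ht, rfl⟩ h0
    refine ⟨t, ⟨ht.1.lt_of_ne ?_, ht.2⟩, rfl⟩
    rintro rfl
    exact h0 ha.zero
  by_cases hgc : ∃ t ∈ Ioo 0 t₀, GC f J (a t)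
  · obtain ⟨t, ht, hgc⟩ := hgc
    refine gc_of_punctured hJ (ha.mem hJc) ?_
    rw [eventually_nhdsWithin_iff]
    filter_upwards [hf, hev] with z h1 h2 h3
    by_cases hz : z ∈ A
    · obtain ⟨t', ht', rfl⟩ := hpar z (h2 hz) h3
      exact (hstat t ht t' ht').1 hgc
    · exact h1 hz
  · push Not at hgc
    exfalso
    have hcont : Continuous fun z : ℂ => z ^ 2 := by fun_prop
    have hball := (hcont.tendsto' 0 0 (by simp)).eventually (Eventually.and (hWo.mem_nhds h0W) hev)
    obtain ⟨r', hr', hball⟩ := Metric.eventually_nhds_iff_ball.1 hball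
    have hle : ∀ u, u ∈ ball (0 : ℂ) (min r r') → u ∈ ball (0 : ℂ) r ∧ u ∈ ball (0 : ℂ) r' :=
      fun u hu => ⟨ball_subset_ball (min_le_left _ _) hu, ball_subset_ball (min_le_right _ _) hu⟩
    set J' := (fun z : ℂ => z ^ 2) ⁻¹' J
    refine not_forall_gc_of_odd (dense_sq hJ) (lt_min hr hr') (s := fun u => f (u ^ 2) * s u)
      (fun u => by simp) (fun u hu huJ => ?_) fun u hu hu0 => ?_
    · rw [neg_sq, hodd u (hle u hu).1 huJ, mul_neg]
    · have hcomp := gc_comp_iff (f := f) (J := J) (map_sq_nhds hu0)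
      have hsu := hs u (hle u hu).1 hu0
      obtain ⟨huW, huA⟩ := hball u (hle u hu).2
      by_cases hA' : u ^ 2 ∈ A
      · obtain ⟨t, ht, htu⟩ := hpar _ (huA hA') (pow_ne_zero 2 hu0)
        refine Flat.gc_mul (Flat.sq hu0 (htu ▸ ha.flat t (hIoo t ht))) (f := f ∘ fun z => z ^ 2)
          ?_ ?_ ?_ ?_
        · filter_upwards [hcont.continuousAt.eventually (hfJ _ huW),
            isOpen_ne.mem_nhds hu0] with w hw hw0 hwJ
          exact (gc_comp_iff (map_sq_nhds hw0)).2 (hw hwJ)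
        · filter_upwards [isOpen_ball.mem_nhds (hle u hu).1,
            isOpen_ne.mem_nhds hu0] with w hw hw0 hwJ
          exact (hs w hw hw0).2 fun h => hwJ (hA h)
        · rw [hcomp, ← htu]
          exact hgc t ht
        · rw [hsu, not_not]; exact hA'
      · exact (hcomp.2 (hW huW hA')).mul (hsu.2 hA')

section
variable {X : Type*} [TopologicalSpace X] [T2Space X] {J : Set X} {v : X}

theorem Branch.pullback {a : ℝ → X} (ha : Branch J v a) {ψ : ℂ → X}
    (hψ : IsOpenEmbedding ψ) (h0 : ψ 0 = v) :
    ∃ a' : ℝ → ℂ, Branch (ψ ⁻¹' J) 0 a' ∧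
      (∀ᶠ z in 𝓝 0, z ∈ a' '' Icc 0 1 ↔ ψ z ∈ a '' Icc 0 1) ∧
      a' '' Icc 0 1 ⊆ ψ ⁻¹' (a '' Icc 0 1) := by
  obtain ⟨t₀, ht₀, hsub, hev⟩ := ha.exists_small (hψ.isOpen_range.mem_nhds ⟨0, h0⟩)
  have hc : ∀ t ∈ Icc (0 : ℝ) 1, ∃ z, ψ z = a (t₀ * t) := fun t ht =>
    hsub ⟨t₀ * t, ⟨mul_nonneg ht₀.1.le ht.1, mul_le_of_le_one_right ht₀.1.le ht.2⟩, rfl⟩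
  choose! a' ha' using hc
  have hmul : ∀ t ∈ Icc (0 : ℝ) 1, t₀ * t ∈ Icc (0 : ℝ) 1 := fun t ht =>
    ⟨mul_nonneg ht₀.1.le ht.1, mul_le_one₀ ht₀.2 ht.1 ht.2⟩
  refine ⟨a', ⟨?_, ?_, ?_, ?_⟩, ?_, ?_⟩
  · rw [hψ.isInducing.continuousOn_iff]
    refine ContinuousOn.congr (f := fun t => a (t₀ * t)) ?_ fun t ht => ha' t ht
    exact ha.cont.comp (by fun_prop) hmul
  · intro x hx y hy hxy
    have := ha.inj (hmul x hx) (hmul y hy) (by rw [← ha' x hx, ← ha' y hy, hxy])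
    exact mul_left_cancel₀ ht₀.1.ne' this
  · apply hψ.injective
    rw [ha' 0 (by simp), mul_zero, ha.zero, h0]
  · intro t ht
    refine Flat.preimage_embedding hψ ?_
    rw [ha' t (Ioc_subset_Icc_self ht)]
    exact ha.flat _ ⟨mul_pos ht₀.1 ht.1, mul_le_one₀ ht₀.2 ht.1.le ht.2⟩
  · have := hψ.continuous.continuousAt.eventually (h0.symm ▸ hev : ∀ᶠ q in 𝓝 (ψ 0), _)
    filter_upwards [this] with z hz
    constructor
    · rintro ⟨t, ht, rfl⟩
      exact ⟨_, hmul t ht, (ha' t ht).symm⟩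
    · intro h
      obtain ⟨t, ht, htz⟩ := hz h
      have ht' : t / t₀ ∈ Icc (0 : ℝ) 1 :=
        ⟨div_nonneg ht.1 ht₀.1.le, (div_le_one ht₀.1).2 ht.2.le⟩
      refine ⟨t / t₀, ht', hψ.injective ?_⟩
      rw [ha' _ ht', mul_div_cancel₀ _ ht₀.1.ne', htz]
  · rintro - ⟨t, ht, rfl⟩
    exact ⟨_, hmul t ht, (ha' t ht).symm⟩

omit [T2Space X] in
theorem dense_preimage_compl {Y : Type*} [TopologicalSpace Y] {ψ : Y → X} (hψ : IsOpenEmbedding ψ)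
    (hJ : Dense Jᶜ) : Dense (ψ ⁻¹' J)ᶜ := by
  rw [← preimage_compl]
  exact hJ.preimage hψ.isOpenMap

/-- The free end of a branch carries no monodromy. -/
theorem Branch.gc_endpoint [Surface X] {a : ℝ → X} (ha : Branch J v a) (hJc : IsClosed J)
    (hJ : Dense Jᶜ) {f : X → ℤˣ} (hf : ∀ᶠ z in 𝓝 v, z ∉ a '' Icc 0 1 → GC f J z) :
    GC f J v := by
  obtain ⟨ψ, hψ, rfl⟩ := Surface.exists_chart v
  obtain ⟨a', ha', hev, -⟩ := ha.pullback hψ rfl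
  rw [← gc_comp_iff (hψ.map_nhds_eq 0)]
  refine ha'.gc_endpoint_complex (hJc.preimage hψ.continuous) (dense_preimage_compl hψ hJ) ?_
  filter_upwards [hev, hψ.continuous.continuousAt.eventually hf] with z h1 h2 h3
  rw [gc_comp_iff (hψ.map_nhds_eq z)]
  exact h2 fun h => h3 (h1.2 h)

/-- `J` is, near `v`, the union of two branches issuing from `v`. -/
def Corner (J : Set X) (v : X) : Prop :=
  ∃ a b, Branch J v a ∧ Branch J v b ∧ (∀ᶠ q in 𝓝 v, q ∈ J → q ∈ a '' Icc 0 1 ∪ b '' Icc 0 1) ∧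
    a '' Icc 0 1 ∩ b '' Icc 0 1 ⊆ {v}

/-- Near `v` the set `J` separates its complement into two local sides. -/
structure Tame (J : Set X) (v : X) : Prop where
  dichotomy : ∀ f : X → ℤˣ, (∀ᶠ q in 𝓝 v, q ∉ J → GC f J q) →
    ∀ᶠ q in 𝓝 v, q ∈ J → (GC f J q ↔ GC f J v)
  exists_sign : ∃ s : X → ℤˣ, ∀ᶠ q in 𝓝 v, GC s J q ↔ q ∉ J
  gc_mul : ∀ f g : X → ℤˣ, (∀ᶠ q in 𝓝 v, q ∉ J → GC f J q) → (∀ᶠ q in 𝓝 v, q ∉ J → GC g J q) →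
    ¬ GC f J v → ¬ GC g J v → GC (fun x => f x * g x) J v

theorem Branch.gc_iff {a : ℝ → X} (ha : Branch J v a) {f : X → ℤˣ}
    (hf : ∀ᶠ q in 𝓝 v, q ∉ J → GC f J q) : ∃ P : Prop,
    ∀ᶠ q in 𝓝[≠] v, q ∈ a '' Icc 0 1 → (GC f J q ↔ P) := by
  obtain ⟨W, hW, hWo, h0W⟩ := _root_.mem_nhds_iff.1 hf
  obtain ⟨t₀, ht₀, hsub, hev⟩ := ha.exists_small (hWo.mem_nhds h0W)
  have hIoo : ∀ t ∈ Ioo 0 t₀, t ∈ Ioc (0 : ℝ) 1 := fun t ht => ⟨ht.1, ht.2.le.trans ht₀.2⟩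
  have hstat : ∀ t ∈ Ioo 0 t₀, ∀ t' ∈ Ioo 0 t₀, (GC f J (a t) ↔ GC f J (a t')) := fun t ht t' ht' =>
    gc_iff_of_isPreconnected isPreconnected_Ioo
      (ha.cont.mono fun t ht => Ioc_subset_Icc_self (hIoo t ht))
      (fun t ht => ha.flat t (hIoo t ht))
      (fun t ht => mem_of_superset
        (hWo.mem_nhds (hsub ⟨t, Ioo_subset_Icc_self ht, rfl⟩)) hW) ht ht'
  refine ⟨GC f J (a (t₀ / 2)), ?_⟩
  rw [eventually_nhdsWithin_iff]
  filter_upwards [hev] with q hq hqv hqa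
  obtain ⟨t, ht, rfl⟩ := hq hqa
  refine hstat t ⟨ht.1.lt_of_ne ?_, ht.2⟩ _ ⟨half_pos ht₀.1, half_lt_self ht₀.1⟩
  rintro rfl
  exact hqv ha.zero

omit [T2Space X] in
theorem Branch.frequently {a : ℝ → X} (ha : Branch J v a) :
    ∃ᶠ q in 𝓝[≠] v, q ∈ a '' Icc 0 1 ∧ Flat J q := by
  have : Tendsto a (𝓝[Ioc 0 1] 0) (𝓝[≠] v) := by
    refine tendsto_nhdsWithin_iff.2 ⟨?_, ?_⟩
    · rw [← ha.zero]
      exact (ha.cont 0 (by simp)).mono_left (nhdsWithin_mono _ Ioc_subset_Icc_self)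
    · filter_upwards [self_mem_nhdsWithin] with t ht htv
      exact ht.1.ne' (ha.inj (Ioc_subset_Icc_self ht) (by simp) (htv.trans ha.zero.symm))
  have hne : (𝓝[Ioc (0 : ℝ) 1] 0).NeBot := by
    rw [← mem_closure_iff_nhdsWithin_neBot, closure_Ioc (by norm_num)]
    simp
  refine this.frequently (Eventually.frequently ?_)
  filter_upwards [self_mem_nhdsWithin] with t ht
  exact ⟨⟨t, Ioc_subset_Icc_self ht, rfl⟩, ha.flat t ht⟩

theorem Corner.dichotomy [Surface X] (h : Corner J v) (hJc : IsClosed J) (hJ : Dense Jᶜ)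
    {f : X → ℤˣ} (hf : ∀ᶠ q in 𝓝 v, q ∉ J → GC f J q) :
    ∀ᶠ q in 𝓝 v, q ∈ J → (GC f J q ↔ GC f J v) := by
  obtain ⟨a, b, ha, hb, hab, hdis⟩ := h
  by_cases hv : GC f J v
  · filter_upwards [hv.eventually] with q hq _
    simp [hq, hv]
  simp only [hv, iff_false]
  have key : ∀ {a b : ℝ → X}, Branch J v a → Branch J v b →
      (∀ᶠ q in 𝓝 v, q ∈ J → q ∈ a '' Icc 0 1 ∪ b '' Icc 0 1) →
      ∀ᶠ q in 𝓝[≠] v, q ∈ a '' Icc 0 1 → ¬ GC f J q := by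
    intro a b ha hb hab
    obtain ⟨P, hP⟩ := ha.gc_iff hf
    by_cases hPt : P
    · exfalso
      refine hv (hb.gc_endpoint hJc hJ ?_)
      have hP' : ∀ᶠ q in 𝓝[≠] v, q ∉ b '' Icc 0 1 → GC f J q := by
        filter_upwards [hP, hf.filter_mono nhdsWithin_le_nhds,
          hab.filter_mono nhdsWithin_le_nhds] with q h1 h2 h3 h4
        by_cases hqJ : q ∈ J
        · exact (h1 ((h3 hqJ).resolve_right h4)).2 hPt
        · exact h2 hqJ
      rw [eventually_nhdsWithin_iff] at hP'
      filter_upwards [hP'] with q hq hqb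
      exact hq (fun h => hqb ⟨0, by simp, hb.zero.trans h.symm⟩) hqb
    · filter_upwards [hP] with q hq hqa
      rw [hq hqa]; exact hPt
  have h1 := key ha hb hab
  have h2 := key hb ha (by simpa only [union_comm] using hab)
  rw [eventually_nhdsWithin_iff] at h1 h2
  filter_upwards [h1, h2, hab] with q h1 h2 h3 h4
  by_cases hqv : q = v
  · rwa [hqv]
  · exact (h3 h4).elim (h1 hqv) (h2 hqv)

theorem Corner.gc_mul [Surface X] (h : Corner J v) (hJc : IsClosed J) (hJ : Dense Jᶜ)
    {f g : X → ℤˣ} (hf : ∀ᶠ q in 𝓝 v, q ∉ J → GC f J q) (hg : ∀ᶠ q in 𝓝 v, q ∉ J → GC g J q)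
    (hfv : ¬ GC f J v) (hgv : ¬ GC g J v) : GC (fun x => f x * g x) J v := by
  have hfg : ∀ᶠ q in 𝓝 v, q ∉ J → GC (fun x => f x * g x) J q := by
    filter_upwards [hf, hg] with q h1 h2 h3 using (h1 h3).mul (h2 h3)
  have h1 := h.dichotomy hJc hJ hf
  have h2 := h.dichotomy hJc hJ hg
  have h3 := h.dichotomy hJc hJ hfg
  obtain ⟨a, b, ha, -⟩ := h
  obtain ⟨q, ⟨-, hq⟩, h1, h2, h3, h4, h5⟩ := (ha.frequently.and_eventually
    ((h1.and (h2.and (h3.and (hf.eventually_nhds.and hg.eventually_nhds)))).filter_mono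
      nhdsWithin_le_nhds)).exists
  rw [← h3 hq.mem]
  exact hq.gc_mul h4 h5 (by rwa [h1 hq.mem]) (by rwa [h2 hq.mem])

theorem Corner.exists_sign_complex {J : Set ℂ} (h : Corner J 0) (hJc : IsClosed J)
    (hJ : Dense Jᶜ) : ∃ s : ℂ → ℤˣ, ∀ᶠ q in 𝓝 0, GC s J q ↔ q ∉ J := by
  have hcor := h
  obtain ⟨a, b, ha, hb, hab, hdis⟩ := h
  obtain ⟨s, r, hr, hodd, hs⟩ := ha.exists_double hJc hJ
  obtain ⟨s', r', hr', hodd', hs'⟩ := hb.exists_double hJc hJ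
  let S : ℂ → ℤˣ := fun u => s u * s' u
  choose rt hrt using fun z : ℂ => IsAlgClosed.exists_pow_nat_eq z (n := 2) (by norm_num)
  set J' := (fun z : ℂ => z ^ 2) ⁻¹' J
  have hR : 0 < min r r' := lt_min hr hr'
  have hle : ∀ u, u ∈ ball (0 : ℂ) (min r r') → u ∈ ball (0 : ℂ) r ∧ u ∈ ball (0 : ℂ) r' :=
      fun u hu => ⟨ball_subset_ball (min_le_left _ _) hu, ball_subset_ball (min_le_right _ _) hu⟩
  have hcong : ∀ u ∈ ball (0 : ℂ) (min r r'), u ∉ J' → S (rt (u ^ 2)) = S u := fun u hu huJ => by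
    rcases sq_eq_sq_iff_eq_or_eq_neg.1 (hrt (u ^ 2)) with h | h
    · rw [h]
    · rw [h]
      simp only [S]
      rw [hodd u (hle u hu).1 huJ, hodd' u (hle u hu).2 huJ, neg_mul_neg]
  have hAJ := ha.image_subset hJc
  have hBJ := hb.image_subset hJc
  have hgc : ∀ u ∈ ball (0 : ℂ) (min r r'), u ≠ 0 →
      (u ^ 2 ∈ J → u ^ 2 ∈ a '' Icc 0 1 ∪ b '' Icc 0 1) → (GC S J' u ↔ u ^ 2 ∉ J) := by
    intro u hu hu0 huJ
    have h1 := hs u (hle u hu).1 hu0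
    have h2 := hs' u (hle u hu).2 hu0
    constructor
    · intro hgc hJ2
      rcases huJ hJ2 with h | h
      · have hb' : u ^ 2 ∉ b '' Icc 0 1 := fun h' => pow_ne_zero 2 hu0 (hdis ⟨h, h'⟩)
        refine (h2.2 hb').not_mul (fun hgc => h1.1 hgc h) (hgc.congr ?_)
        exact Eventually.of_forall fun x => mul_comm _ _
      · have hb' : u ^ 2 ∉ a '' Icc 0 1 := fun h' => pow_ne_zero 2 hu0 (hdis ⟨h', h⟩)
        exact (h1.2 hb').not_mul (fun hgc => h2.1 hgc h) hgc
    · intro hJ2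
      exact (h1.2 fun h => hJ2 (hAJ h)).mul (h2.2 fun h => hJ2 (hBJ h))
  have hgc' : ∀ u ∈ ball (0 : ℂ) (min r r'), u ≠ 0 →
      (GC (fun z => S (rt z)) J (u ^ 2) ↔ GC S J' u) := by
    intro u hu hu0
    rw [← gc_comp_iff (map_sq_nhds hu0)]
    have : ∀ᶠ w in 𝓝[J'ᶜ] u, S (rt (w ^ 2)) = S w := by
      rw [eventually_nhdsWithin_iff]
      filter_upwards [isOpen_ball.mem_nhds hu] with w hw hwJ using hcong w hw hwJ
    exact ⟨fun h => h.congr this, fun h => h.congr (this.mono fun _ h => h.symm)⟩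
  refine ⟨fun z => S (rt z), ?_⟩
  have hpt : ∀ᶠ q in 𝓝[≠] (0 : ℂ), GC (fun z => S (rt z)) J q ↔ q ∉ J := by
    rw [eventually_nhdsWithin_iff]
    filter_upwards [hab, ball_mem_nhds (0 : ℂ) (pow_pos hR 2)] with q hq hqr hq0
    have hu0 : rt q ≠ 0 := fun h => hq0 (by rw [mem_singleton_iff, ← hrt q, h]; simp)
    have hu : rt q ∈ ball (0 : ℂ) (min r r') := by
      rw [mem_ball_zero_iff, ← hrt q, norm_pow] at hqr
      rw [mem_ball_zero_iff]
      exact lt_of_pow_lt_pow_left₀ 2 hR.le hqr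
    have := hgc' _ hu hu0
    rw [hrt] at this
    rw [this, hgc _ hu hu0 (by rwa [hrt]), hrt]
  have h0 : ¬ GC (fun z => S (rt z)) J 0 := fun hc => by
    obtain ⟨q, ⟨-, hqf⟩, hq, hq'⟩ := (ha.frequently.and_eventually
      ((hc.eventually.filter_mono nhdsWithin_le_nhds).and hpt)).exists
    exact hq'.1 hq hqf.mem
  rw [eventually_nhdsWithin_iff] at hpt
  filter_upwards [hpt] with q hq
  by_cases hq0 : q = 0
  · subst hq0
    simp [h0, ha.mem hJc]
  · exact hq hq0

theorem Corner.tame [Surface X] (h : Corner J v) (hJc : IsClosed J) (hJ : Dense Jᶜ) :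
    Tame J v := by
  refine ⟨fun f => h.dichotomy hJc hJ, ?_, fun f g => h.gc_mul hJc hJ⟩
  obtain ⟨ψ, hψ, h0⟩ := Surface.exists_chart v
  have : Corner (ψ ⁻¹' J) 0 := by
    obtain ⟨a, b, ha, hb, hab, hdis⟩ := h
    obtain ⟨a', ha', ha2⟩ := ha.pullback hψ h0
    obtain ⟨b', hb', hb2⟩ := hb.pullback hψ h0
    refine ⟨a', b', ha', hb', ?_, ?_⟩
    · rw [← h0, ← hψ.map_nhds_eq, eventually_map] at hab
      filter_upwards [hab, ha2.1, hb2.1] with z h1 h2 h3 h4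
      exact (h1 h4).imp h2.2 h3.2
    · rintro z ⟨hz, hz'⟩
      exact hψ.injective ((hdis ⟨ha2.2 hz, hb2.2 hz'⟩ : ψ z = v).trans h0.symm)
  obtain ⟨s, hs⟩ := this.exists_sign_complex (hJc.preimage hψ.continuous)
    (dense_preimage_compl hψ hJ)
  refine ⟨s ∘ Function.invFun ψ, ?_⟩
  rw [← h0, ← hψ.map_nhds_eq, eventually_map]
  filter_upwards [hs] with z hz
  rw [← gc_comp_iff (hψ.map_nhds_eq z), Function.comp_assoc, Function.invFun_comp hψ.injective]
  exact hz

end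

section torsor
variable {X : Type*} [TopologicalSpace X] {J : Set X}

open Classical in
/-- The constant value of the germ of `f` at `p` off `J`. -/
noncomputable def germ (J : Set X) (f : X → ℤˣ) (p : X) : ℤˣ :=
  if h : GC f J p then h.choose else 1

theorem germ_spec {f : X → ℤˣ} {p : X} (h : GC f J p) : ∀ᶠ y in 𝓝[Jᶜ] p, f y = germ J f p := by
  rw [germ, dif_pos h]
  exact h.choose_spec

theorem germ_eq (hJ : Dense Jᶜ) {f : X → ℤˣ} {p : X} {c : ℤˣ} (h : ∀ᶠ y in 𝓝[Jᶜ] p, f y = c) :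
    germ J f p = c := by
  have : (𝓝[Jᶜ] p).NeBot := mem_closure_iff_nhdsWithin_neBot.1 (hJ p)
  obtain ⟨y, h1, h2⟩ := ((germ_spec ⟨c, h⟩).and h).exists
  exact h1.symm.trans h2

theorem germ_eventually (hJ : Dense Jᶜ) {f : X → ℤˣ} {p : X} (h : GC f J p) :
    ∀ᶠ q in 𝓝 p, germ J f q = germ J f p := by
  filter_upwards [eventually_nhds_nhdsWithin.2 (germ_spec h)] with q hq using germ_eq hJ hq

theorem germ_mul (hJ : Dense Jᶜ) {f g : X → ℤˣ} {p : X} (hf : GC f J p) (hg : GC g J p) :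
    germ J (fun x => f x * g x) p = germ J f p * germ J g p :=
  germ_eq hJ (by filter_upwards [germ_spec hf, germ_spec hg] with y h1 h2; rw [h1, h2])

theorem germ_of_notMem {f : X → ℤˣ} {p : X} (h : GC f J p) (hp : p ∉ J) : germ J f p = f p :=
  ((germ_spec h).self_of_nhdsWithin hp).symm

theorem exists_global_section [SimplyConnectedSpace X] [LocallyPathConnectedSpace X]
    (hJ : Dense Jᶜ) (V : X → Set X) (hV : ∀ p, IsOpen (V p)) (hpV : ∀ p, p ∈ V p)
    (s : X → X → ℤˣ) (hs : ∀ i j, ∀ x ∈ V i ∩ V j, GC (fun y => s i y * s j y) J x) :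
    ∃ f : X → ℤˣ, ∀ i, ∀ x ∈ V i, GC (fun y => f y * s i y) J x := by
  have hself : ∀ i, (fun y => s i y * s i y) = fun _ => 1 := fun i =>
    funext fun y => Int.units_mul_self _
  let Z : FiberBundleCore X X ℤˣ :=
    { baseSet := V
      isOpen_baseSet := hV
      indexAt := id
      mem_baseSet_at := hpV
      coordChange := fun i j x v => v * germ J (fun y => s i y * s j y) x
      coordChange_self := fun i x _ v => by
        rw [germ_eq hJ (c := 1) (by simp [Int.units_mul_self]), mul_one]
      continuousOn_coordChange := fun i j => by
        refine continuousOn_snd.mul ?_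
        intro q hq
        have h1 := germ_eventually hJ (hs i j q.1 hq.1)
        refine ContinuousAt.continuousWithinAt ?_
        refine (continuousAt_const (y := germ J (fun y => s i y * s j y) q.1)).congr ?_
        filter_upwards [continuousAt_fst.eventually h1] with p hp using hp.symm
      coordChange_comp := fun i j k x hx v => by
        rw [mul_assoc, ← germ_mul hJ (hs i j x hx.1) (hs j k x ⟨hx.1.2, hx.2⟩)]
        congr 2
        ext y
        rw [mul_assoc, ← mul_assoc (s j y), Int.units_mul_self, one_mul] }
  have cov : IsCoveringMap (Bundle.TotalSpace.proj : Z.TotalSpace → X) :=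
    FiberBundle.isCoveringMap (F := ℤˣ) (E := Z.Fiber)
  obtain ⟨x₀⟩ : Nonempty X := inferInstance
  obtain ⟨F, ⟨-, hF⟩, -⟩ := cov.existsUnique_continuousMap_lifts (ContinuousMap.id X) x₀
    (⟨x₀, (1 : ℤˣ)⟩ : Z.TotalSpace) rfl
  have hF' : ∀ x, (F x).1 = x := fun x => congrFun hF x
  let w : X → ℤˣ := fun x => (F x).2
  refine ⟨fun x => w x * s x x, fun i x hx => ?_⟩
  have hcont : ContinuousAt (fun y => (Z.localTriv i (F y)).2) x := by
    refine continuousAt_snd.comp (((Z.localTriv i).continuousAt ?_).comp F.continuous.continuousAt)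
    rw [Z.mem_localTriv_source, hF']
    exact hx
  have hev : ∀ᶠ y in 𝓝 x, (Z.localTriv i (F y)).2 = (Z.localTriv i (F x)).2 :=
    hcont.eventually (isOpen_discrete {(Z.localTriv i (F x)).2} |>.mem_nhds rfl)
  refine ⟨(Z.localTriv i (F x)).2, ?_⟩
  rw [eventually_nhdsWithin_iff]
  filter_upwards [hev, (hV i).mem_nhds hx] with y hy hyi hyJ
  rw [← hy, Z.localTriv_apply]
  change w y * s y y * s i y = w y * germ J (fun z => s (F y).1 z * s i z) (F y).1
  rw [hF', germ_of_notMem (hs y i y ⟨hpV y, hyi⟩) hyJ, mul_assoc]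

end torsor

theorem exists_global_sign {X : Type*} [TopologicalSpace X] {J : Set X} [SimplyConnectedSpace X]
    [LocallyPathConnectedSpace X] (hJc : IsClosed J) (hJ : Dense Jᶜ) (h : ∀ p ∈ J, Tame J p) :
    ∃ s : X → ℤˣ, ∀ p, GC s J p ↔ p ∉ J := by
  have hloc : ∀ p, ∃ s : X → ℤˣ, ∃ V, IsOpen V ∧ p ∈ V ∧ ∀ q ∈ V, GC s J q ↔ q ∉ J := fun p => by
    by_cases hp : p ∈ J
    · obtain ⟨s, hs⟩ := (h p hp).exists_sign
      obtain ⟨V, hV, hVo, hpV⟩ := _root_.mem_nhds_iff.1 hs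
      exact ⟨s, V, hVo, hpV, hV⟩
    · exact ⟨fun _ => 1, Jᶜ, hJc.isOpen_compl, hp, fun q hq =>
        ⟨fun _ => hq, fun _ => ⟨1, Eventually.of_forall fun _ => rfl⟩⟩⟩
  choose s V hVo hpV hs using hloc
  obtain ⟨f, hf⟩ := exists_global_section hJ V hVo hpV s fun i j x hx => by
    by_cases hxJ : x ∈ J
    · refine (h x hxJ).gc_mul _ _ ?_ ?_ ?_ ?_
      · filter_upwards [(hVo i).mem_nhds hx.1] with q hq hqJ using (hs i q hq).2 hqJ
      · filter_upwards [(hVo j).mem_nhds hx.2] with q hq hqJ using (hs j q hq).2 hqJ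
      · exact fun hc => (hs i x hx.1).1 hc hxJ
      · exact fun hc => (hs j x hx.2).1 hc hxJ
    · exact ((hs i x hx.1).2 hxJ).mul ((hs j x hx.2).2 hxJ)
  refine ⟨f, fun p => ?_⟩
  have hfp := hf p p (hpV p)
  rw [← hs p p (hpV p)]
  constructor <;> intro hc
  · exact (hc.mul hfp).congr <| Eventually.of_forall fun x => by
      rw [← mul_assoc, Int.units_mul_self, one_mul]
  · exact (hfp.mul hc).congr <| Eventually.of_forall fun x => by
      rw [mul_assoc, Int.units_mul_self, mul_one]

/-! ### Tame arcs -/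

section
variable {X : Type*} [TopologicalSpace X]

theorem gc_congr_set {J J' : Set X} {p : X} {f : X → ℤˣ} (h : ∀ᶠ q in 𝓝 p, q ∈ J ↔ q ∈ J') :
    GC f J p ↔ GC f J' p := by
  have : 𝓝[Jᶜ] p = 𝓝[J'ᶜ] p := by
    rw [nhdsWithin_eq_iff_eventuallyEq]
    filter_upwards [h] with q hq
    exact propext (not_congr hq)
  rw [GC, GC, this]

theorem eventually_mem_union_iff {A B : Set X} (hB : IsClosed B) {p : X} (hp : p ∉ B) :
    ∀ᶠ q in 𝓝 p, q ∈ A ∪ B ↔ q ∈ A := by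
  filter_upwards [hB.isOpen_compl.mem_nhds hp] with q hq
  exact or_iff_left hq

theorem Flat.of_union {A B : Set X} (hB : IsClosed B) {p : X} (hp : p ∉ B)
    (h : Flat (A ∪ B) p) : Flat A p :=
  h.congr (eventually_mem_union_iff hB hp)

theorem Flat.union {A B : Set X} (hB : IsClosed B) {p : X} (hp : p ∉ B)
    (h : Flat A p) : Flat (A ∪ B) p :=
  h.congr ((eventually_mem_union_iff hB hp).mono fun _ => Iff.symm)

theorem Thin.union {A B : Set X} (hA : Thin A) (hB : Thin B) (h : (A ∩ B).Finite) :
    Thin (A ∪ B) := by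
  refine ⟨hA.1.union hB.1, ((hA.2.union hB.2).union h).subset ?_⟩
  rintro p ⟨hp, hf⟩
  by_contra hc
  simp only [mem_union, mem_ofPred_eq, mem_inter_iff, not_or, not_and, not_not] at hc
  rcases hp with hp | hp
  · exact hf ((hc.1.1 hp).union hB.1 (hc.2 hp))
  · exact hf (union_comm B A ▸ (hc.1.2 hp).union hA.1 fun h => hc.2 h hp)

theorem Thin.of_union {A B : Set X} (h : Thin (A ∪ B)) (hA : IsClosed A) (hB : IsClosed B)
    (hAB : (A ∩ B).Finite) : Thin A := by
  refine ⟨hA, (h.2.union hAB).subset ?_⟩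
  rintro p ⟨hp, hf⟩
  by_contra hc
  simp only [mem_union, mem_ofPred_eq, mem_inter_iff, not_or, not_and, not_not] at hc
  exact hf ((hc.1 (Or.inl hp)).of_union hB (hc.2 hp))

def NArc (A : Set X) (x y : X) : Prop :=
  Thin A ∧ ∃ γ : ℝ → X, ContinuousOn γ (Icc 0 1) ∧ InjOn γ (Icc 0 1) ∧ γ 0 = x ∧ γ 1 = y ∧
    γ '' Icc 0 1 = A

theorem NArc.of_Icc {A : Set X} {γ : ℝ → X} {u v : ℝ} (huv : u < v)
    (hc : ContinuousOn γ (Icc u v)) (hi : InjOn γ (Icc u v)) (hA : γ '' Icc u v = A)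
    (hT : Thin A) : NArc A (γ u) (γ v) := by
  have hm : MapsTo (fun t : ℝ => u + t * (v - u)) (Icc 0 1) (Icc u v) := fun t ht =>
    ⟨by nlinarith [ht.1, ht.2], by nlinarith [ht.1, ht.2]⟩
  refine ⟨hT, fun t => γ (u + t * (v - u)), hc.comp (by fun_prop) hm, ?_, by simp, by simp, ?_⟩
  · intro s hs t ht h
    have := hi (hm hs) (hm ht) h
    have h2 : s * (v - u) = t * (v - u) := by linarith
    exact mul_right_cancel₀ (sub_pos.2 huv).ne' h2
  · rw [← hA]
    refine Subset.antisymm ?_ ?_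
    · rintro _ ⟨t, ht, rfl⟩
      exact ⟨_, hm ht, rfl⟩
    · rintro _ ⟨t, ht, rfl⟩
      have h0 := sub_pos.2 huv
      refine ⟨(t - u) / (v - u), ⟨div_nonneg (by linarith [ht.1]) h0.le,
        (div_le_one h0).2 (by linarith [ht.2])⟩, ?_⟩
      simp only
      rw [div_mul_cancel₀ _ h0.ne']
      ring_nf

variable {A B : Set X} {x y z : X}

theorem NArc.left_mem (h : NArc A x y) : x ∈ A := by
  obtain ⟨-, γ, -, -, rfl, -, rfl⟩ := h
  exact ⟨0, by simp, rfl⟩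

theorem NArc.right_mem (h : NArc A x y) : y ∈ A := by
  obtain ⟨-, γ, -, -, -, rfl, rfl⟩ := h
  exact ⟨1, by simp, rfl⟩

theorem NArc.ne (h : NArc A x y) : x ≠ y := by
  obtain ⟨-, γ, -, hi, rfl, rfl, -⟩ := h
  exact fun h => zero_ne_one (hi (by simp) (by simp) h)

theorem NArc.isCompact (h : NArc A x y) : IsCompact A := by
  obtain ⟨-, γ, hc, -, -, -, rfl⟩ := h
  exact isCompact_Icc.image_of_continuousOn hc

theorem NArc.isConnected (h : NArc A x y) : IsConnected A := by
  obtain ⟨-, γ, hc, -, -, -, rfl⟩ := h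
  exact (isConnected_Icc zero_le_one).image _ hc

theorem NArc.isConnected_sdiff (h : NArc A x y) : IsConnected (A \ {x, y}) := by
  obtain ⟨-, γ, hc, hi, rfl, rfl, rfl⟩ := h
  have : γ '' Icc 0 1 \ {γ 0, γ 1} = γ '' Ioo 0 1 := by
    rw [← image_pair, ← hi.image_sdiff_subset (by simp [insert_subset_iff]), Icc_sdiff_both]
  rw [this]
  exact (isConnected_Ioo zero_lt_one).image _ (hc.mono Ioo_subset_Icc_self)

theorem NArc.symm (h : NArc A x y) : NArc A y x := by
  obtain ⟨hT, γ, hc, hi, rfl, rfl, rfl⟩ := h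
  have hm : ∀ t : ℝ, t ∈ Icc (0 : ℝ) 1 → 1 - t ∈ Icc (0 : ℝ) 1 := fun t ht =>
    ⟨by linarith [ht.2], by linarith [ht.1]⟩
  refine ⟨hT, fun t => γ (1 - t), hc.comp (by fun_prop) hm, ?_, by simp, by simp, ?_⟩
  · intro s hs t ht h
    have := hi (hm s hs) (hm t ht) h
    linarith
  · refine Subset.antisymm ?_ ?_
    · rintro _ ⟨t, ht, rfl⟩
      exact ⟨_, hm t ht, rfl⟩
    · rintro _ ⟨t, ht, rfl⟩
      exact ⟨1 - t, hm t ht, by simp⟩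

theorem thin_image_Icc [T2Space X] {γ : ℝ → X} {u v s : ℝ} (hs : s ∈ Icc u v)
    (hc : ContinuousOn γ (Icc u v)) (hi : InjOn γ (Icc u v)) (hT : Thin (γ '' Icc u v)) :
    Thin (γ '' Icc u s) ∧ Thin (γ '' Icc s v) := by
  have h1 : IsClosed (γ '' Icc u s) := (isCompact_Icc.image_of_continuousOn
    (hc.mono (Icc_subset_Icc_right hs.2))).isClosed
  have h2 : IsClosed (γ '' Icc s v) := (isCompact_Icc.image_of_continuousOn
    (hc.mono (Icc_subset_Icc_left hs.1))).isClosed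
  have h3 : γ '' Icc u s ∩ γ '' Icc s v = {γ s} := by
    rw [← hi.image_inter (Icc_subset_Icc_right hs.2) (Icc_subset_Icc_left hs.1),
      Icc_inter_Icc_eq_singleton hs.1 hs.2, image_singleton]
  rw [← Icc_union_Icc_eq_Icc hs.1 hs.2, image_union] at hT
  refine ⟨hT.of_union h1 h2 (h3 ▸ finite_singleton _), ?_⟩
  rw [union_comm] at hT
  exact hT.of_union h2 h1 (by rw [inter_comm, h3]; exact finite_singleton _)

theorem NArc.tail [T2Space X] (h : NArc A x y) {p : X} (hp : p ∈ A) (hpy : p ≠ y) :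
    ∃ A' ⊆ A, NArc A' p y := by
  obtain ⟨hT, γ, hc, hi, rfl, rfl, rfl⟩ := h
  obtain ⟨t, ht, rfl⟩ := hp
  have ht1 : t < 1 := lt_of_le_of_ne ht.2 fun h => hpy (h ▸ rfl)
  exact ⟨_, image_mono (Icc_subset_Icc_left ht.1), .of_Icc ht1 (hc.mono (Icc_subset_Icc_left ht.1))
    (hi.mono (Icc_subset_Icc_left ht.1)) rfl (thin_image_Icc ht hc hi hT).2⟩

theorem NArc.hit [T2Space X] (h : NArc A x y) {F : Set X} (hF : IsClosed F) (hx : x ∉ F)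
    (hAF : (A ∩ F).Nonempty) : ∃ A' ⊆ A, ∃ p ∈ F, NArc A' x p ∧ A' ∩ F = {p} := by
  obtain ⟨hT, γ, hc, hi, rfl, rfl, rfl⟩ := h
  obtain ⟨_, ⟨s, hs, rfl⟩, hsF⟩ := hAF
  have hK : IsCompact (Icc (0 : ℝ) 1 ∩ γ ⁻¹' F) :=
    isCompact_Icc.of_isClosed_subset (hc.preimage_isClosed_of_isClosed isClosed_Icc hF)
      inter_subset_left
  obtain ⟨t, ⟨ht, htF⟩, hmin⟩ := hK.exists_isLeast ⟨s, hs, hsF⟩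
  have ht0 : 0 < t := lt_of_le_of_ne ht.1 fun h => hx (h ▸ htF)
  have hsub : Icc 0 t ⊆ Icc (0 : ℝ) 1 := Icc_subset_Icc_right ht.2
  refine ⟨_, image_mono hsub, γ t, htF, .of_Icc ht0 (hc.mono hsub)
    (hi.mono hsub) rfl (thin_image_Icc ht hc hi hT).1, ?_⟩
  refine Subset.antisymm ?_ (singleton_subset_iff.2 ⟨⟨t, ⟨ht.1, le_rfl⟩, rfl⟩, htF⟩)
  rintro _ ⟨⟨r, hr, rfl⟩, hrF⟩
  rw [mem_singleton_iff, le_antisymm hr.2 (hmin ⟨hsub hr, hrF⟩)]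

theorem concat_props {α β : ℝ → X} (hα : ContinuousOn α (Icc 0 1)) (hβ : ContinuousOn β (Icc 0 1))
    (h : α 1 = β 0) : ∃ γ : ℝ → X, ContinuousOn γ (Icc 0 2) ∧ (∀ t ≤ 1, γ t = α t) ∧
      (∀ t, 1 ≤ t → γ t = β (t - 1)) := by
  have h2 : ∀ t : ℝ, 1 ≤ t → (if t ≤ 1 then α t else β (t - 1)) = β (t - 1) := fun t ht => by
    split_ifs with h'
    · obtain rfl := le_antisymm h' ht
      simp [h]
    · rfl
  refine ⟨fun t => if t ≤ 1 then α t else β (t - 1), ?_, fun t ht => if_pos ht, h2⟩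
  rw [← Icc_union_Icc_eq_Icc zero_le_one one_le_two]
  refine ContinuousOn.union_of_isClosed ?_ ?_ isClosed_Icc isClosed_Icc
  · exact hα.congr fun t ht => if_pos ht.2
  · refine ContinuousOn.congr (f := fun t => β (t - 1)) ?_ fun t ht => h2 t ht.1
    exact hβ.comp (by fun_prop) fun t ht => ⟨by linarith [ht.1], by linarith [ht.2]⟩

theorem NArc.join (hA : NArc A x y) (hB : NArc B y z) (h : A ∩ B = {y}) : NArc (A ∪ B) x z := by
  have hT := hA.1.union hB.1 (h ▸ finite_singleton _)
  obtain ⟨-, α, hα, hαi, rfl, rfl, rfl⟩ := hA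
  obtain ⟨-, β, hβ, hβi, hy, rfl, rfl⟩ := hB
  obtain ⟨γ, hγ, h1, h2⟩ := concat_props hα hβ hy.symm
  have him : γ '' Icc 0 2 = α '' Icc 0 1 ∪ β '' Icc 0 1 := by
    rw [← Icc_union_Icc_eq_Icc zero_le_one one_le_two, image_union,
      image_congr fun t (ht : t ∈ Icc (0 : ℝ) 1) => h1 t ht.2,
      image_congr fun t (ht : t ∈ Icc (1 : ℝ) 2) => h2 t ht.1]
    congr 1
    rw [show (fun t => β (t - 1)) = β ∘ (fun t => t - 1) from rfl, image_comp,
      image_sub_const_Icc]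
    norm_num
  have hγi : InjOn γ (Icc 0 2) := by
    have key : ∀ s ∈ Icc (0 : ℝ) 1, ∀ t ∈ Icc (1 : ℝ) 2, γ s = γ t → s = t := fun s hs t ht e => by
      rw [h1 s hs.2, h2 t ht.1] at e
      have ht' : t - 1 ∈ Icc (0 : ℝ) 1 := ⟨by linarith [ht.1], by linarith [ht.2]⟩
      have hm : α s ∈ α '' Icc 0 1 ∩ β '' Icc 0 1 := ⟨⟨s, hs, rfl⟩, t - 1, ht', e.symm⟩
      rw [h, mem_singleton_iff] at hm
      have e1 := hαi hs (by simp) hm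
      have e2 := hβi ht' (by simp) (e.symm.trans (hm.trans hy.symm))
      linarith
    intro s hs t ht e
    rcases le_total s 1 with hs1 | hs1 <;> rcases le_total t 1 with ht1 | ht1
    · rw [h1 s hs1, h1 t ht1] at e
      exact hαi ⟨hs.1, hs1⟩ ⟨ht.1, ht1⟩ e
    · exact key s ⟨hs.1, hs1⟩ t ⟨ht1, ht.2⟩ e
    · exact (key t ⟨ht.1, ht1⟩ s ⟨hs1, hs.2⟩ e.symm).symm
    · rw [h2 s hs1, h2 t ht1] at e
      have := hβi (x₁ := s - 1) (x₂ := t - 1) ⟨by linarith, by linarith [hs.2]⟩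
        ⟨by linarith, by linarith [ht.2]⟩ e
      linarith
  have := NArc.of_Icc zero_lt_two hγ hγi him hT
  rwa [h1 0 zero_le_one, h2 2 one_le_two, show (2 : ℝ) - 1 = 1 by norm_num] at this

theorem NArc.concat [T2Space X] (hA : NArc A x y) (hB : NArc B y z) (hxz : x ≠ z) :
    ∃ C ⊆ A ∪ B, NArc C x z := by
  by_cases hx : x ∈ B
  · obtain ⟨C, hC, h⟩ := hB.tail hx hxz
    exact ⟨C, hC.trans subset_union_right, h⟩
  obtain ⟨A', hA', p, hp, h1, h2⟩ := hA.hit hB.1.1 hx ⟨y, hA.right_mem, hB.left_mem⟩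
  by_cases hpz : p = z
  · exact ⟨A', hA'.trans subset_union_left, hpz ▸ h1⟩
  obtain ⟨B', hB', h3⟩ := hB.tail hp hpz
  refine ⟨A' ∪ B', union_subset_union hA' hB', h1.join h3 (Subset.antisymm ?_ ?_)⟩
  · rw [← h2]
    exact inter_subset_inter_right _ hB'
  · exact singleton_subset_iff.2 ⟨h1.right_mem, h3.left_mem⟩

end

/-! ### Segments and circles -/

theorem flat_segment {z w p : ℂ} (hzw : z ≠ w) (hp : p ∈ segment ℝ z w) (hz : p ≠ z)
    (hw : p ≠ w) : Flat (segment ℝ z w) p := by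
  rw [segment_eq_image'] at hp ⊢
  obtain ⟨t, ht, rfl⟩ := hp
  have ht0 : 0 < t := lt_of_le_of_ne ht.1 fun h => hz (by simp [← h])
  have ht1 : t < 1 := lt_of_le_of_ne ht.2 fun h => hw (by simp [h])
  have hd : w - z ≠ 0 := sub_ne_zero.2 hzw.symm
  obtain ⟨σ, h1, h2, h3, h4⟩ := exists_radial_embedding (r := min t (1 - t))
    (lt_min ht0 (sub_pos.2 ht1))
  refine ⟨fun ζ => (z + t • (w - z)) + σ ζ * (w - z), ?_, by simp [h2], fun ζ => ?_⟩
  · exact ((Homeomorph.addLeft (z + t • (w - z))).isOpenEmbedding.comp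
      (Homeomorph.mulRight₀ _ hd).isOpenEmbedding).comp h1
  · obtain ⟨c, hc, hcz⟩ := h4 ζ
    have him : (σ ζ).im = c * ζ.im := by rw [hcz]; simp
    have hn : ‖σ ζ‖ < min t (1 - t) := by
      simpa using h3.subset (mem_range_self ζ)
    constructor
    · rintro ⟨θ, hθ, he⟩
      have he2 : (θ : ℂ) * (w - z) = (t + σ ζ) * (w - z) := by
        simp only [Complex.real_smul] at he
        linear_combination he
      have he3 := congrArg Complex.im (mul_right_cancel₀ hd he2)
      simp only [Complex.ofReal_im, Complex.add_im, zero_add, him] at he3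
      exact (mul_eq_zero.1 he3.symm).resolve_left hc.ne'
    · intro h0
      have hr : σ ζ = (σ ζ).re := by
        apply Complex.ext <;> simp [him, h0]
      have habs := (Complex.abs_re_le_norm (σ ζ)).trans_lt hn
      rw [abs_lt] at habs
      refine ⟨t + (σ ζ).re, ⟨?_, ?_⟩, ?_⟩
      · linarith [habs.1, min_le_left t (1 - t)]
      · linarith [habs.2, min_le_right t (1 - t)]
      · simp only [Complex.real_smul]
        rw [hr]
        push_cast
        simp
        ring

theorem narc_segment {z w : ℂ} (hzw : z ≠ w) : NArc (segment ℝ z w) z w := by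
  refine ⟨⟨?_, ?_⟩, fun t => AffineMap.lineMap z w t, ?_, ?_, by simp, by simp, ?_⟩
  · rw [segment_eq_image_lineMap]
    exact (isCompact_Icc.image AffineMap.lineMap_continuous).isClosed
  · refine (toFinite {z, w}).subset fun p hp => ?_
    by_contra hc
    simp only [mem_insert_iff, mem_singleton_iff, not_or] at hc
    exact hp.2 (flat_segment hzw hp.1 hc.1 hc.2)
  · exact AffineMap.lineMap_continuous.continuousOn
  · exact (AffineMap.lineMap_injective ℝ hzw).injOn
  · rw [segment_eq_image_lineMap]

theorem flat_circle (θ : ℝ) : Flat (sphere (0 : ℂ) 1) (Complex.exp (θ * Complex.I)) := by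
  obtain ⟨σ, h1, h2, h3, h4⟩ := exists_radial_embedding Real.pi_pos
  have hpos : ∀ ζ, ‖σ ζ‖ < Real.pi := fun ζ => by simpa using h3.subset (mem_range_self ζ)
  have ho : IsOpenMap Complex.exp := Complex.isOpenMap_exp
  refine ⟨fun ζ => Complex.exp ((θ + σ ζ) * Complex.I), ?_, by simp [h2], fun ζ => ?_⟩
  · refine IsOpenEmbedding.of_continuous_injective_isOpenMap ?_ ?_ ?_
    · have := h1.continuous
      fun_prop
    · intro ζ ξ h
      simp only at h
      rw [Complex.exp_eq_exp_iff_exists_int] at h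
      obtain ⟨n, hn⟩ := h
      have h5 : σ ζ - σ ξ = n * (2 * Real.pi) := by
        have := mul_right_cancel₀ Complex.I_ne_zero
          (show (θ + σ ζ) * Complex.I = (θ + σ ξ + n * (2 * Real.pi)) * Complex.I by
            linear_combination hn)
        linear_combination this
      have h6 : ‖(n : ℂ) * (2 * Real.pi)‖ < 2 * Real.pi := by
        rw [← h5]
        exact (norm_sub_le _ _).trans_lt (by linarith [hpos ζ, hpos ξ])
      have h7 : |(n : ℝ)| < 1 := by
        have : ‖(n : ℂ) * (2 * Real.pi)‖ = |(n : ℝ)| * (2 * Real.pi) := by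
          rw [norm_mul, norm_mul, Complex.norm_real, Real.norm_of_nonneg Real.pi_pos.le]
          simp
        rw [this] at h6
        have := Real.pi_pos
        nlinarith
      have h8 : n = 0 := by
        rw [← Int.cast_abs, ← Int.cast_one, Int.cast_lt] at h7
        exact Int.abs_lt_one_iff.1 h7
      rw [h8] at h5
      simp only [Int.cast_zero, zero_mul, sub_eq_zero] at h5
      exact h1.injective h5
    · have : IsOpenMap fun w : ℂ => (θ + w) * Complex.I :=
        ((Homeomorph.addLeft (θ : ℂ)).trans (Homeomorph.mulRight₀ _ Complex.I_ne_zero)).isOpenMap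
      exact ho.comp (this.comp h1.isOpenMap)
  · obtain ⟨c, hc, hcz⟩ := h4 ζ
    rw [mem_sphere_zero_iff_norm, Complex.norm_exp, Real.exp_eq_one_iff]
    have : ((θ + σ ζ) * Complex.I).re = - (c * ζ.im) := by
      rw [hcz]; simp
    rw [this, neg_eq_zero, mul_eq_zero, or_iff_right hc.ne']

theorem exists_arg {z : ℂ} (hz : z ∈ sphere (0 : ℂ) 1) :
    Complex.exp (Complex.arg z * Complex.I) = z := by
  have := Complex.norm_mul_exp_arg_mul_I z
  rwa [mem_sphere_zero_iff_norm.1 hz, Complex.ofReal_one, one_mul] at this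

theorem exp_mul_I_eq_iff {s t : ℝ} : Complex.exp ((2 * Real.pi * s : ℝ) * Complex.I) =
    Complex.exp ((2 * Real.pi * t : ℝ) * Complex.I) ↔ ∃ n : ℤ, s - t = n := by
  have h2 : (2 * Real.pi * Complex.I : ℂ) ≠ 0 := Complex.two_pi_I_ne_zero
  rw [Complex.exp_eq_exp_iff_exists_int]
  refine exists_congr fun n => ⟨fun h => ?_, fun h => ?_⟩
  · have : ((s - t : ℝ) : ℂ) = ((n : ℝ) : ℂ) := by
      apply mul_right_cancel₀ h2
      push_cast at h ⊢
      linear_combination h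
    exact_mod_cast this
  · have : s = t + n := by linarith
    rw [this]
    push_cast
    ring

section
variable {X : Type*} [TopologicalSpace X]

def NCurve (J : Set X) : Prop :=
  Thin J ∧ ∃ γ : ℝ → X, Continuous γ ∧ (∀ s t, γ s = γ t ↔ ∃ n : ℤ, s - t = n) ∧ range γ = J

theorem ncurve_circle : NCurve (sphere (0 : ℂ) 1) := by
  refine ⟨⟨isClosed_sphere, ?_⟩, fun t => Complex.exp ((2 * Real.pi * t : ℝ) * Complex.I),
    by fun_prop, fun s t => exp_mul_I_eq_iff, ?_⟩
  · convert finite_empty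
    refine eq_empty_of_forall_notMem fun z hz => hz.2 ?_
    rw [← exists_arg hz.1]
    exact flat_circle _
  · refine Subset.antisymm ?_ fun z hz => ⟨Complex.arg z / (2 * Real.pi), ?_⟩
    · rintro _ ⟨t, rfl⟩
      simp [Complex.norm_exp]
    · simp only
      rw [mul_div_cancel₀ _ Real.two_pi_pos.ne', exists_arg hz]

theorem Thin.image {Y : Type*} [TopologicalSpace Y] {ψ : X → Y} (hψ : IsOpenEmbedding ψ)
    {A : Set X} (hA : Thin A) (hc : IsClosed (ψ '' A)) : Thin (ψ '' A) := by
  refine ⟨hc, (hA.2.image ψ).subset ?_⟩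
  rintro _ ⟨⟨p, hp, rfl⟩, hf⟩
  exact ⟨p, ⟨hp, fun h => hf (h.image_embedding hψ)⟩, rfl⟩

variable {A B J : Set X} {x y z : X}

theorem NArc.image {Y : Type*} [TopologicalSpace Y] [T2Space Y] {ψ : X → Y}
    (hψ : IsOpenEmbedding ψ) (hA : NArc A x y) : NArc (ψ '' A) (ψ x) (ψ y) := by
  refine ⟨hA.1.image hψ (hA.isCompact.image hψ.continuous).isClosed, ?_⟩
  obtain ⟨-, γ, hc, hi, rfl, rfl, rfl⟩ := hA
  exact ⟨ψ ∘ γ, hψ.continuous.comp_continuousOn hc, hψ.injective.comp_injOn hi, rfl, rfl,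
    image_comp _ _ _⟩

theorem NCurve.isCompact (h : NCurve J) : IsCompact J := by
  obtain ⟨-, γ, hc, hi, rfl⟩ := h
  have : range γ = γ '' Icc 0 1 := by
    refine Subset.antisymm ?_ (image_subset_range _ _)
    rintro _ ⟨t, rfl⟩
    exact ⟨Int.fract t, ⟨Int.fract_nonneg t, (Int.fract_lt_one t).le⟩,
      (hi _ _).2 ⟨-⌊t⌋, by rw [Int.fract]; push_cast; ring⟩⟩
  rw [this]
  exact isCompact_Icc.image hc

theorem NCurve.isConnected (h : NCurve J) : IsConnected J := by
  obtain ⟨-, γ, hc, hi, rfl⟩ := h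
  exact isConnected_range hc

theorem NCurve.image {Y : Type*} [TopologicalSpace Y] [T2Space Y] {ψ : X → Y}
    (hψ : IsOpenEmbedding ψ) (hJ : NCurve J) : NCurve (ψ '' J) := by
  refine ⟨hJ.1.image hψ (hJ.isCompact.image hψ.continuous).isClosed, ?_⟩
  obtain ⟨-, γ, hc, hi, rfl⟩ := hJ
  exact ⟨ψ ∘ γ, hψ.continuous.comp hc, fun s t => by simp [hψ.injective.eq_iff, hi],
    range_comp _ _⟩

theorem NArc.curve (hA : NArc A x y) (hB : NArc B x y) (h : A ∩ B = {x, y}) :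
    NCurve (A ∪ B) := by
  have hT := hA.1.union hB.1 (h ▸ toFinite _)
  obtain ⟨-, α, hα, hαi, rfl, rfl, rfl⟩ := hA
  obtain ⟨-, β, hβ, hβi, hy, hx, rfl⟩ := hB.symm
  obtain ⟨γ, hγ, h1, h2⟩ := concat_props hα hβ hy.symm
  have him : γ '' Icc 0 2 = α '' Icc 0 1 ∪ β '' Icc 0 1 := by
    rw [← Icc_union_Icc_eq_Icc zero_le_one one_le_two, image_union,
      image_congr fun t (ht : t ∈ Icc (0 : ℝ) 1) => h1 t ht.2,
      image_congr fun t (ht : t ∈ Icc (1 : ℝ) 2) => h2 t ht.1]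
    congr 1
    rw [show (fun t => β (t - 1)) = β ∘ (fun t => t - 1) from rfl, image_comp,
      image_sub_const_Icc]
    norm_num
  have h02 : γ 0 = γ 2 := by
    rw [h1 0 zero_le_one, h2 2 one_le_two, show (2 : ℝ) - 1 = 1 by norm_num, hx]
  have hγi : InjOn γ (Ico 0 2) := by
    have key : ∀ s ∈ Icc (0 : ℝ) 1, ∀ t ∈ Ico (1 : ℝ) 2, γ s = γ t → s = t := fun s hs t ht e => by
      rw [h1 s hs.2, h2 t ht.1] at e
      have ht' : t - 1 ∈ Icc (0 : ℝ) 1 := ⟨by linarith [ht.1], by linarith [ht.2]⟩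
      have hm : α s ∈ α '' Icc 0 1 ∩ β '' Icc 0 1 := ⟨⟨s, hs, rfl⟩, t - 1, ht', e.symm⟩
      rw [h] at hm
      rcases hm with hm | hm
      · have e2 := hβi ht' (by simp) (e.symm.trans (hm.trans hx.symm))
        linarith [ht.2]
      · have e1 := hαi hs (by simp) hm
        have e2 := hβi ht' (by simp) (e.symm.trans (Eq.trans hm hy.symm))
        linarith
    intro s hs t ht e
    rcases le_total s 1 with hs1 | hs1 <;> rcases le_total t 1 with ht1 | ht1
    · rw [h1 s hs1, h1 t ht1] at e
      exact hαi ⟨hs.1, hs1⟩ ⟨ht.1, ht1⟩ e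
    · exact key s ⟨hs.1, hs1⟩ t ⟨ht1, ht.2⟩ e
    · exact (key t ⟨ht.1, ht1⟩ s ⟨hs1, hs.2⟩ e.symm).symm
    · rw [h2 s hs1, h2 t ht1] at e
      have := hβi (x₁ := s - 1) (x₂ := t - 1) ⟨by linarith, by linarith [hs.2]⟩
        ⟨by linarith, by linarith [ht.2]⟩ e
      linarith
  have hm : ∀ t : ℝ, t ∈ Icc (0 : ℝ) 1 → 2 * t ∈ Icc (0 : ℝ) 2 := fun t ht =>
    ⟨by linarith [ht.1], by linarith [ht.2]⟩
  have hf : ∀ t : ℝ, Int.fract t ∈ Icc (0 : ℝ) 1 := fun t =>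
    ⟨Int.fract_nonneg t, (Int.fract_lt_one t).le⟩
  refine ⟨hT, fun t => γ (2 * Int.fract t), ?_, fun s t => ?_, ?_⟩
  · refine ContinuousOn.comp_fract'' (f := fun t => γ (2 * t)) ?_ (by simp [h02])
    exact hγ.comp (by fun_prop) hm
  · rw [← Int.fract_eq_fract]
    refine ⟨fun e => ?_, fun e => by simp only [e]⟩
    have := hγi (x₁ := 2 * Int.fract s) (x₂ := 2 * Int.fract t)
      ⟨(hm _ (hf s)).1, by linarith [Int.fract_lt_one s]⟩
      ⟨(hm _ (hf t)).1, by linarith [Int.fract_lt_one t]⟩ e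
    linarith
  · rw [← him]
    refine Subset.antisymm ?_ ?_
    · rintro _ ⟨t, rfl⟩
      exact ⟨_, hm _ (hf t), rfl⟩
    · rintro _ ⟨t, ht, rfl⟩
      rcases ht.2.lt_or_eq with ht2 | rfl
      · refine ⟨t / 2, ?_⟩
        simp only
        rw [Int.fract_eq_self.2 ⟨by linarith [ht.1], by linarith⟩]
        congr 1
        ring
      · exact ⟨0, by simp [h02]⟩

theorem split_param [T2Space X] {γ : ℝ → X} (hT : Thin (range γ)) (hc : Continuous γ)
    (hi : ∀ s t, γ s = γ t ↔ ∃ n : ℤ, s - t = n) {s t : ℝ} (hst : s < t) (hts : t < s + 1) :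
    NArc (γ '' Icc s t) (γ s) (γ t) ∧ NArc (γ '' Icc t (s + 1)) (γ s) (γ t) ∧
      γ '' Icc s t ∩ γ '' Icc t (s + 1) = {γ s, γ t} ∧
      γ '' Icc s t ∪ γ '' Icc t (s + 1) = range γ := by
  have hper : γ (s + 1) = γ s := (hi _ _).2 ⟨1, by simp⟩
  have hinj : ∀ {r r' : ℝ}, γ r = γ r' → |r - r'| < 1 → r = r' := fun {r r'} h h' => by
    obtain ⟨n, hn⟩ := (hi _ _).1 h
    rw [hn, ← Int.cast_abs, ← Int.cast_one, Int.cast_lt, Int.abs_lt_one_iff] at h'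
    rw [h'] at hn
    simpa [sub_eq_zero] using hn
  have hU : γ '' Icc s t ∪ γ '' Icc t (s + 1) = range γ := by
    rw [← image_union, Icc_union_Icc_eq_Icc hst.le hts.le]
    refine Subset.antisymm (image_subset_range _ _) ?_
    rintro _ ⟨r, rfl⟩
    refine ⟨s + Int.fract (r - s), ⟨by linarith [Int.fract_nonneg (r - s)],
      by linarith [Int.fract_lt_one (r - s)]⟩, (hi _ _).2 ⟨-⌊r - s⌋, ?_⟩⟩
    rw [Int.fract]; push_cast; ring
  have hI : γ '' Icc s t ∩ γ '' Icc t (s + 1) = {γ s, γ t} := by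
    refine Subset.antisymm ?_ ?_
    · rintro _ ⟨⟨r, hr, rfl⟩, r', hr', he⟩
      rcases hr'.2.lt_or_eq with h | h
      · have := hinj he (abs_lt.2 ⟨by linarith [hr.2, hr'.1], by linarith [hr.1]⟩)
        right
        rw [mem_singleton_iff, show r = t by linarith [hr.2, hr'.1]]
      · left
        rw [← he, h, hper]
    · rintro _ (rfl | rfl)
      · exact ⟨⟨s, ⟨le_rfl, hst.le⟩, rfl⟩, s + 1, ⟨hts.le, le_rfl⟩, hper⟩
      · exact ⟨⟨t, ⟨hst.le, le_rfl⟩, rfl⟩, t, ⟨le_rfl, hts.le⟩, rfl⟩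
  have hk : ∀ u v : ℝ, IsClosed (γ '' Icc u v) := fun u v => (isCompact_Icc.image hc).isClosed
  rw [← hU] at hT
  refine ⟨.of_Icc hst hc.continuousOn ?_ rfl (hT.of_union (hk _ _) (hk _ _) (hI ▸ toFinite _)),
    ?_, hI, hU⟩
  · exact fun r hr r' hr' h => hinj h (abs_lt.2 ⟨by linarith [hr.1, hr'.2], by linarith [hr.2, hr'.1]⟩)
  · rw [← hper]
    rw [union_comm] at hT
    refine (NArc.of_Icc hts hc.continuousOn ?_ rfl
      (hT.of_union (hk _ _) (hk _ _) (by rw [inter_comm, hI]; exact toFinite _))).symm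
    exact fun r hr r' hr' h => hinj h (abs_lt.2 ⟨by linarith [hr.1, hr'.2], by linarith [hr.2, hr'.1]⟩)

theorem NCurve.split [T2Space X] (h : NCurve J) (hx : x ∈ J) (hy : y ∈ J) (hxy : x ≠ y) :
    ∃ A B, NArc A x y ∧ NArc B x y ∧ A ∩ B = {x, y} ∧ A ∪ B = J := by
  obtain ⟨hT, γ, hc, hi, rfl⟩ := h
  obtain ⟨s, rfl⟩ := hx
  obtain ⟨t, rfl⟩ := hy
  have he : γ (s + Int.fract (t - s)) = γ t :=
    (hi _ _).2 ⟨-⌊t - s⌋, by rw [Int.fract]; push_cast; ring⟩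
  have h0 : 0 < Int.fract (t - s) := by
    refine lt_of_le_of_ne (Int.fract_nonneg _) fun h => hxy ?_
    rw [← h, add_zero] at he
    exact he
  obtain ⟨h1, h2, h3, h4⟩ := split_param hT hc hi (s := s) (t := s + Int.fract (t - s))
    (by linarith) (by linarith [Int.fract_lt_one (t - s)])
  rw [he] at h1 h2 h3
  exact ⟨_, _, h1, h2, h3, h4⟩

theorem exists_branch {γ : ℝ → X} {u v s t : ℝ} (hs : s ∈ Icc u v) (ht : t ∈ Icc u v)
    (hst : s ≠ t) (hc : ContinuousOn γ (Icc u v)) (hi : InjOn γ (Icc u v)) (hT : Thin J)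
    (hJ : γ '' Icc u v ⊆ J) : ∃ r ∈ uIcc s t, r ≠ s ∧ ∃ a, Branch J (γ s) a ∧
      a '' Icc 0 1 = γ '' uIcc s r := by
  have hfin : {r ∈ Icc u v | ¬ Flat J (γ r)}.Finite := by
    refine Finite.of_finite_image (hT.2.subset ?_) (hi.mono fun r hr => hr.1)
    rintro _ ⟨r, hr, rfl⟩
    exact ⟨hJ ⟨r, hr.1, rfl⟩, hr.2⟩
  have hev : ∀ᶠ c : ℝ in 𝓝[>] 0, ∀ r ∈ {r ∈ Icc u v | ¬ Flat J (γ r)}, r ≠ s →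
      r ∉ uIcc s (s + c * (t - s)) := by
    rw [eventually_all_finite hfin]
    intro r hr
    by_cases hrs : r = s
    · exact Eventually.of_forall fun _ h => absurd hrs h
    have hcont : Tendsto (fun c : ℝ => dist s (s + c * (t - s))) (𝓝[>] 0) (𝓝 0) := by
      have : Continuous fun c : ℝ => dist s (s + c * (t - s)) := by fun_prop
      simpa using (this.tendsto 0).mono_left nhdsWithin_le_nhds
    filter_upwards [hcont.eventually_lt_const (dist_pos.2 (Ne.symm hrs))] with c hc _ hm
    rw [Real.dist_eq, Real.dist_eq] at hc
    rw [mem_uIcc] at hm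
    rcases hm with hm | hm <;> cases abs_cases (s - r) <;> cases abs_cases (s - (s + c * (t - s)))
      <;> linarith
  have hev2 : ∀ᶠ c : ℝ in 𝓝[>] 0, c ∈ Ioc (0 : ℝ) 1 := Ioc_mem_nhdsGT zero_lt_one
  obtain ⟨c, hc1, hc2⟩ := (hev.and hev2).exists
  have hd : t - s ≠ 0 := sub_ne_zero.2 hst.symm
  have hsub : uIcc s t ⊆ Icc u v := by
    rw [← uIcc_of_le (hs.1.trans hs.2)]
    exact uIcc_subset_uIcc (by rwa [uIcc_of_le (hs.1.trans hs.2)])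
      (by rwa [uIcc_of_le (hs.1.trans hs.2)])
  have hcomb : ∀ w w' e : ℝ, e ∈ Icc (0 : ℝ) 1 → w + e * (w' - w) ∈ uIcc w w' := by
    intro w w' e he
    rw [← segment_eq_uIcc, segment_eq_image']
    exact ⟨e, he, rfl⟩
  have hr := hcomb s t c ⟨hc2.1.le, hc2.2⟩
  set r := s + c * (t - s) with hrdef
  have hrs : r - s ≠ 0 := by
    rw [hrdef, add_sub_cancel_left]
    exact mul_ne_zero hc2.1.ne' hd
  have hsub2 : uIcc s r ⊆ Icc u v := (uIcc_subset_uIcc_left hr).trans hsub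
  have hm : MapsTo (fun e : ℝ => s + e * (r - s)) (Icc 0 1) (Icc u v) := fun e he =>
    hsub2 (hcomb _ _ _ he)
  refine ⟨r, hr, sub_ne_zero.1 hrs, fun e => γ (s + e * (r - s)), ⟨hc.comp (by fun_prop) hm, ?_,
    by simp, ?_⟩, ?_⟩
  · intro e he e' he' h
    have := hi (hm he) (hm he') h
    exact mul_right_cancel₀ hrs (by linarith)
  · intro e he
    have he' : e ∈ Icc (0 : ℝ) 1 := ⟨he.1.le, he.2⟩
    by_contra hf
    refine hc1 _ ⟨hm he', hf⟩ ?_ (hcomb _ _ _ he')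
    simp [he.1.ne', hrs]
  · rw [← segment_eq_uIcc, segment_eq_image', ← image_comp]
    rfl

theorem corner_of_param [T2Space X] {γ : ℝ → X} {u v s : ℝ} (hs : s ∈ Ioo u v)
    (hc : ContinuousOn γ (Icc u v)) (hi : InjOn γ (Icc u v)) (hT : Thin J)
    (hJ : γ '' Icc u v ⊆ J) (h : ∀ᶠ q in 𝓝 (γ s), q ∈ J → q ∈ γ '' Icc u v) :
    Corner J (γ s) := by
  have hs' := Ioo_subset_Icc_self hs
  have huv := hs.1.trans hs.2
  obtain ⟨r, hr, hrs, a, ha, hai⟩ := exists_branch hs' (left_mem_Icc.2 huv.le) hs.1.ne' hc hi hT hJ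
  obtain ⟨r', hr', hrs', b, hb, hbi⟩ := exists_branch hs' (right_mem_Icc.2 huv.le) hs.2.ne hc hi
    hT hJ
  rw [uIcc_of_ge hs.1.le] at hr
  rw [uIcc_of_le hs.2.le] at hr'
  rw [uIcc_of_ge hr.2] at hai
  rw [uIcc_of_le hr'.1] at hbi
  have hrs := lt_of_le_of_ne hr.2 hrs
  have hrs' := lt_of_le_of_ne hr'.1 hrs'.symm
  refine ⟨a, b, ha, hb, ?_, ?_⟩
  · have hcl : ∀ w w' : ℝ, u ≤ w → w' ≤ v → s ∉ Icc w w' → (γ '' Icc w w')ᶜ ∈ 𝓝 (γ s) := by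
      intro w w' hw hw' hsw
      have hsub : Icc w w' ⊆ Icc u v := Icc_subset_Icc hw hw'
      refine (isCompact_Icc.image_of_continuousOn (hc.mono hsub)).isClosed.isOpen_compl.mem_nhds ?_
      rintro ⟨e, he, h⟩
      exact hsw (hi (hsub he) hs' h ▸ he)
    filter_upwards [h, hcl u r le_rfl (hr.2.trans hs.2.le) fun h => not_lt.2 h.2 hrs,
      hcl r' v (hs.1.le.trans hr'.1) le_rfl fun h => not_lt.2 h.1 hrs'] with q h1 h2 h3 h4
    obtain ⟨e, he, rfl⟩ := h1 h4
    rw [hai, hbi]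
    rcases le_total e s with h5 | h5
    · exact Or.inl ⟨e, ⟨le_of_not_ge fun h => h2 ⟨e, ⟨he.1, h⟩, rfl⟩, h5⟩, rfl⟩
    · exact Or.inr ⟨e, ⟨h5, le_of_not_ge fun h => h3 ⟨e, ⟨h, he.2⟩, rfl⟩⟩, rfl⟩
  · rw [hai, hbi, ← hi.image_inter (Icc_subset_Icc hr.1 hs.2.le) (Icc_subset_Icc hs.1.le hr'.2),
      Icc_inter_Icc_eq_singleton hr.2 hr'.1, image_singleton]

theorem NCurve.corner [T2Space X] (h : NCurve J) (hx : x ∈ J) : Corner J x := by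
  obtain ⟨hT, γ, hc, hi, rfl⟩ := h
  obtain ⟨s, rfl⟩ := hx
  have hinj : InjOn γ (Icc (s - 1 / 4) (s + 1 / 4)) := fun r hr r' hr' h => by
    obtain ⟨n, hn⟩ := (hi _ _).1 h
    have h' : |(n : ℝ)| < 1 := by
      rw [← hn]
      exact abs_lt.2 ⟨by linarith [hr.1, hr'.2], by linarith [hr.2, hr'.1]⟩
    rw [← Int.cast_abs, ← Int.cast_one, Int.cast_lt, Int.abs_lt_one_iff] at h'
    rw [h'] at hn
    simpa [sub_eq_zero] using hn
  refine corner_of_param (u := s - 1 / 4) (v := s + 1 / 4) ⟨by linarith, by linarith⟩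
    hc.continuousOn hinj hT (image_subset_range _ _) ?_
  have hk : IsClosed (γ '' Icc (s + 1 / 4) (s + 3 / 4)) := (isCompact_Icc.image hc).isClosed
  have hn : γ s ∉ γ '' Icc (s + 1 / 4) (s + 3 / 4) := by
    rintro ⟨r, hr, h⟩
    obtain ⟨n, hn⟩ := (hi _ _).1 h
    have h1 : (0 : ℝ) < n := by linarith [hr.1]
    have h2 : (n : ℝ) < 1 := by linarith [hr.2]
    rw [← Int.cast_zero, Int.cast_lt] at h1
    rw [← Int.cast_one, Int.cast_lt] at h2
    omega
  filter_upwards [hk.isOpen_compl.mem_nhds hn] with q hq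
  rintro ⟨r, rfl⟩
  have he : γ (s - 1 / 4 + Int.fract (r - (s - 1 / 4))) = γ r :=
    (hi _ _).2 ⟨-⌊r - (s - 1 / 4)⌋, by rw [Int.fract]; push_cast; ring⟩
  rw [← he] at hq ⊢
  have h0 := Int.fract_nonneg (r - (s - 1 / 4))
  have h1 := Int.fract_lt_one (r - (s - 1 / 4))
  refine ⟨_, ⟨by linarith, ?_⟩, rfl⟩
  by_contra hcon
  exact hq ⟨_, ⟨by linarith, by linarith⟩, rfl⟩

theorem exists_narc_subset [T2Space X] [Surface X] {O : Set X} (hO : IsOpen O) (hOc : IsPreconnected O)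
    (hx : x ∈ O) (hy : y ∈ O) (hxy : x ≠ y) : ∃ A ⊆ O, NArc A x y := by
  have key : x = y ∨ ∃ A ⊆ O, NArc A x y := by
    refine hOc.induction₂ (fun x y => x = y ∨ ∃ A ⊆ O, NArc A x y) ?_ ?_ ?_ hx hy
    · intro p hp
      obtain ⟨ψ, h1, rfl, h3⟩ := Surface.exists_small (hO.mem_nhds hp)
      refine mem_nhdsWithin_of_mem_nhds ?_
      filter_upwards [h1.isOpen_range.mem_nhds (mem_range_self 0)] with q hq
      obtain ⟨w, rfl⟩ := hq
      by_cases hw : 0 = w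
      · left
        rw [hw]
      · exact Or.inr ⟨_, (image_subset_range _ _).trans h3, (narc_segment hw).image h1⟩
    · rintro p q r hp hq hr h1 h2
      rcases h1 with rfl | ⟨A, hA, h1⟩
      · exact h2
      rcases h2 with rfl | ⟨B, hB, h2⟩
      · exact Or.inr ⟨A, hA, h1⟩
      by_cases hpr : p = r
      · exact Or.inl hpr
      obtain ⟨C, hC, h3⟩ := h1.concat h2 hpr
      exact Or.inr ⟨C, hC.trans (union_subset hA hB), h3⟩
    · rintro p q hp hq (h | ⟨A, hA, h⟩)
      · exact Or.inl h.symm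
      · exact Or.inr ⟨A, hA, h.symm⟩
  exact key.resolve_left hxy

end

/-! ### The Jordan curve theorem and crosscuts -/

class Planar (X : Type*) [TopologicalSpace X] : Prop extends
    T2Space X, Surface X, PreconnectedSpace X where
  exists_sign : ∀ J : Set X, IsClosed J → Dense Jᶜ → (∀ p ∈ J, Tame J p) →
    ∃ s : X → ℤˣ, ∀ p, GC s J p ↔ p ∉ J

section
variable {X : Type*} [TopologicalSpace X]

section
variable {X : Type*}

open Classical in
noncomputable def sgn (Q : Set X) (x : X) : ℤˣ := if x ∈ Q then 1 else -1

theorem sgn_of_mem {Q : Set X} {x : X} (h : x ∈ Q) : sgn Q x = 1 := if_pos h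

theorem sgn_of_notMem {Q : Set X} {x : X} (h : x ∉ Q) : sgn Q x = -1 := if_neg h

theorem sgn_eq_sgn {Q : Set X} {x y : X} : sgn Q x = sgn Q y ↔ (x ∈ Q ↔ y ∈ Q) := by
  by_cases hx : x ∈ Q <;> by_cases hy : y ∈ Q <;> simp [sgn, hx, hy]

end

theorem gc_iff_of_notMem {J : Set X} {f : X → ℤˣ} {p : X} (hJ : IsClosed J) (hp : p ∉ J) :
    GC f J p ↔ ∀ᶠ y in 𝓝 p, f y = f p := by
  rw [GC, hJ.isOpen_compl.nhdsWithin_eq hp]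
  exact ⟨fun ⟨c, hc⟩ => by rwa [hc.self_of_nhds], fun h => ⟨_, h⟩⟩

structure MCell (Q J : Set X) : Prop where
  curve : NCurve J
  isOpen : IsOpen Q
  isConnected : IsConnected Q
  disjoint : Disjoint Q J
  closure_eq : closure Q = Q ∪ J

variable {Q J : Set X}

theorem MCell.subset_of (h : MCell Q J) {Y : Set X} (hY : IsPreconnected Y) (hd : Disjoint Y J)
    (hn : (Y ∩ Q).Nonempty) : Y ⊆ Q := by
  refine hY.subset_of_closure_inter_subset h.isOpen hn ?_
  rw [h.closure_eq]
  rintro x ⟨hx | hx, hxY⟩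
  · exact hx
  · exact absurd hx (disjoint_left.1 hd hxY)

variable {A B c : Set X} {a b : X}

theorem MCell.inter_crosscut (hQ : MCell Q (A ∪ B)) (hA : NArc A a b) (hc : NArc c a b)
    (hcQ : c \ {a, b} ⊆ Q) : A ∩ c = {a, b} := by
  refine Subset.antisymm (fun x hx => ?_) ?_
  · by_contra hn
    exact disjoint_left.1 hQ.disjoint (hcQ ⟨hx.2, hn⟩) (Or.inl hx.1)
  · rintro x (rfl | rfl)
    · exact ⟨hA.left_mem, hc.left_mem⟩
    · exact ⟨hA.right_mem, hc.right_mem⟩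

theorem Flat.gc_mul_mul {f g h : X → ℤˣ} {p : X} (hp : Flat J p)
    (hf : ∀ᶠ q in 𝓝 p, q ∉ J → GC f J q) (hg : ∀ᶠ q in 𝓝 p, q ∉ J → GC g J q)
    (hfp : ¬ GC f J p) (hgp : ¬ GC g J p) (hh : GC h J p) :
    GC (fun x => f x * g x * h x) J p :=
  (hp.gc_mul hf hg hfp hgp).mul hh

variable [Planar X]

theorem NCurve.dense (h : NCurve J) : Dense Jᶜ := h.1.dense

theorem NCurve.tame (h : NCurve J) {p : X} (hp : p ∈ J) : Tame J p :=
  (h.corner hp).tame h.1.1 h.dense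

theorem NCurve.gc_dichotomy (h : NCurve J) {f : X → ℤˣ} (hf : ∀ p ∉ J, GC f J p) :
    (∀ p ∈ J, GC f J p) ∨ ∀ p ∈ J, ¬ GC f J p := by
  have key : ∀ p ∈ J, ∀ q ∈ J, (GC f J p ↔ GC f J q) := fun p hp q hq => by
    refine h.isConnected.isPreconnected.induction₂ (fun p q => GC f J p ↔ GC f J q) ?_
      (fun _ _ _ _ _ _ h1 h2 => h1.trans h2) (fun _ _ _ _ h => h.symm) hp hq
    intro x hx
    have := (h.tame hx).dichotomy f (Eventually.of_forall fun q hq => hf q hq)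
    rw [eventually_nhdsWithin_iff]
    exact this.mono fun q h1 h2 => (h1 h2).symm
  obtain ⟨p, hp⟩ := h.isConnected.nonempty
  by_cases hg : GC f J p
  · exact Or.inl fun q hq => (key p hp q hq).1 hg
  · exact Or.inr fun q hq hc => hg ((key p hp q hq).2 hc)

theorem eq_of_forall_gc {f : X → ℤˣ} (hJ : Dense Jᶜ) (h : ∀ p, GC f J p) {x y : X} (hx : x ∉ J)
    (hy : y ∉ J) : f x = f y :=
  eq_of_isPreconnected isPreconnected_univ hJ (fun p _ => h p) ⟨mem_univ _, hx⟩ ⟨mem_univ _, hy⟩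

theorem NCurve.mcell (h : NCurve J) {s : X → ℤˣ} (hs : ∀ p, GC s J p ↔ p ∉ J) (c : ℤˣ) :
    MCell {x | x ∉ J ∧ s x = c} J := by
  have hloc : ∀ p ∉ J, ∀ᶠ y in 𝓝 p, y ∉ J ∧ s y = s p := fun p hp =>
    (show ∀ᶠ y in 𝓝 p, y ∉ J from h.1.1.isOpen_compl.mem_nhds hp).and
      ((gc_iff_of_notMem h.1.1 hp).1 ((hs p).2 hp))
  have hopen : ∀ c, IsOpen {x | x ∉ J ∧ s x = c} := fun c => isOpen_iff_mem_nhds.2 fun p hp => by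
    filter_upwards [hloc p hp.1] with y hy
    exact ⟨hy.1, hy.2.trans hp.2⟩
  have hcl : ∀ c, J ⊆ closure {x | x ∉ J ∧ s x = c} := fun c p hp => by
    by_contra hcon
    refine (hs p).1 ⟨-c, ?_⟩ hp
    rw [eventually_nhdsWithin_iff]
    filter_upwards [isClosed_closure.isOpen_compl.mem_nhds hcon] with y hy hyJ
    by_contra hne
    exact hy (subset_closure ⟨hyJ, by rwa [← ne_eq, Int.units_ne_iff_eq_neg, neg_neg] at hne⟩)
  have hne : ∀ c, {x | x ∉ J ∧ s x = c}.Nonempty := fun c =>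
    closure_nonempty_iff.1 (h.isConnected.nonempty.mono (hcl c))
  refine ⟨h, hopen c, ⟨hne c, ?_⟩, disjoint_left.2 fun x hx => hx.1, Subset.antisymm ?_
    (union_subset subset_closure (hcl c))⟩
  · rw [isPreconnected_iff_subset_of_disjoint]
    intro u v hu hv huv hd
    have hf : ∀ p ∉ J, GC (sgn ({x | x ∉ J ∧ s x = c} ∩ u)) J p := fun p hp => by
      rw [gc_iff_of_notMem h.1.1 hp]
      by_cases hpc : s p = c
      · by_cases hpu : p ∈ u
        · filter_upwards [((hopen c).inter hu).mem_nhds ⟨⟨hp, hpc⟩, hpu⟩] with y hy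
          rw [sgn_eq_sgn]
          exact iff_of_true hy ⟨⟨hp, hpc⟩, hpu⟩
        · filter_upwards [((hopen c).inter hv).mem_nhds
            ⟨⟨hp, hpc⟩, (huv ⟨hp, hpc⟩).resolve_left hpu⟩] with y hy
          rw [sgn_eq_sgn]
          exact iff_of_false (fun h => (hd.subset ⟨hy.1, h.2, hy.2⟩ : y ∈ (∅ : Set X)))
            fun h => hpu h.2
      · filter_upwards [hloc p hp] with y hy
        rw [sgn_eq_sgn]
        exact iff_of_false (fun h => hpc (hy.2 ▸ h.1.2)) fun h => hpc h.1.2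
    rcases h.gc_dichotomy hf with h1 | h1
    · right
      intro x hx
      refine (huv hx).resolve_left fun hxu => ?_
      obtain ⟨y, hy⟩ := hne (-c)
      have := eq_of_forall_gc h.dense (fun p => (em (p ∈ J)).elim (h1 p) (hf p)) hx.1 hy.1
      rw [sgn_eq_sgn] at this
      have h2 := (this.1 ⟨hx, hxu⟩).1.2
      rw [hy.2] at h2
      exact Int.units_ne_iff_eq_neg.2 rfl h2
    · by_cases hn : ∃ x, x ∈ {x | x ∉ J ∧ s x = c} ∩ u
      · left
        obtain ⟨x, hx⟩ := hn
        intro y hy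
        have := eq_of_forall_gc h.dense (fun p => (em (p ∈ J)).elim
          (fun hp => (h.tame hp).gc_mul s _ (Eventually.of_forall fun q => (hs q).2)
            (Eventually.of_forall hf) (fun h => (hs p).1 h hp) (h1 p hp))
          (fun hp => ((hs p).2 hp).mul (hf p hp))) hx.1.1 hy.1
        rw [hx.1.2, hy.2, mul_right_inj, sgn_eq_sgn] at this
        exact (this.1 hx).2
      · right
        exact fun x hx => (huv hx).resolve_left fun hxu => hn ⟨x, hx, hxu⟩
  · intro x hx
    by_cases hxJ : x ∈ J
    · exact Or.inr hxJ
    · left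
      obtain ⟨y, hy, hy2⟩ := ((mem_closure_iff_frequently.1 hx).and_eventually (hloc x hxJ)).exists
      exact ⟨hxJ, hy2.2.symm.trans hy.2⟩

theorem NCurve.exists_sgn (h : NCurve J) : ∃ s : X → ℤˣ, ∀ p, GC s J p ↔ p ∉ J :=
  Planar.exists_sign J h.1.1 h.dense fun _ => h.tame

theorem NCurve.jordan (h : NCurve J) :
    ∃ Q R, MCell Q J ∧ MCell R J ∧ Disjoint Q R ∧ Q ∪ R = Jᶜ := by
  obtain ⟨s, hs⟩ := h.exists_sgn
  refine ⟨_, _, h.mcell hs 1, h.mcell hs (-1), disjoint_left.2 fun x hx hx' => ?_, ?_⟩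
  · have := hx.2.symm.trans hx'.2
    exact absurd this (by decide)
  · ext x
    simp only [mem_union, mem_ofPred_eq, mem_compl_iff]
    rcases Int.units_eq_one_or (s x) with h | h <;> simp [h]

theorem MCell.exists_other (h : MCell Q J) : ∃ R, MCell R J ∧ Disjoint Q R ∧ Q ∪ R = Jᶜ := by
  obtain ⟨A, B, hA, hB, hd, hu⟩ := h.curve.jordan
  have hQ : Q ⊆ A ∪ B := hu ▸ subset_compl_iff_disjoint_right.2 h.disjoint
  have key : ∀ A, MCell A J → (Q ∩ A).Nonempty → Q = A := fun A hA hn => Subset.antisymm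
    (hA.subset_of h.isConnected.isPreconnected h.disjoint hn)
    (h.subset_of hA.isConnected.isPreconnected hA.disjoint (by rwa [inter_comm]))
  obtain ⟨x, hx⟩ := h.isConnected.nonempty
  rcases hQ hx with hxA | hxB
  · obtain rfl := key A hA ⟨x, hx, hxA⟩
    exact ⟨B, hB, hd, hu⟩
  · obtain rfl := key B hB ⟨x, hx, hxB⟩
    exact ⟨A, hA, hd.symm, by rw [union_comm, hu]⟩

theorem MCell.gc_sgn (h : MCell Q J) {p : X} : GC (sgn Q) J p ↔ p ∉ J := by
  obtain ⟨R, hR, hd, hu⟩ := h.exists_other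
  have hc := h.curve.1.1
  refine ⟨fun ⟨c, hg⟩ hp => ?_, fun hp => ?_⟩
  · have key : ∀ A ⊆ Jᶜ, p ∈ closure A → ∃ y ∈ A, sgn Q y = c := fun A hA hpA => by
      have := (mem_closure_iff_frequently.1 hpA).and_eventually (eventually_nhdsWithin_iff.1 hg)
      obtain ⟨y, hy, h1⟩ := this.exists
      exact ⟨y, hy, h1 (hA hy)⟩
    obtain ⟨y, hy, h1⟩ := key Q (hu ▸ subset_union_left) (h.closure_eq ▸ Or.inr hp)
    obtain ⟨z, hz, h2⟩ := key R (hu ▸ subset_union_right) (hR.closure_eq ▸ Or.inr hp)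
    have := sgn_eq_sgn.1 (h1.trans h2.symm)
    exact disjoint_left.1 hd (this.1 hy) hz
  · rw [gc_iff_of_notMem hc hp]
    rcases (hu.symm ▸ hp : p ∈ Q ∪ R) with hp | hp
    · filter_upwards [h.isOpen.mem_nhds hp] with y hy
      rw [sgn_eq_sgn]
      exact iff_of_true hy hp
    · filter_upwards [hR.isOpen.mem_nhds hp] with y hy
      rw [sgn_eq_sgn]
      exact iff_of_false (fun h => disjoint_left.1 hd h hy) (fun h => disjoint_left.1 hd h hp)

theorem MCell.exists_half (hQ : MCell Q (A ∪ B)) (hA : NArc A a b)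
    (hAB : A ∩ B = {a, b}) (hc : NArc c a b) (hcQ : c \ {a, b} ⊆ Q) :
    ∃ Q', MCell Q' (A ∪ c) ∧ Q' ⊆ Q := by
  obtain ⟨R, hR, hd, hu⟩ := hQ.exists_other
  have hAc := hQ.inter_crosscut hA hc hcQ
  have hY : IsPreconnected (R ∪ (B \ {a, b})) :=
    hR.isConnected.isPreconnected.subset_closure subset_union_left (by
      rw [hR.closure_eq]
      exact union_subset_union_right _ (sdiff_subset.trans subset_union_right))
  have hYd : Disjoint (R ∪ (B \ {a, b})) (A ∪ c) := by
    rw [disjoint_left]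
    rintro x (hx | hx) (hx' | hx')
    · exact disjoint_left.1 hR.disjoint hx (Or.inl hx')
    · by_cases hxab : x ∈ ({a, b} : Set X)
      · exact disjoint_left.1 hR.disjoint hx (Or.inl (hAc.symm.subset hxab).1)
      · exact disjoint_left.1 hd (hcQ ⟨hx', hxab⟩) hx
    · exact hx.2 (hAB ▸ ⟨hx', hx.1⟩)
    · exact disjoint_left.1 hQ.disjoint (hcQ ⟨hx', hx.2⟩) (Or.inr hx.1)
  obtain ⟨S, S', hS, hS', hSS, hSu⟩ := (hA.curve hc hAc).jordan
  have key : ∀ T, MCell T (A ∪ c) → Disjoint T (R ∪ (B \ {a, b})) → T ⊆ Q := by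
    intro T hT hTd x hx
    have h1 : x ∉ A := fun h => disjoint_left.1 hT.disjoint hx (Or.inl h)
    have h2 : x ∉ B := fun h => disjoint_left.1 hTd hx (Or.inr ⟨h, fun h' =>
      h1 (hAB.symm.subset h').1⟩)
    have h3 : x ∈ Q ∪ R := hu ▸ not_or.2 ⟨h1, h2⟩
    exact h3.resolve_right fun h => disjoint_left.1 hTd hx (Or.inl h)
  by_cases hn : ((R ∪ (B \ {a, b})) ∩ S).Nonempty
  · have := hS.subset_of hY hYd hn
    exact ⟨S', hS', key S' hS' (hSS.symm.mono_right this)⟩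
  · exact ⟨S, hS, key S hS (disjoint_iff_inter_eq_empty.2 (by
      rw [inter_comm]; exact not_nonempty_iff_eq_empty.1 hn))⟩

theorem MCell.theta (hQ : MCell Q (A ∪ B)) (hA : NArc A a b) (hB : NArc B a b)
    (hAB : A ∩ B = {a, b}) (hc : NArc c a b) (hcQ : c \ {a, b} ⊆ Q) :
    ∃ Q₁ Q₂, MCell Q₁ (A ∪ c) ∧ MCell Q₂ (B ∪ c) ∧ Disjoint Q₁ Q₂ ∧ Q₁ ⊆ Q ∧ Q₂ ⊆ Q ∧
      Q ⊆ Q₁ ∪ Q₂ ∪ c := by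
  have hQ' : MCell Q (B ∪ A) := union_comm A B ▸ hQ
  obtain ⟨Q₁, h1, h1Q⟩ := hQ.exists_half hA hAB hc hcQ
  obtain ⟨Q₂, h2, h2Q⟩ := hQ'.exists_half hB (inter_comm A B ▸ hAB) hc hcQ
  have hAc := hQ.inter_crosscut hA hc hcQ
  have hBc := hQ'.inter_crosscut hB hc hcQ
  have hfin : ((A ∪ B) ∩ c).Finite := by
    rw [union_inter_distrib_right, hAc, hBc]
    exact toFinite _
  have hT : Thin (A ∪ B ∪ c) := hQ.curve.1.union hc.1 hfin
  have hab : ∀ p, ∀ᶠ q in 𝓝[≠] p, q ∉ ({a, b} : Set X) := fun p => by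
    have : ((({a, b} : Set X) \ {p})ᶜ) ∈ 𝓝 p :=
      ((toFinite _).isClosed).isOpen_compl.mem_nhds fun h => h.2 rfl
    filter_upwards [nhdsWithin_le_nhds this, self_mem_nhdsWithin] with q h1 h2 h3
    exact h1 ⟨h3, h2⟩
  have sQ : ∀ q ∉ A ∪ B, GC (sgn Q) (A ∪ B ∪ c) q := fun q hq =>
    (hQ.gc_sgn.2 hq).mono subset_union_left
  have s1 : ∀ q ∉ A ∪ c, GC (sgn Q₁) (A ∪ B ∪ c) q := fun q hq =>
    (h1.gc_sgn.2 hq).mono (union_subset_union_left _ subset_union_left)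
  have s2 : ∀ q ∉ B ∪ c, GC (sgn Q₂) (A ∪ B ∪ c) q := fun q hq =>
    (h2.gc_sgn.2 hq).mono (union_subset_union_left _ subset_union_right)
  have oQ : ∀ q, q ∉ A ∪ B ∪ c → GC (sgn Q) (A ∪ B ∪ c) q := fun q hq =>
    sQ q fun h => hq (Or.inl h)
  have o1 : ∀ q, q ∉ A ∪ B ∪ c → GC (sgn Q₁) (A ∪ B ∪ c) q := fun q hq =>
    s1 q fun h => hq (h.elim (fun h => Or.inl (Or.inl h)) Or.inr)
  have o2 : ∀ q, q ∉ A ∪ B ∪ c → GC (sgn Q₂) (A ∪ B ∪ c) q := fun q hq =>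
    s2 q fun h => hq (h.elim (fun h => Or.inl (Or.inr h)) Or.inr)
  have nQ : ∀ q ∈ A ∪ B, q ∉ c → ¬ GC (sgn Q) (A ∪ B ∪ c) q := fun q hq hqc h =>
    hQ.gc_sgn.1 ((gc_congr_set (eventually_mem_union_iff hc.1.1 hqc)).1 h) hq
  have n1 : ∀ q ∈ A ∪ c, q ∉ B → ¬ GC (sgn Q₁) (A ∪ B ∪ c) q := fun q hq hqB h => by
    rw [union_right_comm] at h
    exact h1.gc_sgn.1 ((gc_congr_set (eventually_mem_union_iff hB.1.1 hqB)).1 h) hq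
  have n2 : ∀ q ∈ B ∪ c, q ∉ A → ¬ GC (sgn Q₂) (A ∪ B ∪ c) q := fun q hq hqA h => by
    rw [union_comm A, union_right_comm] at h
    exact h2.gc_sgn.1 ((gc_congr_set (eventually_mem_union_iff hA.1.1 hqA)).1 h) hq
  have key : ∀ p, GC (fun x => sgn Q x * sgn Q₁ x * sgn Q₂ x) (A ∪ B ∪ c) p := by
    have hne : ∀ q ∉ ({a, b} : Set X), (q ∈ A ∪ B ∪ c → Flat (A ∪ B ∪ c) q) →
        GC (fun x => sgn Q x * sgn Q₁ x * sgn Q₂ x) (A ∪ B ∪ c) q := by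
      intro q hqab hfl
      by_cases hq : q ∈ A ∪ B ∪ c
      · have hfl := hfl hq
        have eQ := Eventually.of_forall (f := 𝓝 q) oQ
        have e1 := Eventually.of_forall (f := 𝓝 q) o1
        have e2 := Eventually.of_forall (f := 𝓝 q) o2
        have hqA : q ∈ A → q ∉ B ∪ c := fun h h' => hqab
          (h'.elim (fun h' => hAB ▸ ⟨h, h'⟩) fun h' => hAc ▸ ⟨h, h'⟩)
        have hqB : q ∈ B → q ∉ A ∪ c := fun h h' => hqab
          (h'.elim (fun h' => hAB ▸ ⟨h', h⟩) fun h' => hBc ▸ ⟨h, h'⟩)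
        have hqc : q ∈ c → q ∉ A ∪ B := fun h h' => hqab
          (h'.elim (fun h' => hAc ▸ ⟨h', h⟩) fun h' => hBc ▸ ⟨h', h⟩)
        rcases hq with (hq | hq) | hq
        · have hn := not_or.1 (hqA hq)
          exact hfl.gc_mul_mul eQ e1 (nQ q (Or.inl hq) hn.2) (n1 q (Or.inl hq) hn.1)
            (s2 q (hqA hq))
        · have hn := not_or.1 (hqB hq)
          have := hfl.gc_mul_mul eQ e2 (nQ q (Or.inr hq) hn.2) (n2 q (Or.inl hq) hn.1)
            (s1 q (hqB hq))
          simpa only [mul_right_comm] using this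
        · have hn := not_or.1 (hqc hq)
          have := hfl.gc_mul_mul e1 e2 (n1 q (Or.inr hq) hn.2) (n2 q (Or.inr hq) hn.1)
            (sQ q (hqc hq))
          convert this using 2 with x
          exact (mul_assoc _ _ _).trans (mul_comm _ _)
      · exact ((oQ q hq).mul (o1 q hq)).mul (o2 q hq)
    intro p
    by_cases hp : p ∈ A ∪ B ∪ c
    · refine gc_of_punctured hT.dense hp ?_
      filter_upwards [hT.eventually_flat p, hab p] with q h1 h2 using hne q h2 h1
    · exact ((oQ p hp).mul (o1 p hp)).mul (o2 p hp)
  obtain ⟨R, hR, hd, hu⟩ := hQ.exists_other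
  obtain ⟨r, hr⟩ := hR.isConnected.nonempty
  have hrQ : r ∉ Q := fun h => disjoint_left.1 hd h hr
  have hrJ : r ∉ A ∪ B := disjoint_left.1 hR.disjoint hr
  have hrc : r ∉ A ∪ B ∪ c := fun h => h.elim hrJ fun h => by
    by_cases hrab : r ∈ ({a, b} : Set X)
    · exact hrJ (Or.inl (hAc.symm.subset hrab).1)
    · exact hrQ (hcQ ⟨h, hrab⟩)
  have hval : ∀ x ∈ Q, x ∉ c → sgn Q₁ x * sgn Q₂ x = -1 := fun x hx hxc => by
    have := eq_of_forall_gc hT.dense key (x := x) (y := r)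
      (fun h => h.elim (disjoint_left.1 hQ.disjoint hx) hxc) hrc
    simp only [sgn_of_mem hx, sgn_of_notMem hrQ, sgn_of_notMem fun h => hrQ (h1Q h),
      sgn_of_notMem fun h => hrQ (h2Q h)] at this
    rw [one_mul] at this
    rw [this]
    rfl
  refine ⟨Q₁, Q₂, h1, h2, disjoint_left.2 fun x hx1 hx2 => ?_, h1Q, h2Q, fun x hx => ?_⟩
  · have := hval x (h1Q hx1) fun h => disjoint_left.1 h1.disjoint hx1 (Or.inr h)
    rw [sgn_of_mem hx1, sgn_of_mem hx2] at this
    exact absurd this (by decide)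
  · by_contra hcon
    simp only [mem_union, not_or] at hcon
    have := hval x hx hcon.2
    rw [sgn_of_notMem hcon.1.1, sgn_of_notMem hcon.1.2] at this
    exact absurd this (by decide)

end

/-! ### Crosscuts -/

section
variable {X : Type*} [TopologicalSpace X] [T2Space X] [Surface X] {x y : X} {σ O : Set X}

theorem NArc.isPreconnected_sdiff (hσ : NArc σ x y) (hO : IsOpen O) (hOc : IsPreconnected O)
    (hx : x ∉ O) (hσO : σ \ {x} ⊆ O) : IsPreconnected (O \ σ) := by
  have hT := hσ.1
  obtain ⟨-, γ, hc, hi, rfl, rfl, rfl⟩ := hσ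
  set σ := γ '' Icc 0 1
  have hOσ : IsOpen (O \ σ) := hO.sdiff hT.1
  rw [isPreconnected_iff_subset_of_disjoint]
  intro u v hu hv huv hd
  have hf : ∀ p ∈ O, p ∉ σ → GC (sgn u) σ p := fun p hp hpσ => by
    rcases huv ⟨hp, hpσ⟩ with h | h
    · refine gc_of_eventually (c := 1) ?_
      filter_upwards [hu.mem_nhds h] with q hq using sgn_of_mem hq
    · refine gc_of_eventually (c := -1) ?_
      filter_upwards [(hOσ.inter hv).mem_nhds ⟨⟨hp, hpσ⟩, h⟩] with q hq
      exact sgn_of_notMem fun h => (hd.subset ⟨hq.1, h, hq.2⟩ : q ∈ (∅ : Set X))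
  have hmem : ∀ t ∈ Ioc (0 : ℝ) 1, γ t ∈ O := fun t ht =>
    hσO ⟨⟨t, ⟨ht.1.le, ht.2⟩, rfl⟩, fun h => ht.1.ne'
      (hi ⟨ht.1.le, ht.2⟩ (left_mem_Icc.2 zero_le_one) h)⟩
  have hev : ∀ t ∈ Ioc (0 : ℝ) 1, ∀ᶠ q in 𝓝 (γ t), q ∉ σ → GC (sgn u) σ q := fun t ht => by
    filter_upwards [hO.mem_nhds (hmem t ht)] with q hq using hf q hq
  have h1 : GC (sgn u) σ (γ 1) := by
    have h1' : (1 : ℝ) ∈ Icc (0 : ℝ) 1 := right_mem_Icc.2 zero_le_one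
    obtain ⟨r, hr, hr1, a, ha, hai⟩ := exists_branch h1' (t := 1 / 2) ⟨by norm_num, by norm_num⟩
      (by norm_num) hc hi hT Subset.rfl
    rw [uIcc_of_ge (by norm_num)] at hr
    rw [uIcc_of_ge hr.2] at hai
    refine ha.gc_endpoint hT.1 hT.dense ?_
    have hcl : IsClosed (γ '' Icc 0 r) := (isCompact_Icc.image_of_continuousOn
      (hc.mono (Icc_subset_Icc_right hr.2))).isClosed
    have hn : γ 1 ∉ γ '' Icc 0 r := by
      rintro ⟨t, ht, e⟩
      exact hr1 (le_antisymm hr.2 (hi ⟨ht.1, ht.2.trans hr.2⟩ h1' e ▸ ht.2))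
    filter_upwards [hev 1 (right_mem_Ioc.2 zero_lt_one), hcl.isOpen_compl.mem_nhds hn]
      with q hq1 hq2 hq3
    refine hq1 ?_
    rintro ⟨t, ht, rfl⟩
    rcases le_total t r with h | h
    · exact hq2 ⟨t, ⟨ht.1, h⟩, rfl⟩
    · exact hq3 (hai ▸ ⟨t, ⟨h, ht.2⟩, rfl⟩)
  have hall : ∀ t ∈ Ioc (0 : ℝ) 1, GC (sgn u) σ (γ t) := by
    intro t ht
    refine (isPreconnected_Ioc.induction₂ (fun s t => GC (sgn u) σ (γ s) ↔ GC (sgn u) σ (γ t))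
      (fun t ht => ?_) (fun _ _ _ _ _ _ h1 h2 => h1.trans h2) (fun _ _ _ _ h => h.symm)
      (right_mem_Ioc.2 zero_lt_one) ht).1 h1
    have hct : Tendsto γ (𝓝[Ioc 0 1] t) (𝓝 (γ t)) :=
      (hc.mono Ioc_subset_Icc_self) t ht
    rcases ht.2.eq_or_lt with rfl | ht1
    · filter_upwards [hct.eventually h1.eventually] with s hs using iff_of_true h1 hs
    · have htm := (corner_of_param (J := σ) ⟨ht.1, ht1⟩ hc hi hT Subset.rfl
        (Eventually.of_forall fun _ => id)).tame hT.1 hT.dense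
      filter_upwards [hct.eventually (htm.dichotomy _ (hev t ht)), self_mem_nhdsWithin] with s hs hs'
      exact (hs ⟨s, Ioc_subset_Icc_self hs', rfl⟩).symm
  have hO' : ∀ q ∈ O, GC (sgn u) σ q := fun q hq => by
    by_cases hqσ : q ∈ σ
    · obtain ⟨t, ht, rfl⟩ := hqσ
      exact hall t ⟨lt_of_le_of_ne ht.1 fun h => hx (h ▸ hq), ht.2⟩
    · exact hf q hq hqσ
  by_cases hne : ((O \ σ) ∩ u).Nonempty
  · obtain ⟨p, hp, hpu⟩ := hne
    left
    intro q hq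
    exact (sgn_eq_sgn.1 (eq_of_isPreconnected hOc hT.dense hO' hp hq)).1 hpu
  · right
    exact fun q hq => (huv hq).resolve_left fun h => hne ⟨q, hq, h⟩

theorem NArc.exists_extend {A : Set X} {b b' : X} (hA : NArc A b b') (hO : IsOpen O)
    (hOc : IsPreconnected O) (hAO : A \ {b} ⊆ O) (hb : b ∉ O) (hy : y ∈ O) :
    ∃ C, NArc C b y ∧ C \ {b} ⊆ O := by
  have hb' : b' ∈ O := hAO ⟨hA.right_mem, hA.ne.symm⟩
  by_cases h : b' = y
  · exact ⟨A, h ▸ hA, hAO⟩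
  obtain ⟨D, hD, hDn⟩ := exists_narc_subset hO hOc hb' hy h
  obtain ⟨C, hC, hCn⟩ := hA.concat hDn fun h => hb (h ▸ hy)
  exact ⟨C, hCn, fun q hq => (hC hq.1).elim (fun h => hAO ⟨h, hq.2⟩) fun h => hD h⟩

variable {Q J : Set X} {a b : X}

theorem MCell.exists_access (hQ : MCell Q J) (ha : Flat J a) {W : Set X} (hW : W ∈ 𝓝 a) :
    ∃ a' A, NArc A a a' ∧ A \ {a} ⊆ Q ∧ A ⊆ W := by
  obtain ⟨ψ, hψ, rfl, hJ, hψW⟩ := ha.exists_small hW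
  have hcl : ψ 0 ∈ closure Q := hQ.closure_eq ▸ Or.inr ha.mem
  obtain ⟨_, ⟨z, rfl⟩, hz⟩ := mem_closure_iff.1 hcl _ hψ.isOpen_range ⟨0, rfl⟩
  have hzim : z.im ≠ 0 := fun h => disjoint_left.1 hQ.disjoint hz ((hJ z).2 h)
  have hz0 : (0 : ℂ) ≠ z := by
    rintro rfl
    exact hzim rfl
  refine ⟨ψ z, _, (narc_segment hz0).image hψ, ?_, (image_subset_range _ _).trans hψW⟩
  have hsub : ψ '' segment ℝ 0 z \ {ψ 0} ⊆ (fun t : ℝ => ψ (t * z)) '' Ioc 0 1 := by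
    rintro _ ⟨⟨w, hw, rfl⟩, hne⟩
    rw [segment_eq_image] at hw
    obtain ⟨t, ht, rfl⟩ := hw
    have e : (1 - t) • (0 : ℂ) + t • z = t * z := by simp
    refine ⟨t, ⟨lt_of_le_of_ne ht.1 fun h => hne ?_, ht.2⟩, by simp only [e]⟩
    simp [← h]
  refine hsub.trans (hQ.subset_of (isPreconnected_Ioc.image _ ?_) ?_ ?_)
  · have := hψ.continuous
    fun_prop
  · rw [disjoint_left]
    rintro _ ⟨t, ht, rfl⟩ h
    rw [hJ] at h
    simp [ht.1.ne', hzim] at h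
  · exact ⟨ψ z, ⟨1, by simp, by simp⟩, hz⟩

theorem MCell.exists_crosscut (hQ : MCell Q J) (ha : Flat J a) (hb : Flat J b) (hab : a ≠ b) :
    ∃ c, NArc c a b ∧ c \ {a, b} ⊆ Q := by
  have hJ : ∀ {p}, Flat J p → p ∉ Q := fun h hp => disjoint_left.1 hQ.disjoint hp h.mem
  obtain ⟨a', A, hA, hAQ, -⟩ := hQ.exists_access ha univ_mem
  obtain ⟨b', B, hB, hBQ, -⟩ := hQ.exists_access hb univ_mem
  obtain ⟨C, hC, hCQ⟩ := hB.exists_extend hQ.isOpen hQ.isConnected.isPreconnected hBQ (hJ hb)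
    (hAQ ⟨hA.right_mem, hA.ne.symm⟩)
  obtain ⟨c, hc, hcn⟩ := hA.concat hC.symm hab
  refine ⟨c, hcn, fun q hq => ?_⟩
  have h2 := not_or.1 hq.2
  exact (hc hq.1).elim (fun h => hAQ ⟨h, h2.1⟩) fun h => hCQ ⟨h, h2.2⟩

theorem mem_segment_smul {e w : ℂ} {s t : ℝ} (hst : s ≤ t) :
    w ∈ segment ℝ (s • e) (t • e) ↔ ∃ r ∈ Icc s t, r • e = w := by
  have := image_segment ℝ (LinearMap.toSpanSingleton ℝ ℂ e).toAffineMap s t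
  simp only [LinearMap.coe_toAffineMap, LinearMap.toSpanSingleton_apply] at this
  rw [← this, segment_eq_Icc hst]
  rfl

theorem mem_image_segment_smul {Y : Type*} {f : ℂ → Y} {e : ℂ} {s t : ℝ} (hst : s ≤ t) {q : Y} :
    q ∈ f '' segment ℝ (s • e) (t • e) ↔ ∃ r ∈ Icc s t, f (r • e) = q := by
  constructor
  · rintro ⟨w, hw, rfl⟩
    obtain ⟨r, hr, rfl⟩ := (mem_segment_smul hst).1 hw
    exact ⟨r, hr, rfl⟩
  · rintro ⟨r, hr, rfl⟩
    exact ⟨_, (mem_segment_smul hst).2 ⟨r, hr, rfl⟩, rfl⟩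

theorem MCell.exists_crosscut_through (hQ : MCell Q J) (ha : Flat J a) (hb : Flat J b)
    (hab : a ≠ b) {z : X} (hz : z ∈ Q) : ∃ c, NArc c a b ∧ c \ {a, b} ⊆ Q ∧ z ∈ c := by
  have hJ : ∀ {p}, Flat J p → p ∉ Q := fun h hp => disjoint_left.1 hQ.disjoint hp h.mem
  obtain ⟨ψ, hψ, rfl, hψQ⟩ := Surface.exists_small (hQ.isOpen.mem_nhds hz)
  have hψQ' : ∀ w, ψ w ∈ Q := fun w => hψQ ⟨w, rfl⟩
  obtain ⟨a', A, hA, hAQ, -⟩ := hQ.exists_access ha univ_mem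
  obtain ⟨C₀, hC₀, hC₀Q⟩ := hA.exists_extend hQ.isOpen hQ.isConnected.isPreconnected hAQ (hJ ha) hz
  have hFcl : IsClosed (ψ '' closedBall 0 1) :=
    ((isCompact_closedBall _ _).image hψ.continuous).isClosed
  have haF : a ∉ ψ '' closedBall 0 1 := fun ⟨w, _, e⟩ => hJ ha (e ▸ hψQ' w)
  obtain ⟨A', hA', p, ⟨e, he, rfl⟩, hA'n, hA'F⟩ := hC₀.hit hFcl haF
    ⟨_, hC₀.right_mem, 0, by simp, rfl⟩
  have hA'Q : A' \ {a} ⊆ Q := (sdiff_subset_sdiff_left hA').trans hC₀Q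
  have he0 : e ≠ 0 := by
    rintro rfl
    have hop : IsOpen (ψ '' ball 0 1) := hψ.isOpenMap _ isOpen_ball
    have h0 : ψ 0 ∈ ψ '' ball 0 1 := ⟨0, by simp, rfl⟩
    have := hA'n.isConnected.isPreconnected.subset_of_closure_inter_subset hop
      ⟨_, hA'n.right_mem, h0⟩ fun q hq => by
        have h1 : q ∈ A' ∩ ψ '' closedBall 0 1 := ⟨hq.2, closure_minimal
          (image_mono ball_subset_closedBall) hFcl hq.1⟩
        rw [hA'F] at h1
        exact h1 ▸ h0
    exact haF (image_mono ball_subset_closedBall (this hA'n.left_mem))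
  have hmem : ∀ r ∈ Icc (-1 : ℝ) 1, ψ (r • e) ∈ ψ '' closedBall 0 1 := fun r hr => by
    refine ⟨_, ?_, rfl⟩
    rw [mem_closedBall_zero_iff] at he ⊢
    rw [norm_smul]
    exact mul_le_one₀ (abs_le.2 hr) (norm_nonneg _) he
  have hA'e : ∀ r ∈ Icc (-1 : ℝ) 1, ψ (r • e) ∈ A' → r = 1 := fun r hr h => by
    have h1 : ψ (r • e) ∈ A' ∩ ψ '' closedBall 0 1 := ⟨h, hmem r hr⟩
    rw [hA'F] at h1
    have h2 : r • e = (1 : ℝ) • e := by rw [one_smul]; exact hψ.injective h1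
    exact smul_left_injective ℝ he0 h2
  have hne : ∀ {r s : ℝ}, r ≠ s → r • e ≠ s • e := fun h h' => h (smul_left_injective ℝ he0 h')
  have hS₁ := (narc_segment (hne (show (1 : ℝ) ≠ -1 / 2 by norm_num))).image hψ
  have hS₂ := (narc_segment (hne (show (-1 : ℝ) ≠ -1 / 2 by norm_num))).image hψ
  rw [segment_symm] at hS₁
  have hS₁m : ∀ q, q ∈ ψ '' segment ℝ ((-1 / 2 : ℝ) • e) ((1 : ℝ) • e) ↔
      ∃ r ∈ Icc (-1 / 2 : ℝ) 1, ψ (r • e) = q := fun q => mem_image_segment_smul (by norm_num)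
  have hS₂m : ∀ q, q ∈ ψ '' segment ℝ ((-1 : ℝ) • e) ((-1 / 2 : ℝ) • e) ↔
      ∃ r ∈ Icc (-1 : ℝ) (-1 / 2), ψ (r • e) = q := fun q => mem_image_segment_smul (by norm_num)
  set S₁ := ψ '' segment ℝ ((-1 / 2 : ℝ) • e) ((1 : ℝ) • e)
  set S₂ := ψ '' segment ℝ ((-1 : ℝ) • e) ((-1 / 2 : ℝ) • e)
  have hAn : NArc A' a (ψ ((1 : ℝ) • e)) := by rwa [one_smul]
  have hσ := hAn.join hS₁ (Subset.antisymm (fun q hq => by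
    obtain ⟨r, hr, rfl⟩ := (hS₁m q).1 hq.2
    rw [hA'e r ⟨by linarith [hr.1], hr.2⟩ hq.1]
    rfl) (singleton_subset_iff.2 ⟨hAn.right_mem, hS₁.left_mem⟩))
  have hS₁Q : S₁ ⊆ Q := fun q hq => by
    obtain ⟨r, hr, rfl⟩ := (hS₁m q).1 hq
    exact hψQ' _
  have hS₂Q : S₂ ⊆ Q := fun q hq => by
    obtain ⟨r, hr, rfl⟩ := (hS₂m q).1 hq
    exact hψQ' _
  have hσQ : (A' ∪ S₁) \ {a} ⊆ Q := fun q hq => hq.1.elim (fun h => hA'Q ⟨h, hq.2⟩) fun h => hS₁Q h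
  have hO : IsOpen (Q \ (A' ∪ S₁)) := hQ.isOpen.sdiff hσ.1.1
  have hOc := hσ.isPreconnected_sdiff hQ.isOpen hQ.isConnected.isPreconnected (hJ ha) hσQ
  have hy : ψ ((-1 : ℝ) • e) ∈ Q \ (A' ∪ S₁) := by
    refine ⟨hψQ' _, ?_⟩
    rintro (h | h)
    · have := hA'e _ (by norm_num) h
      norm_num at this
    · obtain ⟨r, hr, h⟩ := (hS₁m _).1 h
      have := smul_left_injective ℝ he0 (hψ.injective h)
      norm_num [this] at hr
  have hbσ : b ∉ A' ∪ S₁ := fun h => hJ hb (hσQ ⟨h, hab.symm⟩)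
  obtain ⟨b', B, hB, hBQ, hBW⟩ := hQ.exists_access hb (hσ.1.1.isOpen_compl.mem_nhds hbσ)
  obtain ⟨C, hC, hCO⟩ := hB.exists_extend hO hOc (fun q hq => ⟨hBQ hq, hBW hq.1⟩)
    (fun h => hJ hb h.1) hy
  obtain ⟨D, hD, hDn⟩ := hC.concat hS₂ fun h => hJ hb (h ▸ hψQ' _)
  have hj := hσ.join hDn.symm (Subset.antisymm (fun q hq => by
    have hqS : q ∈ S₂ := (hD hq.2).resolve_left fun h =>
      (hCO ⟨h, fun h' => hbσ (h' ▸ hq.1)⟩).2 hq.1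
    obtain ⟨r, hr, rfl⟩ := (hS₂m q).1 hqS
    have hr1 : r ≠ 1 := by linarith [hr.2]
    rcases hq.1 with h | h
    · exact absurd (hA'e r ⟨hr.1, by linarith [hr.2]⟩ h) hr1
    · obtain ⟨r', hr', h⟩ := (hS₁m _).1 h
      have := smul_left_injective ℝ he0 (hψ.injective h)
      rw [le_antisymm hr.2 (this ▸ hr'.1)]
      rfl) (singleton_subset_iff.2 ⟨hσ.right_mem, hDn.right_mem⟩))
  refine ⟨_, hj, fun q hq => ?_, Or.inl (Or.inr ((hS₁m _).2 ⟨0, by norm_num, by simp⟩))⟩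
  have h2 := not_or.1 hq.2
  rcases hq.1 with h | h
  · exact hσQ ⟨h, h2.1⟩
  · exact (hD h).elim (fun h => (hCO ⟨h, h2.2⟩).1) fun h => hS₂Q h

theorem NCurve.infinite (h : NCurve J) : J.Infinite := by
  obtain ⟨-, γ, -, hi, rfl⟩ := h
  refine ((Icc_infinite (show (0 : ℝ) < 1 / 2 by norm_num)).image (f := γ) ?_).mono
    (image_subset_range _ _)
  intro s hs t ht e
  obtain ⟨n, hn⟩ := (hi s t).1 e
  have h1 : (n : ℝ) < 1 := by linarith [hs.2, ht.1]
  have h2 : (-1 : ℝ) < n := by linarith [hs.1, ht.2]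
  have : n = 0 := by
    have h1 : n < 1 := by exact_mod_cast h1
    have h2 : -1 < n := by exact_mod_cast h2
    omega
  rw [this, Int.cast_zero] at hn
  linarith

theorem NCurve.infinite_flat (h : NCurve J) : {p | Flat J p}.Infinite := by
  intro hf
  refine h.infinite ((h.1.2.union hf).subset fun p hp => ?_)
  by_cases hp' : Flat J p
  · exact Or.inr hp'
  · exact Or.inl ⟨hp, hp'⟩

end

section
variable {X : Type*} [TopologicalSpace X] [Planar X] {ψ : ℂ → X}

theorem mcell_ball (hψ : IsOpenEmbedding ψ) : MCell (ψ '' ball 0 1) (ψ '' sphere 0 1) := by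
  refine ⟨ncurve_circle.image hψ, hψ.isOpenMap _ isOpen_ball,
    ⟨⟨ψ 0, 0, by simp, rfl⟩, ((convex_ball _ _).isPreconnected).image _ hψ.continuous.continuousOn⟩,
    (disjoint_image_iff hψ.injective).2 (sphere_disjoint_ball).symm, ?_⟩
  rw [← image_union, ball_union_sphere]
  refine Subset.antisymm (closure_minimal (image_mono ball_subset_closedBall)
    ((isCompact_closedBall _ _).image hψ.continuous).isClosed) ?_
  rw [← closure_ball _ one_ne_zero]
  exact image_closure_subset_closure_image hψ.continuous

theorem isPreconnected_compl_image_closedBall (hψ : IsOpenEmbedding ψ) :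
    IsPreconnected (ψ '' closedBall 0 1)ᶜ := by
  obtain ⟨R, hR, hd, hu⟩ := (mcell_ball hψ).exists_other
  have : R = (ψ '' closedBall 0 1)ᶜ := by
    rw [← ball_union_sphere, image_union, compl_union, ← hu, inter_union_distrib_left]
    simp only [compl_inter_self, empty_union]
    exact (inter_eq_right.2 (subset_compl_iff_disjoint_left.2 hd)).symm
  exact this ▸ hR.isConnected.isPreconnected

end

/-! ### Gaps of a circle in a cell -/

section
variable {X : Type*} [MetricSpace X] {J : Set X}

theorem NCurve.exists_small_split (h : NCurve J) {ε : ℝ} (hε : 0 < ε) : ∃ δ > 0, ∀ a ∈ J, ∀ b ∈ J,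
    a ≠ b → dist a b < δ → ∃ A B, NArc A a b ∧ NArc B a b ∧ A ∩ B = {a, b} ∧ A ∪ B = J ∧
      ∀ z ∈ A, ∀ w ∈ A, dist z w < ε := by
  obtain ⟨hT, γ, hc, hi, rfl⟩ := h
  obtain ⟨η, hη, hγη⟩ := Metric.uniformContinuousOn_iff.1
    ((isCompact_Icc (a := (0 : ℝ)) (b := 2)).uniformContinuousOn_of_continuous hc.continuousOn) ε hε
  have hη' : ∀ s t, 0 ≤ s → t ≤ 2 → t - s < η → ∀ z ∈ γ '' Icc s t, ∀ w ∈ γ '' Icc s t,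
      dist z w < ε := by
    rintro s t hs ht hst _ ⟨p, hp, rfl⟩ _ ⟨q, hq, rfl⟩
    refine hγη p ⟨hs.trans hp.1, hp.2.trans ht⟩ q ⟨hs.trans hq.1, hq.2.trans ht⟩ ?_
    rw [Real.dist_eq, abs_lt]
    constructor <;> linarith [hp.1, hp.2, hq.1, hq.2]
  let K : Set (ℝ × ℝ) := (Icc 0 1 ×ˢ Icc 0 1) ∩ ({p | η ≤ p.2 - p.1} ∩ {p | p.2 - p.1 ≤ 1 - η})
  have hK : IsCompact K := (isCompact_Icc.prod isCompact_Icc).inter_right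
    ((isClosed_le continuous_const (by fun_prop)).inter (isClosed_le (by fun_prop) (by fun_prop)))
  obtain ⟨δ, hδ, hδK⟩ : ∃ δ > 0, ∀ p ∈ K, δ ≤ dist (γ p.1) (γ p.2) := by
    rcases K.eq_empty_or_nonempty with h | h
    · exact ⟨1, one_pos, by simp [h]⟩
    · obtain ⟨p, hp, hmin⟩ := hK.exists_isMinOn h
        (f := fun p : ℝ × ℝ => dist (γ p.1) (γ p.2)) (by fun_prop)
      refine ⟨_, dist_pos.2 fun e => ?_, hmin⟩
      obtain ⟨n, hn⟩ := (hi _ _).1 e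
      have h1 : η ≤ p.2 - p.1 := hp.2.1
      have h2 : p.2 - p.1 ≤ 1 - η := hp.2.2
      have h3 : (n : ℝ) < 0 := by linarith
      have h4 : (-1 : ℝ) < n := by linarith
      have h3 : n < 0 := by exact_mod_cast h3
      have h4 : -1 < n := by exact_mod_cast h4
      omega
  have main : ∀ s ∈ Ico (0 : ℝ) 1, ∀ t ∈ Ico (0 : ℝ) 1, s < t → dist (γ s) (γ t) < δ →
      ∃ A B, NArc A (γ s) (γ t) ∧ NArc B (γ s) (γ t) ∧ A ∩ B = {γ s, γ t} ∧ A ∪ B = range γ ∧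
      ∀ z ∈ A, ∀ w ∈ A, dist z w < ε := by
    intro s hs t ht hst hd
    have hts : t < s + 1 := by linarith [hs.1, ht.2]
    obtain ⟨h1, h2, h3, h4⟩ := split_param hT hc hi hst hts
    by_cases h : t - s < η
    · exact ⟨_, _, h1, h2, h3, h4, hη' _ _ hs.1 (by linarith [ht.2]) h⟩
    by_cases h' : t - s ≤ 1 - η
    · exact absurd hd (not_lt.2 (hδK (s, t) ⟨⟨Ico_subset_Icc_self hs, Ico_subset_Icc_self ht⟩,
        not_lt.1 h, h'⟩))
    · refine ⟨_, _, h2, h1, ?_, ?_, hη' _ _ ht.1 (by linarith [hs.2]) (by linarith)⟩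
      · rw [inter_comm, h3]
      · rw [union_comm, h4]
  refine ⟨δ, hδ, ?_⟩
  have hfr : ∀ s, γ s = γ (Int.fract s) := fun s => (hi _ _).2 ⟨⌊s⌋, by rw [Int.self_sub_fract]⟩
  rintro _ ⟨s, rfl⟩ _ ⟨t, rfl⟩ hab hd
  rw [hfr s, hfr t] at *
  have hs : Int.fract s ∈ Ico (0 : ℝ) 1 := ⟨Int.fract_nonneg _, Int.fract_lt_one _⟩
  have ht : Int.fract t ∈ Ico (0 : ℝ) 1 := ⟨Int.fract_nonneg _, Int.fract_lt_one _⟩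
  rcases lt_trichotomy (Int.fract s) (Int.fract t) with h | h | h
  · exact main _ hs _ ht h hd
  · exact absurd (congrArg γ h) hab
  · obtain ⟨A, B, h1, h2, h3, h4, h5⟩ := main _ ht _ hs h (by rwa [dist_comm])
    exact ⟨A, B, h1.symm, h2.symm, by rw [h3, pair_comm], h4, h5⟩

end

section
variable {X : Type*} [TopologicalSpace X] {Q : Set X} {c : ℝ → X} {u v u' v' t : ℝ}

structure IsGap (Q : Set X) (c : ℝ → X) (u v : ℝ) : Prop where
  lt : u < v
  nonneg : 0 ≤ u
  le_one : v ≤ 1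
  left : c u ∉ Q
  right : c v ∉ Q
  mem : ∀ t ∈ Ioo u v, c t ∈ Q

theorem IsGap.eq (h : IsGap Q c u v) (h' : IsGap Q c u' v') (ht : t ∈ Ioo u v)
    (ht' : t ∈ Ioo u' v') : u = u' ∧ v = v' := by
  have h1 : u' ≤ u := by
    by_contra! hu
    exact h'.left (h.mem _ ⟨hu, ht'.1.trans ht.2⟩)
  have h2 : u ≤ u' := by
    by_contra! hu
    exact h.left (h'.mem _ ⟨hu, ht.1.trans ht'.2⟩)
  have h3 : v' ≤ v := by
    by_contra! hu
    exact h.right (h'.mem _ ⟨ht'.1.trans ht.2, hu⟩)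
  have h4 : v ≤ v' := by
    by_contra! hu
    exact h'.right (h.mem _ ⟨ht.1.trans ht'.2, hu⟩)
  exact ⟨le_antisymm h2 h1, le_antisymm h4 h3⟩

theorem IsGap.sub_le (h : IsGap Q c u v) (h2 : c (1 / 2) ∉ Q) : v - u ≤ 1 / 2 := by
  rcases le_or_gt v (1 / 2) with h1 | h1
  · linarith [h.nonneg]
  rcases le_or_gt (1 / 2) u with h3 | h3
  · linarith [h.le_one]
  · exact absurd (h.mem _ ⟨h3, h1⟩) h2

theorem exists_isGap (hc : Continuous c) (hQ : IsOpen Q) (h0 : c 0 ∉ Q) (h1 : c 1 ∉ Q)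
    (ht : t ∈ Icc (0 : ℝ) 1) (htQ : c t ∈ Q) : ∃ u v, IsGap Q c u v ∧ t ∈ Ioo u v := by
  have hcl : IsClosed {s | c s ∉ Q} := hQ.isClosed_compl.preimage hc
  obtain ⟨u, ⟨⟨hu, hut⟩, huQ⟩, hu'⟩ := (isCompact_Icc.inter_right hcl).exists_isGreatest
    ⟨0, ⟨le_rfl, ht.1⟩, h0⟩
  obtain ⟨v, ⟨⟨hv, hvt⟩, hvQ⟩, hv'⟩ := (isCompact_Icc.inter_right hcl).exists_isLeast
    ⟨1, ⟨ht.2, le_rfl⟩, h1⟩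
  have hut' : u < t := lt_of_le_of_ne hut fun h => huQ (h ▸ htQ)
  have hvt' : t < v := lt_of_le_of_ne hv fun h => hvQ (h ▸ htQ)
  refine ⟨u, v, ⟨hut'.trans hvt', hu, hvt, huQ, hvQ, fun s hs => ?_⟩, hut', hvt'⟩
  by_contra hsQ
  rcases le_total s t with h | h
  · exact not_lt.2 (hu' ⟨⟨hu.trans hs.1.le, h⟩, hsQ⟩) hs.1
  · exact not_lt.2 (hv' ⟨⟨h, hs.2.le.trans hvt⟩, hsQ⟩) hs.2

theorem finite_isGap {ρ : ℝ} (hρ : 0 < ρ) :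
    {g : ℝ × ℝ | IsGap Q c g.1 g.2 ∧ ρ ≤ g.2 - g.1}.Finite := by
  refine Finite.of_finite_image (f := fun g => ⌊g.1 / ρ⌋)
    ((finite_Icc (0 : ℤ) ⌊1 / ρ⌋).subset ?_) ?_
  · rintro _ ⟨g, ⟨hg, hg'⟩, rfl⟩
    refine ⟨Int.floor_nonneg.2 (div_nonneg hg.nonneg hρ.le), Int.floor_le_floor ?_⟩
    gcongr
    linarith [hg.lt, hg.le_one]
  · have key : ∀ g g' : ℝ × ℝ, IsGap Q c g.1 g.2 → IsGap Q c g'.1 g'.2 → ρ ≤ g.2 - g.1 →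
        ⌊g.1 / ρ⌋ = ⌊g'.1 / ρ⌋ → g.1 ≤ g'.1 → g = g' := by
      intro g g' h h' hl e hle
      have h1 : g'.1 < g.2 := by
        have := Int.abs_sub_lt_one_of_floor_eq_floor e
        rw [← sub_div, abs_div, abs_of_pos hρ, div_lt_one hρ, abs_sub_comm,
          abs_of_nonneg (sub_nonneg.2 hle)] at this
        linarith
      obtain ⟨t, ht⟩ := exists_between (lt_min h1 h'.lt)
      have h2 := lt_min_iff.1 ht.2
      obtain ⟨e1, e2⟩ := h.eq h' ⟨hle.trans_lt ht.1, h2.1⟩ ⟨ht.1, h2.2⟩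
      exact Prod.ext e1 e2
    intro g hg g' hg' e
    rcases le_total g.1 g'.1 with h | h
    · exact key g g' hg.1 hg'.1 hg.2 e h
    · exact (key g' g hg'.1 hg.1 hg'.2 e.symm h).symm

theorem GC.prod {ι : Type*} {J : Set X} {p : X} (s : Finset ι) {f : ι → X → ℤˣ}
    (h : ∀ i ∈ s, GC (f i) J p) : GC (fun x => ∏ i ∈ s, f i x) J p := by
  classical
  induction s using Finset.induction_on with
  | empty => exact gc_of_eventually (c := 1) (by simp)
  | insert i s hi ih =>
    simp only [Finset.prod_insert hi]
    exact (h i (Finset.mem_insert_self i s)).mul (ih fun j hj => h j (Finset.mem_insert_of_mem hj))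

end

section
variable {X : Type*} [TopologicalSpace X] [Planar X] {Q J B : Set X} {c : ℝ → X}

theorem exists_mem_Ico_of_mem_range (hci : ∀ s t, c s = c t ↔ ∃ n : ℤ, s - t = n) {q : X}
    (hq : q ∈ range c) : ∃ t ∈ Ico (0 : ℝ) 1, c t = q := by
  obtain ⟨t, rfl⟩ := hq
  exact ⟨Int.fract t, ⟨Int.fract_nonneg t, Int.fract_lt_one t⟩,
    (hci _ _).2 ⟨-⌊t⌋, by rw [Int.fract]; push_cast; ring⟩⟩

theorem eq_of_mem_Ico (hci : ∀ s t, c s = c t ↔ ∃ n : ℤ, s - t = n) {s t : ℝ}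
    (hs : s ∈ Ico (0 : ℝ) 1) (ht : t ∈ Ico (0 : ℝ) 1) (h : c s = c t) : s = t := by
  obtain ⟨n, hn⟩ := (hci s t).1 h
  have h1 : (n : ℝ) < 1 := by linarith [hs.2, ht.1]
  have h2 : (-1 : ℝ) < n := by linarith [hs.1, ht.2]
  have h1 : n < 1 := by exact_mod_cast h1
  have h2 : -1 < n := by exact_mod_cast h2
  obtain rfl : n = 0 := by omega
  rw [Int.cast_zero] at hn
  linarith

theorem IsGap.mem_Ioo {u v t : ℝ} (h : IsGap Q c u v) (ht : t ∈ Icc u v) (htQ : c t ∈ Q) :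
    t ∈ Ioo u v :=
  ⟨lt_of_le_of_ne ht.1 fun e => h.left (e ▸ htQ), lt_of_le_of_ne ht.2 fun e => h.right (e ▸ htQ)⟩

theorem IsGap.Ioo_subset {u v : ℝ} (h : IsGap Q c u v) : Ioo u v ⊆ Ico 0 1 := fun _ ht =>
  ⟨h.nonneg.trans ht.1.le, ht.2.trans_le h.le_one⟩

theorem mem_iff_of_gaps (hQ : MCell Q J) (hc : Continuous c)
    (hci : ∀ s t, c s = c t ↔ ∃ n : ℤ, s - t = n) (hfl : ∀ t, Flat (range c) (c t))
    (hB : MCell B (range c)) (h0 : c 0 ∉ Q) {x y : X} (hx : x ∈ Q) (hy : y ∈ Q)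
    (hxc : x ∉ range c) (hyc : y ∉ range c)
    (H : ∀ u v, IsGap Q c u v → ∃ S K, K ⊆ J ∧ MCell S (K ∪ c '' Icc u v) ∧ (x ∈ S ↔ y ∈ S)) :
    x ∈ B ↔ y ∈ B := by
  by_cases hxy : x = y
  · rw [hxy]
  have h1 : c 1 ∉ Q := by rwa [(hci 1 0).2 ⟨1, by simp⟩]
  have H' : ∀ i : {g : ℝ × ℝ // IsGap Q c g.1 g.2}, ∃ S K, K ⊆ J ∧
      MCell S (K ∪ c '' Icc i.1.1 i.1.2) ∧ (x ∈ S ↔ y ∈ S) := fun i => H _ _ i.2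
  choose S K hK hS hSxy using H'
  obtain ⟨Γ, hΓQ, hΓ⟩ := exists_narc_subset hQ.isOpen hQ.isConnected.isPreconnected hx hy hxy
  obtain ⟨s, hs⟩ := (isCompact_Icc.inter_right (hΓ.1.1.preimage hc)).elim_finite_subcover
    (s := Icc (0 : ℝ) 1 ∩ c ⁻¹' Γ)
    (fun i : {g : ℝ × ℝ // IsGap Q c g.1 g.2} => Ioo i.1.1 i.1.2) (fun i => isOpen_Ioo)
    (fun t ht => by
      obtain ⟨u, v, hg, ht'⟩ := exists_isGap hc hQ.isOpen h0 h1 ht.1 (hΓQ ht.2)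
      exact mem_iUnion.2 ⟨⟨(u, v), hg⟩, ht'⟩)
  have hJQ : ∀ q ∈ Q, q ∉ J := fun q hq => disjoint_left.1 hQ.disjoint hq
  have hJcl : IsClosed J := hQ.curve.1.1
  have hdense : Dense (range c ∪ J)ᶜ := by
    rw [compl_union]
    exact hB.curve.dense.inter_of_isOpen_left hQ.curve.dense hB.curve.1.1.isOpen_compl
  have hBgc : ∀ q, q ∉ range c → GC (sgn B) (range c ∪ J) q := fun q hq =>
    (hB.gc_sgn.2 hq).mono subset_union_left
  have hSgc : ∀ i q, q ∉ J → q ∉ c '' Icc i.1.1 i.1.2 → GC (sgn (S i)) (range c ∪ J) q :=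
    fun i q hq hq' => ((hS i).gc_sgn.2 fun h => h.elim (fun h => hq (hK i h)) hq').mono
      (union_subset ((hK i).trans subset_union_right)
        ((image_subset_range _ _).trans subset_union_left))
  have key : ∀ q ∈ Γ, GC (fun z => sgn B z * ∏ i ∈ s, sgn (S i) z) (range c ∪ J) q := by
    intro q hq
    have hqJ := hJQ q (hΓQ hq)
    by_cases hqc : q ∈ range c
    · obtain ⟨t, ht, rfl⟩ := exists_mem_Ico_of_mem_range hci hqc
      obtain ⟨i, hi, hti⟩ := mem_iUnion₂.1 (hs ⟨Ico_subset_Icc_self ht, hq⟩)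
      classical
      have e : (fun z => sgn B z * ∏ i ∈ s, sgn (S i) z) =
          fun z => (sgn B z * sgn (S i) z) * ∏ i ∈ s.erase i, sgn (S i) z := by
        ext1 z
        rw [mul_assoc, Finset.mul_prod_erase s (fun i => sgn (S i) z) hi]
      rw [e]
      refine GC.mul ?_ (GC.prod _ fun j hj => hSgc j _ hqJ ?_)
      · have hflat : Flat (range c ∪ J) (c t) := (hfl t).union hJcl hqJ
        refine hflat.gc_mul (Eventually.of_forall fun z hz => hBgc z fun h => hz (Or.inl h))
          (Eventually.of_forall fun z hz => hSgc i z (fun h => hz (Or.inr h))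
            fun h => hz (Or.inl (image_subset_range _ _ h))) (fun h => ?_) (fun h => ?_)
        · rw [gc_congr_set (eventually_mem_union_iff hJcl hqJ), hB.gc_sgn] at h
          exact h hqc
        · have hcl : ∀ a b : ℝ, IsClosed (c '' Icc a b) := fun a b =>
            (isCompact_Icc.image hc).isClosed
          have hn1 : c t ∉ c '' Icc 0 i.1.1 := by
            rintro ⟨r, hr, hr'⟩
            have := eq_of_mem_Ico hci ⟨hr.1, hr.2.trans_lt (hti.1.trans ht.2)⟩ ht hr'
            linarith [hr.2, hti.1]
          have hn2 : c t ∉ c '' Icc i.1.2 1 := by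
            rintro ⟨r, hr, hr'⟩
            rcases hr.2.eq_or_lt with rfl | h1'
            · exact h1 (hr' ▸ hΓQ hq)
            have := eq_of_mem_Ico hci ⟨by linarith [hr.1, hti.2, ht.1], h1'⟩ ht hr'
            linarith [hr.1, hti.2]
          have hev : ∀ᶠ z in 𝓝 (c t), z ∈ range c ∪ J ↔ z ∈ K i ∪ c '' Icc i.1.1 i.1.2 := by
            filter_upwards [hJcl.isOpen_compl.mem_nhds hqJ,
              (hcl 0 i.1.1).isOpen_compl.mem_nhds hn1, (hcl i.1.2 1).isOpen_compl.mem_nhds hn2]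
              with z hz1 hz2 hz3
            refine ⟨fun h => Or.inr ?_, fun h => h.elim (fun h => Or.inr (hK i h))
              fun h => Or.inl (image_subset_range _ _ h)⟩
            obtain ⟨r, hr, rfl⟩ := exists_mem_Ico_of_mem_range hci (h.resolve_right hz1)
            refine ⟨r, ⟨?_, ?_⟩, rfl⟩
            · by_contra! hlt
              exact hz2 ⟨r, ⟨hr.1, hlt.le⟩, rfl⟩
            · by_contra! hlt
              exact hz3 ⟨r, ⟨hlt.le, hr.2.le⟩, rfl⟩
          rw [gc_congr_set hev, (hS i).gc_sgn] at h
          exact h (Or.inr ⟨t, Ioo_subset_Icc_self hti, rfl⟩)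
      · rintro ⟨r, hr, hr'⟩
        have hrQ : c r ∈ Q := hr' ▸ hΓQ hq
        have hrj := j.2.mem_Ioo hr hrQ
        obtain rfl := eq_of_mem_Ico hci (j.2.Ioo_subset hrj) ht hr'
        obtain ⟨e1, e2⟩ := j.2.eq i.2 hrj hti
        exact (Finset.mem_erase.1 hj).1 (Subtype.ext (Prod.ext e1 e2))
    · exact (hBgc q hqc).mul (GC.prod _ fun i _ => hSgc i q hqJ
        fun h => hqc (image_subset_range _ _ h))
  have := eq_of_isPreconnected hΓ.isConnected.isPreconnected hdense key
    (x := x) (y := y) ⟨hΓ.left_mem, fun h => h.elim hxc (hJQ x hx)⟩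
    ⟨hΓ.right_mem, fun h => h.elim hyc (hJQ y hy)⟩
  rw [Finset.prod_congr rfl fun i _ => sgn_eq_sgn.2 (hSxy i)] at this
  exact sgn_eq_sgn.1 (mul_right_cancel this)

end

section
variable {X : Type*} [TopologicalSpace X] [Planar X] {ψ : ℂ → X}

theorem isPreconnected_compl_image_closedBall' (hψ : IsOpenEmbedding ψ) (w : ℂ) {r : ℝ}
    (hr : 0 < r) : IsPreconnected (ψ '' closedBall w r)ᶜ := by
  let e : ℂ ≃ₜ ℂ := (Homeomorph.mulLeft₀ (r : ℂ) (by exact_mod_cast hr.ne')).trans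
    (Homeomorph.addLeft w)
  have he : e '' closedBall 0 1 = closedBall w r := by
    have h : ∀ z, e z = w + r * z := fun _ => rfl
    ext z
    constructor
    · rintro ⟨z, hz, rfl⟩
      rw [mem_closedBall_zero_iff] at hz
      rw [h, mem_closedBall, dist_eq_norm, add_sub_cancel_left, norm_mul, Complex.norm_real,
        Real.norm_of_nonneg hr.le]
      exact mul_le_of_le_one_right hr.le hz
    · intro hz
      refine ⟨(z - w) / r, ?_, ?_⟩
      · rw [mem_closedBall, dist_eq_norm] at hz
        rw [mem_closedBall_zero_iff, norm_div, Complex.norm_real, Real.norm_of_nonneg hr.le]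
        exact div_le_one_of_le₀ hz hr.le
      · have : (r : ℂ) ≠ 0 := by exact_mod_cast hr.ne'
        rw [h]
        field_simp
        ring
  rw [← he, ← image_comp]
  exact isPreconnected_compl_image_closedBall (hψ.comp e.isOpenEmbedding)

theorem MCell.iff_of_isPreconnected {Q J Y : Set X} (h : MCell Q J) (hY : IsPreconnected Y)
    (hd : Disjoint Y J) {x y : X} (hx : x ∈ Y) (hy : y ∈ Y) : x ∈ Q ↔ y ∈ Q :=
  ⟨fun h' => h.subset_of hY hd ⟨x, hx, h'⟩ hy, fun h' => h.subset_of hY hd ⟨y, hy, h'⟩ hx⟩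

end

section
variable {X : Type*} [MetricSpace X] [Planar X] {ψ : ℂ → X} {Q J : Set X}

theorem exists_finite_crosscuts (hψ : IsOpenEmbedding ψ) (hQ : MCell Q J) (h1 : ψ 1 ∉ Q)
    (h2 : ψ (-1) ∉ Q) : ∃ 𝒢 : Set (Set X), 𝒢.Finite ∧
      (∀ g ∈ 𝒢, ∃ a b, NArc g a b ∧ a ∉ Q ∧ b ∉ Q ∧ g \ {a, b} ⊆ Q) ∧
      (∀ g ∈ 𝒢, ∀ g' ∈ 𝒢, g ≠ g' → Disjoint (g ∩ Q) (g' ∩ Q)) ∧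
      ∀ Q' ⊆ Q, IsPreconnected Q' → (∀ g ∈ 𝒢, Disjoint Q' g) →
        ∀ x ∈ Q', x ∈ ψ '' closedBall 0 (1 / 2) → Q' ⊆ ψ '' ball 0 2 := by
  set c : ℝ → X := fun t => ψ (Complex.exp ((2 * Real.pi * t : ℝ) * Complex.I)) with hcdef
  have hc : Continuous c := hψ.continuous.comp (by fun_prop)
  have hci : ∀ s t, c s = c t ↔ ∃ n : ℤ, s - t = n := fun s t => by
    rw [← exp_mul_I_eq_iff]
    exact hψ.injective.eq_iff
  have hr : range c = ψ '' sphere 0 1 := by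
    ext q
    constructor
    · rintro ⟨t, rfl⟩
      refine ⟨_, ?_, rfl⟩
      rw [mem_sphere_zero_iff_norm, Complex.norm_exp_ofReal_mul_I]
    · rintro ⟨z, hz, rfl⟩
      refine ⟨Complex.arg z / (2 * Real.pi), ?_⟩
      simp only [hcdef]
      rw [mul_div_cancel₀ _ Real.two_pi_pos.ne', exists_arg hz]
  have hB : MCell (ψ '' ball 0 1) (range c) := hr ▸ mcell_ball hψ
  have hfl : ∀ t, Flat (range c) (c t) := fun t => by
    rw [hr]
    exact (flat_circle _).image_embedding hψ
  have h0 : c 0 ∉ Q := by simpa [hcdef] using h1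
  have h1' : c 1 ∉ Q := by rwa [(hci 1 0).2 ⟨1, by simp⟩]
  have h2' : c (1 / 2) ∉ Q := by
    have : (((2 * Real.pi * (1 / 2) : ℝ) : ℂ) * Complex.I) = Real.pi * Complex.I := by
      push_cast; ring
    simp only [hcdef]
    rwa [this, Complex.exp_pi_mul_I]
  obtain ⟨ε, hε, hεw⟩ : ∃ ε > 0, ∀ x ∈ range c, ∃ w ∈ sphere (0 : ℂ) 1,
      ball x ε ⊆ ψ '' closedBall w (1 / 4) := by
    obtain ⟨ε, hε, h⟩ := lebesgue_number_lemma_of_metric (s := range c)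
      (c := fun w : sphere (0 : ℂ) 1 => ψ '' ball (w : ℂ) (1 / 4)) hB.curve.isCompact
      (fun w => hψ.isOpenMap _ isOpen_ball) (fun q hq => by
        rw [hr] at hq
        obtain ⟨z, hz, rfl⟩ := hq
        exact mem_iUnion.2 ⟨⟨z, hz⟩, z, mem_ball_self (by norm_num), rfl⟩)
    refine ⟨ε, hε, fun x hx => ?_⟩
    obtain ⟨w, hw⟩ := h x hx
    exact ⟨w, w.2, hw.trans (image_mono ball_subset_closedBall)⟩
  obtain ⟨δ, hδ, hsplit⟩ := hQ.curve.exists_small_split hε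
  obtain ⟨ρ, hρ, hcρ⟩ := Metric.uniformContinuousOn_iff.1
    ((isCompact_Icc (a := (0 : ℝ)) (b := 1)).uniformContinuousOn_of_continuous hc.continuousOn)
    (min δ ε) (lt_min hδ hε)
  have hgap : ∀ u v, IsGap Q c u v → NArc (c '' Icc u v) (c u) (c v) ∧ c u ∈ J ∧ c v ∈ J ∧
      c '' Icc u v \ {c u, c v} ⊆ Q := by
    intro u v h
    have hlt := h.sub_le h2'
    have hcl : ∀ t ∈ Icc u v, c t ∈ Q ∪ J := fun t ht => by
      rw [← hQ.closure_eq]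
      rw [← closure_Ioo h.lt.ne] at ht
      exact map_mem_closure hc ht h.mem
    refine ⟨(split_param hB.curve.1 hc hci h.lt (by linarith)).1,
      (hcl u (left_mem_Icc.2 h.lt.le)).resolve_left h.left,
      (hcl v (right_mem_Icc.2 h.lt.le)).resolve_left h.right, ?_⟩
    rintro _ ⟨⟨t, ht, rfl⟩, hne⟩
    refine h.mem t ⟨lt_of_le_of_ne ht.1 ?_, lt_of_le_of_ne ht.2 ?_⟩
    · rintro rfl
      exact hne (Or.inl rfl)
    · rintro rfl
      exact hne (Or.inr rfl)
  refine ⟨(fun g : ℝ × ℝ => c '' Icc g.1 g.2) '' {g | IsGap Q c g.1 g.2 ∧ ρ ≤ g.2 - g.1},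
    (finite_isGap hρ).image _, ?_, ?_, ?_⟩
  · rintro _ ⟨g, ⟨hg, -⟩, rfl⟩
    exact ⟨_, _, (hgap _ _ hg).1, hg.left, hg.right, (hgap _ _ hg).2.2.2⟩
  · rintro _ ⟨g, ⟨hg, -⟩, rfl⟩ _ ⟨g', ⟨hg', -⟩, rfl⟩ hne
    rw [disjoint_left]
    rintro _ ⟨⟨t, ht, rfl⟩, htQ⟩ ⟨⟨t', ht', e⟩, -⟩
    have htt := hg.mem_Ioo ht htQ
    have htt' := hg'.mem_Ioo ht' (e ▸ htQ)
    obtain rfl := eq_of_mem_Ico hci (hg'.Ioo_subset htt') (hg.Ioo_subset htt) e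
    obtain ⟨e1, e2⟩ := hg.eq hg' htt htt'
    exact hne (by simp only [e1, e2])
  · intro Q' hQ' hQ'c hQ'd x hx hxB y hy
    by_contra hyB
    have hxr : x ∈ ψ '' ball 0 1 := image_mono (closedBall_subset_ball (by norm_num)) hxB
    have hyr : y ∉ ψ '' closedBall 0 1 := fun h =>
      hyB (image_mono (closedBall_subset_ball (by norm_num)) h)
    have := mem_iff_of_gaps hQ hc hci hfl hB h0 (hQ' hx) (hQ' hy)
      (disjoint_left.1 hB.disjoint hxr) (fun h => hyr (by
        rw [hr] at h
        exact image_mono sphere_subset_closedBall h)) ?_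
    · exact hyr (image_mono ball_subset_closedBall (this.1 hxr))
    intro u v hg
    obtain ⟨hn, huJ, hvJ, hgQ⟩ := hgap u v hg
    by_cases hl : ρ ≤ v - u
    · obtain ⟨A, B, hA, hB', hAB, hABu⟩ := hQ.curve.split huJ hvJ hn.ne
      obtain ⟨Q₁, Q₂, hQ₁, -⟩ := (show MCell Q (A ∪ B) from hABu ▸ hQ).theta hA hB' hAB hn hgQ
      refine ⟨Q₁, A, hABu ▸ subset_union_left, hQ₁, hQ₁.iff_of_isPreconnected hQ'c ?_ hx hy⟩
      refine disjoint_union_right.2 ⟨?_, hQ'd _ ⟨(u, v), ⟨hg, hl⟩, rfl⟩⟩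
      exact hQ.disjoint.mono hQ' (hABu ▸ subset_union_left)
    · have hclose : ∀ s ∈ Icc u v, dist (c s) (c u) < min δ ε := fun s hs => by
        refine hcρ s ⟨hg.nonneg.trans hs.1, hs.2.trans hg.le_one⟩ u
          ⟨hg.nonneg, hg.lt.le.trans hg.le_one⟩ ?_
        rw [Real.dist_eq, abs_of_nonneg (by linarith [hs.1])]
        linarith [hs.2]
      obtain ⟨A, B, hA, hB', hAB, hABu, hAε⟩ := hsplit _ huJ _ hvJ hn.ne (by
        rw [dist_comm]
        exact (hclose v (right_mem_Icc.2 hg.lt.le)).trans_le (min_le_left _ _))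
      obtain ⟨Q₁, Q₂, hQ₁, -⟩ := (show MCell Q (A ∪ B) from hABu ▸ hQ).theta hA hB' hAB hn hgQ
      obtain ⟨w, hw, hwD⟩ := hεw (c u) ⟨u, rfl⟩
      rw [mem_sphere_zero_iff_norm] at hw
      have hsub : A ∪ c '' Icc u v ⊆ ψ '' closedBall w (1 / 4) := by
        refine Subset.trans ?_ hwD
        rintro z (hz | ⟨s, hs, rfl⟩)
        · exact hAε z hz _ hA.left_mem
        · exact (hclose s hs).trans_le (min_le_right _ _)
      refine ⟨Q₁, A, hABu ▸ subset_union_left, hQ₁, hQ₁.iff_of_isPreconnected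
        (isPreconnected_compl_image_closedBall' hψ w (r := 1 / 4) (by norm_num))
        (disjoint_compl_left_iff_subset.2 hsub) ?_ ?_⟩
      · obtain ⟨z, hz, rfl⟩ := hxB
        rintro ⟨z', hz', e⟩
        obtain rfl := hψ.injective e
        rw [mem_closedBall_zero_iff] at hz
        rw [mem_closedBall, dist_comm, dist_eq_norm] at hz'
        linarith [norm_sub_norm_le w z']
      · rintro ⟨z, hz, rfl⟩
        refine hyB ⟨z, ?_, rfl⟩
        rw [mem_closedBall, dist_eq_norm] at hz
        rw [mem_ball_zero_iff]
        linarith [norm_sub_norm_le z w]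

end

/-! ### Cutting planar convex bodies along a line -/

section
variable {K : Set ℂ} {L : ℂ →L[ℝ] ℝ} {r : ℝ} {p q z : ℂ}

theorem apply_eq_re_add_im (L : ℂ →L[ℝ] ℝ) (w : ℂ) : L w = w.re * L 1 + w.im * L Complex.I := by
  conv_lhs => rw [← Complex.re_add_im w]
  rw [map_add, ← mul_one (w.re : ℂ), ← Complex.real_smul, ← Complex.real_smul, map_smul, map_smul]
  simp

theorem exists_ne_zero_apply_eq_zero (hL : L ≠ 0) : ∃ u, u ≠ 0 ∧ L u = 0 := by
  refine ⟨⟨L Complex.I, -L 1⟩, fun h => hL (ContinuousLinearMap.ext fun w => ?_), ?_⟩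
  · have h1 := congrArg Complex.re h
    have h2 := congrArg Complex.im h
    simp at h1 h2
    rw [apply_eq_re_add_im, h1, h2]
    simp
  · rw [apply_eq_re_add_im]
    simp [mul_comm]

theorem eq_smul_of_apply_eq_zero (hL : L ≠ 0) {u v : ℂ} (hu : u ≠ 0) (hLu : L u = 0) (hLv : L v = 0) :
    ∃ t : ℝ, v = t • u := by
  have hf := apply_eq_re_add_im L
  rw [hf] at hLu hLv
  have hab : L 1 ≠ 0 ∨ L Complex.I ≠ 0 := by
    by_contra! h
    exact hL (ContinuousLinearMap.ext fun w => by rw [hf, h.1, h.2]; simp)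
  have hcr : u.re * v.im = u.im * v.re := by
    rcases hab with h | h
    · apply mul_left_cancel₀ h
      linear_combination v.im * hLu - u.im * hLv
    · apply mul_left_cancel₀ h
      linear_combination u.re * hLv - v.re * hLu
  by_cases h : u.re = 0
  · have hi : u.im ≠ 0 := fun h' => hu (Complex.ext h h')
    refine ⟨v.im / u.im, Complex.ext ?_ ?_⟩
    · rw [h, zero_mul] at hcr
      rcases mul_eq_zero.1 hcr.symm with h' | h'
      · exact absurd h' hi
      · simp [h, h']
    · simp [hi]
  · refine ⟨v.re / u.re, Complex.ext ?_ ?_⟩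
    · simp [h]
    · simp
      field_simp
      linarith

theorem isOpenMap_of_ne_zero (hL : L ≠ 0) : IsOpenMap L :=
  L.isOpenMap (L.toLinearMap.surjective fun h => hL (ContinuousLinearMap.coe_injective h))

theorem interior_setOf_le (hL : L ≠ 0) (r : ℝ) : interior {z | L z ≤ r} = {z | L z < r} := by
  have := (isOpenMap_of_ne_zero hL).preimage_interior_eq_interior_preimage L.continuous (Iic r)
  rw [interior_Iic] at this
  exact this.symm

theorem interior_setOf_ge (hL : L ≠ 0) (r : ℝ) : interior {z | r ≤ L z} = {z | r < L z} := by
  have := (isOpenMap_of_ne_zero hL).preimage_interior_eq_interior_preimage L.continuous (Ici r)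
  rw [interior_Ici] at this
  exact this.symm

theorem smul_add_smul_eq_of_add_eq_one {a b s t c : ℝ} {p v : ℂ} (h : a + b = 1)
    (h' : a * s + b * t = c) : a • (p + s • v) + b • (p + t • v) = p + c • v := by
  calc a • (p + s • v) + b • (p + t • v) = (a + b) • p + (a * s + b * t) • v := by module
    _ = p + c • v := by rw [h, h', one_smul]

theorem mem_segment_of_apply_eq (hK : Convex ℝ K) (hL : L ≠ 0) (hp : p ∉ interior K)
    (hq : q ∉ interior K) (hpq : p ≠ q) (hLp : L p = r) (hLq : L q = r)
    (hseg : openSegment ℝ p q ⊆ interior K) (hz : z ∈ K) (hLz : L z = r) : z ∈ segment ℝ p q := by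
  obtain ⟨t, ht⟩ := eq_smul_of_apply_eq_zero hL (u := q - p) (v := z - p) (sub_ne_zero.2 hpq.symm)
    (by rw [map_sub, hLp, hLq, sub_self]) (by rw [map_sub, hLp, hLz, sub_self])
  have hzt : z = p + t • (q - p) := by rw [← ht]; ring
  rw [segment_eq_image']
  have hm : ∀ s ∈ Ioo (0 : ℝ) 1, p + s • (q - p) ∈ interior K := fun s hs =>
    hseg (by rw [openSegment_eq_image']; exact ⟨s, hs, rfl⟩)
  refine ⟨t, ⟨?_, ?_⟩, hzt.symm⟩
  · by_contra! hlt
    refine hp ?_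
    have := hK.combo_interior_self_mem_interior (hm (1 / 2) (by norm_num)) hz
      (a := -t / (1 / 2 - t)) (b := (1 / 2) / (1 / 2 - t))
      (div_pos (by linarith) (by linarith)) (div_nonneg (by norm_num) (by linarith))
      (by rw [← add_div, div_eq_one_iff_eq (by linarith)]; ring)
    have h2 : 1 / 2 - t ≠ 0 := by linarith
    have h3 := smul_add_smul_eq_of_add_eq_one (a := -t / (1 / 2 - t))
      (b := (1 / 2) / (1 / 2 - t)) (s := 1 / 2) (t := t) (c := 0) (p := p) (v := q - p)
      (by rw [← add_div, div_eq_one_iff_eq (by linarith)]; ring) (by field_simp; ring)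
    rw [← hzt] at h3
    rwa [h3, zero_smul, add_zero] at this
  · by_contra! hlt
    refine hq ?_
    have := hK.combo_interior_self_mem_interior (hm (1 / 2) (by norm_num)) hz
      (a := (t - 1) / (t - 1 / 2)) (b := (1 / 2) / (t - 1 / 2))
      (div_pos (by linarith) (by linarith)) (div_nonneg (by norm_num) (by linarith))
      (by rw [← add_div, div_eq_one_iff_eq (by linarith)]; ring)
    have h2 : t - 1 / 2 ≠ 0 := by linarith
    have h3 := smul_add_smul_eq_of_add_eq_one (a := (t - 1) / (t - 1 / 2))
      (b := (1 / 2) / (t - 1 / 2)) (s := 1 / 2) (t := t) (c := 1) (p := p) (v := q - p)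
      (by rw [← add_div, div_eq_one_iff_eq (by linarith)]; ring)
      (by rw [div_mul_eq_mul_div, div_mul_eq_mul_div, ← add_div, div_eq_one_iff_eq h2]; ring)
    rw [← hzt] at h3
    rwa [h3, one_smul, add_sub_cancel] at this

theorem exists_mem_frontier_lt (hK : IsCompact K) (hL : L ≠ 0) (hz : z ∈ K) (hr : r < L z) :
    ∃ w ∈ K, w ∉ interior K ∧ r < L w := by
  obtain ⟨w, hw, hmax⟩ := hK.exists_isMaxOn ⟨z, hz⟩ L.continuous.continuousOn
  refine ⟨w, hw, fun hwi => ?_, hr.trans_le (hmax hz)⟩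
  have h1 : L '' interior K ∈ 𝓝 (L w) :=
    ((isOpenMap_of_ne_zero hL) _ isOpen_interior).mem_nhds ⟨w, hwi, rfl⟩
  have h2 : ∀ᶠ t in 𝓝 (L w), t ≤ L w := by
    filter_upwards [h1]
    rintro _ ⟨v, hv, rfl⟩
    exact hmax (interior_subset hv)
  obtain ⟨t, ht, ht'⟩ := (h2.filter_mono nhdsWithin_le_nhds |>.and
    (self_mem_nhdsWithin : Ioi (L w) ∈ 𝓝[>] (L w))).exists
  exact not_lt.2 ht ht'

theorem exists_interior_lt (hL : L ≠ 0) (hz : z ∈ interior K) (hLz : L z = r) :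
    (∃ w ∈ interior K, L w < r) ∧ ∃ w ∈ interior K, r < L w := by
  have h1 : L '' interior K ∈ 𝓝 r :=
    ((isOpenMap_of_ne_zero hL) _ isOpen_interior).mem_nhds ⟨z, hz, hLz⟩
  constructor
  · obtain ⟨_, ⟨w, hw, rfl⟩, ht'⟩ := ((show ∀ᶠ t in 𝓝 r, t ∈ L '' interior K from h1).filter_mono
      nhdsWithin_le_nhds |>.and (self_mem_nhdsWithin : Iio r ∈ 𝓝[<] r)).exists
    exact ⟨w, hw, ht'⟩
  · obtain ⟨_, ⟨w, hw, rfl⟩, ht'⟩ := ((show ∀ᶠ t in 𝓝 r, t ∈ L '' interior K from h1).filter_mono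
      nhdsWithin_le_nhds |>.and (self_mem_nhdsWithin : Ioi r ∈ 𝓝[>] r)).exists
    exact ⟨w, hw, ht'⟩

theorem exists_chord_end (hKc : IsCompact K) (hz : z ∈ interior K) {u : ℂ} (hu : u ≠ 0)
    (hLu : L u = 0) :
    ∃ t > 0, z + (t : ℝ) • u ∈ K ∧ z + t • u ∉ interior K := by
  have hcl : IsClosedEmbedding fun t : ℝ => z + t • u :=
    (Homeomorph.addLeft z).isClosedEmbedding.comp (isClosedEmbedding_smul_left hu)
  have hT : IsCompact ((fun t : ℝ => z + t • u) ⁻¹' K) := hcl.isCompact_preimage hKc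
  have hin_K : ∀ t : ℝ, z + t • u ∈ interior K → ∃ s > t, z + s • u ∈ K := fun t ht => by
    have : ∀ᶠ s in 𝓝 t, z + s • u ∈ K :=
      hcl.continuous.continuousAt.eventually (mem_interior_iff_mem_nhds.1 ht)
    obtain ⟨s, hs, hs'⟩ := ((this.filter_mono nhdsWithin_le_nhds).and
      (self_mem_nhdsWithin : Ioi t ∈ 𝓝[>] t)).exists
    exact ⟨s, hs', hs⟩
  have h0 : z + (0 : ℝ) • u ∈ interior K := by simpa using hz
  obtain ⟨t, ht, hmax⟩ := hT.exists_isMaxOn ⟨0, show z + (0 : ℝ) • u ∈ K from interior_subset h0⟩ continuousOn_id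
  obtain ⟨s, hs, hsK⟩ := hin_K 0 h0
  refine ⟨t, lt_of_lt_of_le hs (hmax hsK), ht, fun h => ?_⟩
  obtain ⟨s', hs', hsK'⟩ := hin_K t h
  exact absurd (hmax hsK') (not_le.2 hs')

/-- The points where a line through the interior of a convex body meets its frontier. -/
theorem exists_chord (hK : Convex ℝ K) (hKc : IsCompact K) (hL : L ≠ 0) (hz : z ∈ interior K)
    (hLz : L z = r) : ∃ p ∈ K, ∃ q ∈ K, p ∉ interior K ∧ q ∉ interior K ∧ p ≠ q ∧ L p = r ∧
      L q = r ∧ openSegment ℝ p q ⊆ interior K := by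
  obtain ⟨u, hu, hLu⟩ := exists_ne_zero_apply_eq_zero hL
  obtain ⟨t, ht, htK, htI⟩ := exists_chord_end hKc hz hu hLu
  obtain ⟨s, hs, hsK, hsI⟩ := exists_chord_end hKc hz (neg_ne_zero.2 hu) (by rw [map_neg, hLu, neg_zero])
  refine ⟨_, hsK, _, htK, hsI, htI, fun h => ?_, ?_, ?_, ?_⟩
  · have h' : (s + t) • u = 0 := by
      have : (s + t) • u = (z + t • u) - (z + s • -u) := by module
      rw [this, h, sub_self]
    exact (smul_ne_zero (by linarith) hu) h'
  · rw [map_add, map_smul, map_neg, hLu, hLz]; simp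
  · rw [map_add, map_smul, hLu, hLz]; simp
  · rintro _ ⟨a, b, ha, hb, hab, rfl⟩
    have e : a • (z + s • -u) + b • (z + t • u) = z + (b * t - a * s) • u := by
      rw [← smul_add_smul_eq_of_add_eq_one (a := a) (b := b) (s := -s) (t := t) (c := b * t - a * s) hab
        (by ring)]
      module
    rw [e]
    rcases le_total 0 (b * t - a * s) with h | h
    · have := hK.combo_interior_self_mem_interior hz htK (a := 1 - (b * t - a * s) / t)
        (b := (b * t - a * s) / t) (by rw [sub_pos, div_lt_one ht]; nlinarith)
        (div_nonneg h ht.le) (by ring)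
      convert this using 1
      have : b * t - a * s = ((b * t - a * s) / t) * t := by field_simp
      generalize (b * t - a * s) / t = c at *
      rw [this]
      module
    · have := hK.combo_interior_self_mem_interior hz hsK (a := 1 - (a * s - b * t) / s)
        (b := (a * s - b * t) / s) (by rw [sub_pos, div_lt_one hs]; nlinarith)
        (div_nonneg (by linarith) hs.le) (by ring)
      convert this using 1
      have : b * t - a * s = -((a * s - b * t) / s) * s := by field_simp; ring
      generalize (a * s - b * t) / s = c at *
      rw [this]
      module

end

/-- A chord of a planar convex body, cut out by the line `L = r`. -/
structure Chord (K : Set ℂ) (L : ℂ →L[ℝ] ℝ) (r : ℝ) (p q : ℂ) : Prop where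
  convex : Convex ℝ K
  isCompact : IsCompact K
  ne_zero : L ≠ 0
  left_mem : p ∈ frontier K
  right_mem : q ∈ frontier K
  ne : p ≠ q
  apply_left : L p = r
  apply_right : L q = r
  openSegment_subset : openSegment ℝ p q ⊆ interior K

namespace Chord
variable {K : Set ℂ} {L : ℂ →L[ℝ] ℝ} {r : ℝ} {p q z : ℂ}

theorem of_interior (hK : Convex ℝ K) (hKc : IsCompact K) (hL : L ≠ 0) (hz : z ∈ interior K) :
    ∃ p q, Chord K L (L z) p q := by
  obtain ⟨p, hp, q, hq, hp', hq', hpq, h1, h2, h3⟩ := exists_chord hK hKc hL hz rfl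
  exact ⟨p, q, hK, hKc, hL, hKc.isClosed.frontier_eq ▸ ⟨hp, hp'⟩,
    hKc.isClosed.frontier_eq ▸ ⟨hq, hq'⟩, hpq, h1, h2, h3⟩

variable (h : Chord K L r p q)
include h

theorem frontier_eq : frontier K = K \ interior K := h.isCompact.isClosed.frontier_eq

theorem neg : Chord K (-L) (-r) p q where
  convex := h.convex
  isCompact := h.isCompact
  ne_zero := neg_ne_zero.2 h.ne_zero
  left_mem := h.left_mem
  right_mem := h.right_mem
  ne := h.ne
  apply_left := congrArg Neg.neg h.apply_left
  apply_right := congrArg Neg.neg h.apply_right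
  openSegment_subset := h.openSegment_subset

theorem isClosed_half : IsClosed {z | L z ≤ r} := isClosed_le L.continuous continuous_const

theorem segment_eq : segment ℝ p q = K ∩ {z | L z = r} := by
  have hp := h.frontier_eq ▸ h.left_mem
  have hq := h.frontier_eq ▸ h.right_mem
  refine Subset.antisymm (fun z hz => ⟨h.convex.segment_subset hp.1 hq.1 hz, ?_⟩) fun z hz =>
    mem_segment_of_apply_eq h.convex h.ne_zero hp.2 hq.2 h.ne h.apply_left h.apply_right
      h.openSegment_subset hz.1 hz.2
  obtain ⟨a, b, ha, hb, hab, rfl⟩ := hz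
  show L (a • p + b • q) = r
  rw [map_add, map_smul, map_smul, h.apply_left, h.apply_right, ← add_smul, hab, one_smul]

theorem eq_or_eq (hz : z ∈ frontier K) (hLz : L z = r) : z = p ∨ z = q := by
  rw [h.frontier_eq] at hz
  have : z ∈ segment ℝ p q := by rw [h.segment_eq]; exact ⟨hz.1, hLz⟩
  rw [← insert_endpoints_openSegment] at this
  rcases this with h1 | h1 | h1
  · exact .inl h1
  · exact .inr h1
  · exact absurd (h.openSegment_subset h1) hz.2

theorem convex_half : Convex ℝ (K ∩ {z | L z ≤ r}) :=
  h.convex.inter (convex_halfSpace_le L.isLinear r)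

theorem isCompact_half : IsCompact (K ∩ {z | L z ≤ r}) := h.isCompact.inter_right h.isClosed_half

theorem interior_half : interior (K ∩ {z | L z ≤ r}) = interior K ∩ {z | L z < r} := by
  rw [interior_inter, interior_setOf_le h.ne_zero]

theorem frontier_half :
    frontier (K ∩ {z | L z ≤ r}) = (frontier K ∩ {z | L z ≤ r}) ∪ segment ℝ p q := by
  rw [h.isCompact_half.isClosed.frontier_eq, h.interior_half, h.frontier_eq, h.segment_eq]
  ext z
  simp only [Set.mem_sdiff, mem_inter_iff, mem_ofPred_eq, mem_union]
  grind

theorem exists_mem : ∃ z ∈ interior K, L z = r := by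
  obtain ⟨z, hz⟩ : (openSegment ℝ p q).Nonempty := ⟨_, midpoint_mem_openSegment (𝕜 := ℝ) p q⟩
  have : z ∈ segment ℝ p q := openSegment_subset_segment _ _ _ hz
  exact ⟨z, h.openSegment_subset hz, (h.segment_eq ▸ this).2⟩

theorem nonempty_half : (interior (K ∩ {z | L z ≤ r})).Nonempty := by
  obtain ⟨z, hz, hLz⟩ := h.exists_mem
  obtain ⟨w, hw, hw'⟩ := (exists_interior_lt h.ne_zero hz hLz).1
  rw [h.interior_half]
  exact ⟨w, hw, hw'⟩

theorem exists_frontier_gt : ∃ w ∈ frontier K, r < L w := by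
  obtain ⟨z, hz, hLz⟩ := h.exists_mem
  obtain ⟨w, hw, hw'⟩ := (exists_interior_lt h.ne_zero hz hLz).2
  obtain ⟨v, hv, hv', hv''⟩ := exists_mem_frontier_lt h.isCompact h.ne_zero (interior_subset hw) hw'
  exact ⟨v, h.frontier_eq ▸ ⟨hv, hv'⟩, hv''⟩

end Chord

/-! ### Cells and their images -/

/-- A cell `Q` with boundary `J` in `X`, together with a parametrised convex cell in `S`. -/
structure Cell (X S : Type*) where
  Q : Set X
  J : Set X
  K : Set ℂ
  φ : ℂ → S

/-- The closed cell in the target. -/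
def Cell.target {X S : Type*} (C : Cell X S) : Set S := C.φ '' C.K

/-- The interior of the cell in the target. -/
def Cell.inner {X S : Type*} (C : Cell X S) : Set S := C.φ '' interior C.K

section
variable {X S : Type*} [TopologicalSpace X] [Planar X] [TopologicalSpace S] [T2Space S]
  {C C' : Cell X S} {h : X → S} {G c : Set X} {a b : X} {L : ℂ →L[ℝ] ℝ} {r : ℝ} {p q : ℂ}

/-- Compatibility of a cell with an embedding `h` of the graph `G`. -/
structure Cell.Good (C : Cell X S) (h : X → S) (G : Set X) : Prop where
  mcell : MCell C.Q C.J
  convex : Convex ℝ C.K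
  isCompact : IsCompact C.K
  nonempty : (interior C.K).Nonempty
  continuousOn : ContinuousOn C.φ C.K
  injOn : InjOn C.φ C.K
  image_eq : h '' C.J = C.φ '' frontier C.K
  subset : C.J ⊆ G
  disjoint : Disjoint C.Q G
  disjoint_image : Disjoint C.inner (h '' G)

theorem exists_continuousOn_factor {Y Z T : Type*} [TopologicalSpace Y] [TopologicalSpace Z]
    [T2Space Z] [TopologicalSpace T] {K : Set Y} {γ : Y → Z} {σ : Y → T} [Nonempty Y]
    (hK : IsCompact K) (hγ : ContinuousOn γ K) (hi : InjOn γ K) (hσ : ContinuousOn σ K) :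
    ∃ e : Z → T, ContinuousOn e (γ '' K) ∧ ∀ t ∈ K, e (γ t) = σ t := by
  have hinv : ∀ t ∈ K, Function.invFunOn γ K (γ t) = t := fun t ht => hi.leftInvOn_invFunOn ht
  have he : ∀ t ∈ K, (σ ∘ Function.invFunOn γ K) (γ t) = σ t := fun t ht => by
    rw [Function.comp_apply, hinv t ht]
  refine ⟨σ ∘ Function.invFunOn γ K, continuousOn_iff_isClosed.2 fun F hF => ?_, he⟩
  obtain ⟨u, hu, hu'⟩ := continuousOn_iff_isClosed.1 hσ F hF
  refine ⟨γ '' (K ∩ u), ((hK.inter_right hu).image_of_continuousOn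
    (hγ.mono inter_subset_left)).isClosed, ?_⟩
  ext z
  constructor
  · rintro ⟨hz, t, ht, rfl⟩
    refine ⟨⟨t, ⟨ht, ?_⟩, rfl⟩, t, ht, rfl⟩
    have : t ∈ σ ⁻¹' F ∩ K := ⟨by rwa [mem_preimage, he t ht] at hz, ht⟩
    rw [hu'] at this
    exact this.1
  · rintro ⟨⟨t, ⟨ht, htu⟩, rfl⟩, -⟩
    have : t ∈ u ∩ K := ⟨htu, ht⟩
    rw [← hu'] at this
    exact ⟨by rw [mem_preimage, he t ht]; exact this.1, t, ht, rfl⟩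

theorem NArc.exists_edge {φ : ℂ → S} (hc : NArc c a b) (hpq : p ≠ q)
    (hφ : ContinuousOn φ (segment ℝ p q)) (hi : InjOn φ (segment ℝ p q)) :
    ∃ e : X → S, ContinuousOn e c ∧ InjOn e c ∧ e a = φ p ∧ e b = φ q ∧
      e '' c = φ '' segment ℝ p q ∧ e '' (c \ {a, b}) ⊆ φ '' openSegment ℝ p q := by
  obtain ⟨-, γ, hγ, hγi, h0, h1, rfl⟩ := hc
  have hmaps : ∀ t ∈ Icc (0 : ℝ) 1, AffineMap.lineMap p q t ∈ segment ℝ p q := fun t ht => by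
    rw [segment_eq_image_lineMap]
    exact ⟨t, ht, rfl⟩
  have hσ : ContinuousOn (fun t : ℝ => φ (AffineMap.lineMap p q t)) (Icc 0 1) :=
    hφ.comp AffineMap.lineMap_continuous.continuousOn hmaps
  obtain ⟨e, he, hes⟩ := exists_continuousOn_factor isCompact_Icc hγ hγi hσ
  refine ⟨e, he, ?_, ?_, ?_, ?_, ?_⟩
  · rintro _ ⟨s, hs, rfl⟩ _ ⟨t, ht, rfl⟩ hst
    rw [hes s hs, hes t ht] at hst
    rw [AffineMap.lineMap_injective ℝ hpq (hi (hmaps s hs) (hmaps t ht) hst)]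
  · rw [← h0, hes 0 (by simp)]; simp
  · rw [← h1, hes 1 (by simp)]; simp
  · rw [segment_eq_image_lineMap, image_image, image_image]
    exact image_congr hes
  · rintro _ ⟨_, ⟨⟨t, ht, rfl⟩, hne⟩, rfl⟩
    rw [hes t ht]
    refine ⟨_, ?_, rfl⟩
    rw [openSegment_eq_image_lineMap]
    refine ⟨t, ⟨ht.1.lt_of_ne ?_, ht.2.lt_of_ne ?_⟩, rfl⟩
    · rintro rfl; exact hne (by simp [h0])
    · rintro rfl; exact hne (by simp [h1])

theorem Cell.Good.side {A : Set X} (hC : C.Good h G) (hh : ContinuousOn h G) (hinj : InjOn h G)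
    (hch : Chord C.K L r p q) (ha : a ∈ C.J) (hb : b ∈ C.J) (hap : h a = C.φ p)
    (hbq : h b = C.φ q) (hA : NArc A a b) (hAJ : A ⊆ C.J) :
    h '' (A \ {a, b}) ⊆ C.φ '' (frontier C.K ∩ {z | L z ≤ r}) ∨
      h '' (A \ {a, b}) ⊆ C.φ '' (frontier C.K ∩ {z | r ≤ L z}) := by
  have hfK : frontier C.K ⊆ C.K := hC.isCompact.isClosed.frontier_subset
  have hfc : IsCompact (frontier C.K) := hC.isCompact.of_isClosed_subset isClosed_frontier hfK
  have hcl : ∀ F : Set ℂ, IsClosed F → IsClosed (C.φ '' (frontier C.K ∩ F)) := fun F hF =>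
    ((hfc.inter_right hF).image_of_continuousOn
      (hC.continuousOn.mono (inter_subset_left.trans hfK))).isClosed
  have hconn : IsPreconnected (h '' (A \ {a, b})) :=
    hA.isConnected_sdiff.isPreconnected.image _
      (hh.mono (sdiff_subset.trans (hAJ.trans hC.subset)))
  refine isPreconnected_iff_subset_of_disjoint_closed.1 hconn _ _
    (hcl _ (isClosed_le L.continuous continuous_const))
    (hcl _ (isClosed_le continuous_const L.continuous)) ?_ ?_
  · rw [← image_union, ← inter_union_distrib_left]
    refine (image_mono (sdiff_subset.trans hAJ)).trans (hC.image_eq.le.trans (image_mono ?_))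
    exact fun z hz => ⟨hz, le_total (L z) r⟩
  · rw [eq_empty_iff_forall_notMem]
    rintro _ ⟨⟨x, ⟨hxA, hx⟩, rfl⟩, ⟨z, ⟨hz, hz'⟩, hzx⟩, ⟨w, ⟨hw, hw'⟩, hwx⟩⟩
    obtain rfl := hC.injOn (hfK hz) (hfK hw) (hzx.trans hwx.symm)
    have hxG := hC.subset (hAJ hxA)
    rcases hch.eq_or_eq hz (le_antisymm hz' hw') with rfl | rfl
    · exact hx (.inl (hinj hxG (hC.subset ha) (hzx.symm.trans hap.symm)))
    · exact hx (.inr (hinj hxG (hC.subset hb) (hzx.symm.trans hbq.symm)))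

theorem Cell.Good.image_half {A B : Set X} (hC : C.Good h G)
    (hch : Chord C.K L r p q) (haA : a ∈ A) (hbA : b ∈ A) (hap : h a = C.φ p)
    (hbq : h b = C.φ q) (hAB : A ∪ B = C.J)
    (h1 : h '' (A \ {a, b}) ⊆ C.φ '' (frontier C.K ∩ {z | L z ≤ r}))
    (h2 : h '' (B \ {a, b}) ⊆ C.φ '' (frontier C.K ∩ {z | r ≤ L z})) :
    h '' A = C.φ '' (frontier C.K ∩ {z | L z ≤ r}) := by
  have hfK : frontier C.K ⊆ C.K := hC.isCompact.isClosed.frontier_subset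
  refine Subset.antisymm ?_ ?_
  · rintro _ ⟨x, hx, rfl⟩
    by_cases hxa : x = a
    · exact ⟨p, ⟨hch.left_mem, hch.apply_left.le⟩, by rw [hxa, hap]⟩
    by_cases hxb : x = b
    · exact ⟨q, ⟨hch.right_mem, hch.apply_right.le⟩, by rw [hxb, hbq]⟩
    exact h1 ⟨x, ⟨hx, by simp [hxa, hxb]⟩, rfl⟩
  · rintro _ ⟨z, ⟨hz, hzL⟩, rfl⟩
    obtain ⟨x, hx, hxz⟩ : C.φ z ∈ h '' C.J := hC.image_eq ▸ ⟨z, hz, rfl⟩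
    by_cases hxA : x ∈ A
    · exact ⟨x, hxA, hxz⟩
    have hxB : x ∈ B := by rw [← hAB] at hx; exact hx.resolve_left hxA
    have hxab : x ∉ ({a, b} : Set X) := by
      rintro (rfl | rfl)
      exacts [hxA haA, hxA hbA]
    obtain ⟨w, ⟨hw, hwL⟩, hwx⟩ := h2 ⟨x, ⟨hxB, hxab⟩, rfl⟩
    obtain rfl := hC.injOn (hfK hw) (hfK hz) (hwx.trans hxz)
    rcases hch.eq_or_eq hw (le_antisymm hzL hwL) with rfl | rfl
    · exact ⟨a, haA, hap⟩
    · exact ⟨b, hbA, hbq⟩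

theorem Cell.Good.not_both {A B : Set X} (hC : C.Good h G)
    (hch : Chord C.K L r p q) (hap : h a = C.φ p)
    (hbq : h b = C.φ q) (hAB : A ∪ B = C.J)
    (h1 : h '' (A \ {a, b}) ⊆ C.φ '' (frontier C.K ∩ {z | L z ≤ r}))
    (h2 : h '' (B \ {a, b}) ⊆ C.φ '' (frontier C.K ∩ {z | L z ≤ r})) : False := by
  have hfK : frontier C.K ⊆ C.K := hC.isCompact.isClosed.frontier_subset
  obtain ⟨w, hw, hwr⟩ := hch.exists_frontier_gt
  obtain ⟨x, hx, hxw⟩ : C.φ w ∈ h '' C.J := hC.image_eq ▸ ⟨w, hw, rfl⟩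
  by_cases hxab : x ∈ ({a, b} : Set X)
  · rcases hxab with rfl | rfl
    · rw [← hC.injOn (hfK hch.left_mem) (hfK hw) (hap.symm.trans hxw), hch.apply_left] at hwr
      exact lt_irrefl _ hwr
    · rw [← hC.injOn (hfK hch.right_mem) (hfK hw) (hbq.symm.trans hxw), hch.apply_right] at hwr
      exact lt_irrefl _ hwr
  have : h x ∈ C.φ '' (frontier C.K ∩ {z | L z ≤ r}) := by
    rw [← hAB] at hx
    rcases hx with hx | hx
    exacts [h1 ⟨x, ⟨hx, hxab⟩, rfl⟩, h2 ⟨x, ⟨hx, hxab⟩, rfl⟩]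
  obtain ⟨z, ⟨hz, hzL⟩, hzx⟩ := this
  obtain rfl := hC.injOn (hfK hz) (hfK hw) (hzx.trans hxw)
  exact not_lt.2 hzL hwr

theorem neg_half (L : ℂ →L[ℝ] ℝ) (r : ℝ) : {z | (-L) z ≤ -r} = {z | r ≤ L z} := by
  ext z; simp

theorem neg_half' (L : ℂ →L[ℝ] ℝ) (r : ℝ) : {z | -r ≤ (-L) z} = {z | L z ≤ r} := by
  ext z; simp

theorem Cell.Good.exists_sides (hC : C.Good h G) (hh : ContinuousOn h G) (hinj : InjOn h G)
    (hch : Chord C.K L r p q) (ha : a ∈ C.J) (hb : b ∈ C.J) (hap : h a = C.φ p)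
    (hbq : h b = C.φ q) (hab : a ≠ b) :
    ∃ A B, NArc A a b ∧ NArc B a b ∧ A ∩ B = {a, b} ∧ A ∪ B = C.J ∧
      h '' A = C.φ '' (frontier C.K ∩ {z | L z ≤ r}) ∧
      h '' B = C.φ '' (frontier C.K ∩ {z | r ≤ L z}) := by
  have main : ∀ A B, NArc A a b → NArc B a b → A ∩ B = {a, b} → A ∪ B = C.J →
      h '' (A \ {a, b}) ⊆ C.φ '' (frontier C.K ∩ {z | L z ≤ r}) →
      h '' A = C.φ '' (frontier C.K ∩ {z | L z ≤ r}) ∧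
      h '' B = C.φ '' (frontier C.K ∩ {z | r ≤ L z}) := by
    intro A B hA hB hAB hJ h1
    have h2 := (hC.side hh hinj hch ha hb hap hbq hB (hJ ▸ subset_union_right)).resolve_left
      fun h2 => hC.not_both hch hap hbq hJ h1 h2
    refine ⟨hC.image_half hch hA.left_mem hA.right_mem hap hbq hJ h1 h2, ?_⟩
    have := hC.image_half hch.neg hB.left_mem hB.right_mem hap hbq ((union_comm _ _).trans hJ)
      (by rwa [neg_half]) (by rwa [neg_half'])
    rwa [neg_half] at this
  obtain ⟨A, B, hA, hB, hAB, hJ⟩ := hC.mcell.curve.split ha hb hab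
  rcases hC.side hh hinj hch ha hb hap hbq hA (hJ ▸ subset_union_left) with h1 | h1
  · exact ⟨A, B, hA, hB, hAB, hJ, main A B hA hB hAB hJ h1⟩
  · have hJ' := (union_comm B A).trans hJ
    have hAB' := (inter_comm B A).trans hAB
    refine ⟨B, A, hB, hA, hAB', hJ', main B A hB hA hAB' hJ' ?_⟩
    refine (hC.side hh hinj hch ha hb hap hbq hB (hJ ▸ subset_union_right)).resolve_right
      fun h2 => hC.not_both hch.neg hap hbq hJ ?_ ?_ <;> rwa [neg_half]

theorem Cell.Good.half {A Q₁ : Set X} {h' : X → S} (hC : C.Good h G) (hch : Chord C.K L r p q)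
    (hQ₁ : MCell Q₁ (A ∪ c)) (hQ : Q₁ ⊆ C.Q) (hA : h '' A = C.φ '' (frontier C.K ∩ {z | L z ≤ r}))
    (hAJ : A ⊆ C.J) (hh' : EqOn h' h G) (hc' : h' '' c = C.φ '' segment ℝ p q) :
    Cell.Good ⟨Q₁, A ∪ c, C.K ∩ {z | L z ≤ r}, C.φ⟩ h' (G ∪ c) where
  mcell := hQ₁
  convex := hch.convex_half
  isCompact := hch.isCompact_half
  nonempty := hch.nonempty_half
  continuousOn := hC.continuousOn.mono inter_subset_left
  injOn := hC.injOn.mono inter_subset_left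
  image_eq := by
    show h' '' (A ∪ c) = C.φ '' frontier (C.K ∩ {z | L z ≤ r})
    rw [hch.frontier_half, image_union, image_union, hc', ← hA,
      (hh'.mono (hAJ.trans hC.subset)).image_eq]
  subset := union_subset_union_left _ (hAJ.trans hC.subset)
  disjoint := disjoint_union_right.2 ⟨hC.disjoint.mono_left hQ,
    hQ₁.disjoint.mono_right subset_union_right⟩
  disjoint_image := by
    rw [image_union, hh'.image_eq, hc', disjoint_union_right]
    show Disjoint (C.φ '' interior (C.K ∩ {z | L z ≤ r})) _ ∧
      Disjoint (C.φ '' interior (C.K ∩ {z | L z ≤ r})) _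
    rw [hch.interior_half]
    refine ⟨hC.disjoint_image.mono_left (image_mono inter_subset_left), ?_⟩
    rw [hch.segment_eq]
    rw [disjoint_left]
    rintro _ ⟨z, ⟨hzK, hz⟩, rfl⟩ ⟨w, ⟨hwK, hw⟩, hwz⟩
    obtain rfl := hC.injOn hwK (interior_subset hzK) hwz
    exact (show L w < r from hz).ne hw

theorem Cell.Good.split (hC : C.Good h G) (hG : IsClosed G) (hh : ContinuousOn h G)
    (hinj : InjOn h G) (hch : Chord C.K L r p q) (hc : NArc c a b) (hcQ : c \ {a, b} ⊆ C.Q)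
    (ha : a ∈ C.J) (hb : b ∈ C.J) (hap : h a = C.φ p) (hbq : h b = C.φ q) :
    ∃ h' : X → S, ∃ Q₁ Q₂ J₁ J₂, EqOn h' h G ∧ ContinuousOn h' (G ∪ c) ∧ InjOn h' (G ∪ c) ∧
      h' '' c ⊆ C.inner ∪ h '' G ∧
      Cell.Good ⟨Q₁, J₁, C.K ∩ {z | L z ≤ r}, C.φ⟩ h' (G ∪ c) ∧
      Cell.Good ⟨Q₂, J₂, C.K ∩ {z | r ≤ L z}, C.φ⟩ h' (G ∪ c) ∧
      Disjoint Q₁ Q₂ ∧ Q₁ ⊆ C.Q ∧ Q₂ ⊆ C.Q ∧ closure C.Q ⊆ closure Q₁ ∪ closure Q₂ := by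
  have hsK : segment ℝ p q ⊆ C.K := hch.segment_eq ▸ inter_subset_left
  obtain ⟨e, he, hei, hea, heb, hec, heo⟩ := hc.exists_edge hch.ne (hC.continuousOn.mono hsK)
    (hC.injOn.mono hsK)
  classical
  set h' : X → S := fun x => if x ∈ G then h x else e x with hdef
  have hG' : EqOn h' h G := fun x hx => if_pos hx
  have hcG : ∀ x ∈ c, x ∈ G → x = a ∨ x = b := fun x hx hxG => by
    by_contra hne
    exact disjoint_left.1 hC.disjoint (hcQ ⟨hx, hne⟩) hxG
  have hc' : EqOn h' e c := fun x hx => by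
    by_cases hxG : x ∈ G
    · rw [hG' hxG]
      rcases hcG x hx hxG with rfl | rfl
      · rw [hap, hea]
      · rw [hbq, heb]
    · exact if_neg hxG
  have heo' : ∀ x ∈ c, x ∉ G → e x ∈ C.inner := fun x hx hxG => by
    obtain ⟨z, hz, hze⟩ := heo ⟨x, ⟨hx, by
      rintro (rfl | rfl)
      exacts [hxG (hC.subset ha), hxG (hC.subset hb)]⟩, rfl⟩
    exact ⟨z, hch.openSegment_subset hz, hze⟩
  obtain ⟨A, B, hA, hB, hAB, hJ, hiA, hiB⟩ := hC.exists_sides hh hinj hch ha hb hap hbq hc.ne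
  have hQ : MCell C.Q (A ∪ B) := hJ ▸ hC.mcell
  obtain ⟨Q₁, Q₂, hQ₁, hQ₂, hd, h1, h2, hcov⟩ := hQ.theta hA hB hAB hc hcQ
  have himg : h' '' c = C.φ '' segment ℝ p q := hc'.image_eq.trans hec
  have hAJ : A ⊆ C.J := hJ ▸ subset_union_left
  have hBJ : B ⊆ C.J := hJ ▸ subset_union_right
  refine ⟨h', Q₁, Q₂, A ∪ c, B ∪ c, hG', ?_, ?_, ?_, hC.half hch hQ₁ h1 hiA hAJ hG' himg, ?_, hd,
    h1, h2, ?_⟩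
  · exact (hh.congr hG').union_of_isClosed (he.congr hc') hG hc.isCompact.isClosed
  · have cross : ∀ x ∈ G, ∀ y ∈ c, h' x = h' y → x = y := fun x hx y hy hxy => by
      by_cases hyG : y ∈ G
      · rw [hG' hx, hG' hyG] at hxy
        exact hinj hx hyG hxy
      · rw [hG' hx, hc' hy] at hxy
        exact absurd ⟨x, hx, hxy⟩ (disjoint_left.1 hC.disjoint_image (heo' y hy hyG))
    rintro x (hx | hx) y (hy | hy) hxy
    · rw [hG' hx, hG' hy] at hxy
      exact hinj hx hy hxy
    · exact cross x hx y hy hxy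
    · exact (cross y hy x hx hxy.symm).symm
    · rw [hc' hx, hc' hy] at hxy
      exact hei hx hy hxy
  · rintro _ ⟨x, hx, rfl⟩
    by_cases hxG : x ∈ G
    · exact .inr ⟨x, hxG, (hG' hxG).symm⟩
    · exact .inl (by rw [hc' hx]; exact heo' x hx hxG)
  · have := hC.half (L := -L) (r := -r) hch.neg hQ₂ h2 (by rwa [neg_half]) hBJ hG' himg
    rwa [neg_half] at this
  · rw [hQ₁.closure_eq, hQ₂.closure_eq, hC.mcell.closure_eq, ← hJ]
    rintro x (hx | hx | hx)
    · rcases hcov hx with (hx | hx) | hx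
      exacts [.inl (.inl hx), .inr (.inl hx), .inl (.inr (.inr hx))]
    · exact .inl (.inr (.inl hx))
    · exact .inr (.inr (.inl hx))

end

/-! ### Compatible cell decompositions -/

section
variable {X S : Type*} [TopologicalSpace X] [Planar X] [TopologicalSpace S] [T2Space S]
  {C C' C₀ C₁ C₂ : Cell X S} {h h' : X → S} {G c : Set X} {a b : X} {L : ℂ →L[ℝ] ℝ} {r : ℝ}
  {p q : ℂ} {𝒞 : Set (Cell X S)}

/-- A pair of compatible finite cell decompositions of `X` and `S`; the map `h` embeds the graph
`G` of the first decomposition into `S`. -/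
structure IsState (𝒞 : Set (Cell X S)) (h : X → S) (G : Set X) : Prop where
  finite : 𝒞.Finite
  good : ∀ C ∈ 𝒞, C.Good h G
  isClosed : IsClosed G
  continuousOn : ContinuousOn h G
  injOn : InjOn h G
  disjoint : ∀ C ∈ 𝒞, ∀ C' ∈ 𝒞, C ≠ C' → Disjoint C.Q C'.Q
  disjoint_inner : ∀ C ∈ 𝒞, ∀ C' ∈ 𝒞, C ≠ C' → Disjoint C.inner C'.inner
  cover : ∀ x, ∃ C ∈ 𝒞, x ∈ closure C.Q
  cover_target : ∀ y, ∃ C ∈ 𝒞, y ∈ C.target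

/-- The relation of being a subcell, both in the source and in the target. -/
structure Cell.Refines {X S : Type*} (C' C : Cell X S) : Prop where
  subset : C'.Q ⊆ C.Q
  target : C'.target ⊆ C.target
  inner : C'.inner ⊆ C.inner

theorem Cell.Refines.refl {X S : Type*} (C : Cell X S) : C.Refines C :=
  ⟨Subset.rfl, Subset.rfl, Subset.rfl⟩

theorem Cell.Refines.trans {X S : Type*} {C₁ C₂ C₃ : Cell X S} (h₁ : C₁.Refines C₂)
    (h₂ : C₂.Refines C₃) : C₁.Refines C₃ :=
  ⟨h₁.1.trans h₂.1, h₁.2.trans h₂.2, h₁.3.trans h₂.3⟩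

theorem Cell.Good.extend (hC : C.Good h G) (hh' : EqOn h' h G) (hd : Disjoint C.Q c)
    (hd' : Disjoint C.inner (h' '' c)) : C.Good h' (G ∪ c) where
  mcell := hC.mcell
  convex := hC.convex
  isCompact := hC.isCompact
  nonempty := hC.nonempty
  continuousOn := hC.continuousOn
  injOn := hC.injOn
  image_eq := (hh'.mono hC.subset).image_eq.trans hC.image_eq
  subset := hC.subset.trans subset_union_left
  disjoint := disjoint_union_right.2 ⟨hC.disjoint, hd⟩
  disjoint_image := by
    rw [image_union, hh'.image_eq]
    exact disjoint_union_right.2 ⟨hC.disjoint_image, hd'⟩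

theorem IsState.replace (hS : IsState 𝒞 h G) (hC : C ∈ 𝒞) (hc : IsClosed c)
    (hcQ : c ⊆ C.Q ∪ G) (hh' : EqOn h' h G) (hcont : ContinuousOn h' (G ∪ c))
    (hinj : InjOn h' (G ∪ c)) (him : h' '' c ⊆ C.inner ∪ h '' G) (h₁ : C₁.Good h' (G ∪ c))
    (h₂ : C₂.Good h' (G ∪ c)) (hd : Disjoint C₁.Q C₂.Q) (hd' : Disjoint C₁.inner C₂.inner)
    (hr₁ : C₁.Refines C) (hr₂ : C₂.Refines C) (hcov : closure C.Q ⊆ closure C₁.Q ∪ closure C₂.Q)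
    (hcov' : C.target ⊆ C₁.target ∪ C₂.target) :
    IsState (insert C₁ (insert C₂ (𝒞 \ {C}))) h' (G ∪ c) where
  finite := ((hS.finite.sdiff).insert _).insert _
  good := by
    rintro D (rfl | rfl | ⟨hD, hDC⟩)
    · exact h₁
    · exact h₂
    · have hDG := hS.good D hD
      refine hDG.extend hh' ?_ ?_
      · exact (disjoint_union_right.2 ⟨hS.disjoint D hD C hC hDC, hDG.disjoint⟩).mono_right hcQ
      · exact (disjoint_union_right.2 ⟨hS.disjoint_inner D hD C hC hDC,
          hDG.disjoint_image⟩).mono_right him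
  isClosed := hS.isClosed.union hc
  continuousOn := hcont
  injOn := hinj
  disjoint := by
    rintro D (rfl | rfl | ⟨hD, hDC⟩) D' (rfl | rfl | ⟨hD', hDC'⟩) hne
    · exact absurd rfl hne
    · exact hd
    · exact ((hS.disjoint D' hD' C hC hDC').mono_right hr₁.subset).symm
    · exact hd.symm
    · exact absurd rfl hne
    · exact ((hS.disjoint D' hD' C hC hDC').mono_right hr₂.subset).symm
    · exact (hS.disjoint D hD C hC hDC).mono_right hr₁.subset
    · exact (hS.disjoint D hD C hC hDC).mono_right hr₂.subset
    · exact hS.disjoint D hD D' hD' hne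
  disjoint_inner := by
    rintro D (rfl | rfl | ⟨hD, hDC⟩) D' (rfl | rfl | ⟨hD', hDC'⟩) hne
    · exact absurd rfl hne
    · exact hd'
    · exact ((hS.disjoint_inner D' hD' C hC hDC').mono_right hr₁.inner).symm
    · exact hd'.symm
    · exact absurd rfl hne
    · exact ((hS.disjoint_inner D' hD' C hC hDC').mono_right hr₂.inner).symm
    · exact (hS.disjoint_inner D hD C hC hDC).mono_right hr₁.inner
    · exact (hS.disjoint_inner D hD C hC hDC).mono_right hr₂.inner
    · exact hS.disjoint_inner D hD D' hD' hne
  cover := fun x => by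
    obtain ⟨D, hD, hx⟩ := hS.cover x
    by_cases hDC : D = C
    · rcases hcov (hDC ▸ hx) with hx | hx
      exacts [⟨C₁, .inl rfl, hx⟩, ⟨C₂, .inr (.inl rfl), hx⟩]
    · exact ⟨D, .inr (.inr ⟨hD, hDC⟩), hx⟩
  cover_target := fun y => by
    obtain ⟨D, hD, hy⟩ := hS.cover_target y
    by_cases hDC : D = C
    · rcases hcov' (hDC ▸ hy) with hy | hy
      exacts [⟨C₁, .inl rfl, hy⟩, ⟨C₂, .inr (.inl rfl), hy⟩]
    · exact ⟨D, .inr (.inr ⟨hD, hDC⟩), hy⟩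

theorem IsState.cut (hS : IsState 𝒞 h G) (hC : C ∈ 𝒞) (hC₀ : C₀.Good h G) (hQ : C₀.Q = C.Q)
    (ht : C₀.target = C.target) (hi : C₀.inner = C.inner) (hch : Chord C₀.K L r p q)
    (hc : NArc c a b) (hcQ : c \ {a, b} ⊆ C₀.Q) (ha : a ∈ C₀.J) (hb : b ∈ C₀.J)
    (hap : h a = C₀.φ p) (hbq : h b = C₀.φ q) :
    ∃ h' : X → S, ∃ Q₁ Q₂ J₁ J₂,
      IsState (insert ⟨Q₁, J₁, C₀.K ∩ {z | L z ≤ r}, C₀.φ⟩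
        (insert ⟨Q₂, J₂, C₀.K ∩ {z | r ≤ L z}, C₀.φ⟩ (𝒞 \ {C}))) h' (G ∪ c) ∧
      Cell.Refines ⟨Q₁, J₁, C₀.K ∩ {z | L z ≤ r}, C₀.φ⟩ C ∧
      Cell.Refines ⟨Q₂, J₂, C₀.K ∩ {z | r ≤ L z}, C₀.φ⟩ C := by
  obtain ⟨h', Q₁, Q₂, J₁, J₂, hh', hcont, hinj, him, h₁, h₂, hd, hQ₁, hQ₂, hcov⟩ :=
    hC₀.split hS.isClosed hS.continuousOn hS.injOn hch hc hcQ ha hb hap hbq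
  have hr₁ : Cell.Refines ⟨Q₁, J₁, C₀.K ∩ {z | L z ≤ r}, C₀.φ⟩ C :=
    ⟨hQ ▸ hQ₁, ht ▸ image_mono inter_subset_left, hi ▸ image_mono (interior_mono inter_subset_left)⟩
  have hr₂ : Cell.Refines ⟨Q₂, J₂, C₀.K ∩ {z | r ≤ L z}, C₀.φ⟩ C :=
    ⟨hQ ▸ hQ₂, ht ▸ image_mono inter_subset_left, hi ▸ image_mono (interior_mono inter_subset_left)⟩
  refine ⟨h', Q₁, Q₂, J₁, J₂, hS.replace hC hc.isCompact.isClosed ?_ hh' hcont hinj (hi ▸ him) h₁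
    h₂ hd ?_ hr₁ hr₂ (hQ ▸ hcov) ?_, hr₁, hr₂⟩
  · intro x hx
    by_cases hxab : x ∈ ({a, b} : Set X)
    · rcases hxab with rfl | rfl
      exacts [.inr (hC₀.subset ha), .inr (hC₀.subset hb)]
    · exact .inl (hQ ▸ hcQ ⟨hx, hxab⟩)
  · show Disjoint (C₀.φ '' interior (C₀.K ∩ {z | L z ≤ r}))
      (C₀.φ '' interior (C₀.K ∩ {z | r ≤ L z}))
    rw [interior_inter, interior_inter, interior_setOf_le hch.ne_zero, interior_setOf_ge hch.ne_zero,
      disjoint_left]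
    rintro _ ⟨z, ⟨hzK, hz⟩, rfl⟩ ⟨w, ⟨hwK, hw⟩, hwz⟩
    obtain rfl := hC₀.injOn (interior_subset hwK) (interior_subset hzK) hwz
    exact lt_asymm (show L w < r from hz) hw
  · rw [← ht]
    rintro _ ⟨z, hz, rfl⟩
    rcases le_total (L z) r with hzr | hzr
    exacts [.inl ⟨z, ⟨hz, hzr⟩, rfl⟩, .inr ⟨z, ⟨hz, hzr⟩, rfl⟩]

theorem chord_closedBall {p q : ℂ} (hp : p ∈ sphere (0 : ℂ) 1) (hq : q ∈ sphere (0 : ℂ) 1)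
    (hpq : p ≠ q) : ∃ L r, Chord (closedBall (0 : ℂ) 1) L r p q := by
  have hf : frontier (closedBall (0 : ℂ) 1) = sphere 0 1 := frontier_closedBall _ one_ne_zero
  set u := q - p with hu
  set L : ℂ →L[ℝ] ℝ := u.re • Complex.imCLM - u.im • Complex.reCLM with hL
  have hLz : ∀ z, L z = u.re * z.im - u.im * z.re := fun z => by simp [hL]
  refine ⟨L, L p, convex_closedBall _ _, isCompact_closedBall _ _, fun h0 => ?_, hf ▸ hp, hf ▸ hq,
    hpq, rfl, ?_, ?_⟩
  · have h1 : L 1 = 0 := by rw [h0]; rfl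
    have h2 : L Complex.I = 0 := by rw [h0]; rfl
    rw [hLz] at h1 h2
    simp at h1 h2
    exact sub_ne_zero.2 hpq.symm (Complex.ext h2 h1)
  · rw [hLz, hLz, hu]
    simp
    ring
  · exact (strictConvex_closedBall ℝ (0 : ℂ) 1).openSegment_subset (sphere_subset_closedBall hp)
      (sphere_subset_closedBall hq) hpq

theorem Cell.Good.exists_disc (hC : C.Good h G) (ha : a ∈ C.J) (hb : b ∈ C.J) (hab : a ≠ b)
    (hinj : InjOn h G) :
    ∃ C₀ : Cell X S, ∃ L r p q, C₀.Good h G ∧ C₀.Q = C.Q ∧ C₀.J = C.J ∧ C₀.target = C.target ∧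
      C₀.inner = C.inner ∧ Chord C₀.K L r p q ∧ h a = C₀.φ p ∧ h b = C₀.φ q := by
  obtain ⟨e, he1, he2, he3⟩ := exists_homeomorph_image_interior_closure_frontier_eq_unitBall
    hC.convex hC.nonempty hC.isCompact.isBounded
  rw [hC.isCompact.isClosed.closure_eq] at he2
  have hs : ∀ A B, e '' A = B → (C.φ ∘ e.symm) '' B = C.φ '' A := fun A B hAB => by
    rw [← hAB, ← image_comp]
    congr 1
    ext z
    simp
  have hm : MapsTo e.symm (closedBall 0 1) C.K := fun z hz => by
    rw [← he2] at hz
    obtain ⟨w, hw, rfl⟩ := hz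
    simpa using hw
  have hf : frontier (closedBall (0 : ℂ) 1) = sphere 0 1 := frontier_closedBall _ one_ne_zero
  have hi : interior (closedBall (0 : ℂ) 1) = ball 0 1 := interior_closedBall _ one_ne_zero
  set C₀ : Cell X S := ⟨C.Q, C.J, closedBall 0 1, C.φ ∘ e.symm⟩ with hC₀
  have h1 : C₀.target = C.target := hs _ _ he2
  have h2 : C₀.inner = C.inner := hs _ _ (he1.trans hi.symm)
  have hg : C₀.Good h G :=
    { mcell := hC.mcell
      convex := convex_closedBall _ _
      isCompact := isCompact_closedBall _ _
      nonempty := hi ▸ nonempty_ball.2 one_pos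
      continuousOn := hC.continuousOn.comp e.symm.continuous.continuousOn hm
      injOn := hC.injOn.comp e.symm.injective.injOn hm
      image_eq := hC.image_eq.trans (hs _ _ (he3.trans hf.symm)).symm
      subset := hC.subset
      disjoint := hC.disjoint
      disjoint_image := h2 ▸ hC.disjoint_image }
  have hpt : ∀ x ∈ C.J, ∃ p ∈ sphere (0 : ℂ) 1, C₀.φ p = h x := fun x hx => by
    have : h x ∈ C₀.φ '' frontier C₀.K := hg.image_eq ▸ mem_image_of_mem h hx
    rwa [show frontier C₀.K = sphere 0 1 from hf] at this
  obtain ⟨p, hp, hpa⟩ := hpt a ha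
  obtain ⟨q, hq, hqb⟩ := hpt b hb
  obtain ⟨L, r, hch⟩ := chord_closedBall hp hq (fun hpq => hab (hinj (hC.subset ha)
    (hC.subset hb) (by rw [← hpa, ← hqb, hpq])))
  exact ⟨C₀, L, r, p, q, hg, rfl, rfl, h1, h2, hch, hpa.symm, hqb.symm⟩

/-- Cutting along a crosscut of the source. -/
theorem IsState.cut_source (hS : IsState 𝒞 h G) (hC : C ∈ 𝒞) (hc : NArc c a b)
    (hcQ : c \ {a, b} ⊆ C.Q) (ha : a ∈ C.J) (hb : b ∈ C.J) :
    ∃ h' C₁ C₂, IsState (insert C₁ (insert C₂ (𝒞 \ {C}))) h' (G ∪ c) ∧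
      C₁.Refines C ∧ C₂.Refines C := by
  obtain ⟨C₀, L, r, p, q, hg, h1, h2, h3, h4, hch, hap, hbq⟩ :=
    (hS.good C hC).exists_disc ha hb hc.ne hS.injOn
  obtain ⟨h', Q₁, Q₂, J₁, J₂, hst, hr₁, hr₂⟩ := hS.cut hC hg h1 h3 h4 hch hc (h1 ▸ hcQ) (h2 ▸ ha)
    (h2 ▸ hb) hap hbq
  exact ⟨h', _, _, hst, hr₁, hr₂⟩

/-- Cutting along a chord of the target. -/
theorem IsState.cut_target (hS : IsState 𝒞 h G) (hC : C ∈ 𝒞) (hch : Chord C.K L r p q)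
    (hp : ∀ x ∈ C.J, h x = C.φ p → Flat C.J x) (hq : ∀ x ∈ C.J, h x = C.φ q → Flat C.J x) :
    ∃ (h' : X → S) (G' : Set X) (Q₁ Q₂ J₁ J₂ : Set X),
      IsState (insert ⟨Q₁, J₁, C.K ∩ {z | L z ≤ r}, C.φ⟩
        (insert ⟨Q₂, J₂, C.K ∩ {z | r ≤ L z}, C.φ⟩ (𝒞 \ {C}))) h' G' ∧
      Cell.Refines ⟨Q₁, J₁, C.K ∩ {z | L z ≤ r}, C.φ⟩ C ∧
      Cell.Refines ⟨Q₂, J₂, C.K ∩ {z | r ≤ L z}, C.φ⟩ C := by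
  have hg := hS.good C hC
  have hfK : frontier C.K ⊆ C.K := hg.isCompact.isClosed.frontier_subset
  obtain ⟨a, ha, hap⟩ : C.φ p ∈ h '' C.J := hg.image_eq ▸ mem_image_of_mem _ hch.left_mem
  obtain ⟨b, hb, hbq⟩ : C.φ q ∈ h '' C.J := hg.image_eq ▸ mem_image_of_mem _ hch.right_mem
  obtain ⟨c, hc, hcQ⟩ := hg.mcell.exists_crosscut (hp a ha hap) (hq b hb hbq) (fun hab =>
    hch.ne (hg.injOn (hfK hch.left_mem) (hfK hch.right_mem) (by rw [← hap, ← hbq, hab])))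
  obtain ⟨h', Q₁, Q₂, J₁, J₂, hst, hr₁, hr₂⟩ := hS.cut hC hg rfl rfl rfl hch hc hcQ ha
    hb hap hbq
  exact ⟨h', _, _, _, _, _, hst, hr₁, hr₂⟩

/-- Improving the cells of a decomposition step by step, measured by a natural number. -/
theorem IsState.exists_refinement {P : ℕ → Cell X S → Prop} {N : ℕ}
    (step : ∀ 𝒞 h G, IsState 𝒞 h G → ∀ n, ∀ C ∈ 𝒞, P (n + 1) C → ¬ P n C → ∃ 𝒞' h' G',
      IsState 𝒞' h' G' ∧ ∀ C' ∈ 𝒞', (C' ∈ 𝒞 ∧ C' ≠ C) ∨ (P n C' ∧ C'.Refines C))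
    (hS : IsState 𝒞 h G) (hP : ∀ C ∈ 𝒞, P N C) (mono : ∀ n C, P n C → P (n + 1) C) :
    ∃ 𝒞' h' G', IsState 𝒞' h' G' ∧ (∀ C' ∈ 𝒞', P 0 C') ∧ ∀ C' ∈ 𝒞', ∃ C ∈ 𝒞, C'.Refines C := by
  have inner : ∀ n k, ∀ 𝒞 h G, IsState 𝒞 h G → (∀ C ∈ 𝒞, P (n + 1) C) →
      {C ∈ 𝒞 | ¬ P n C}.ncard = k → ∃ 𝒞' h' G', IsState 𝒞' h' G' ∧ (∀ C' ∈ 𝒞', P n C') ∧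
        ∀ C' ∈ 𝒞', ∃ C ∈ 𝒞, C'.Refines C := by
    intro n k
    induction k using Nat.strong_induction_on with
    | _ k ih =>
      intro 𝒞 h G hS hP hk
      by_cases hall : ∀ C ∈ 𝒞, P n C
      · exact ⟨𝒞, h, G, hS, hall, fun C hC => ⟨C, hC, .refl C⟩⟩
      push Not at hall
      obtain ⟨C, hC, hCn⟩ := hall
      obtain ⟨𝒞', h', G', hS', hC'⟩ := step 𝒞 h G hS n C hC (hP C hC) hCn
      have hlt : {C ∈ 𝒞' | ¬ P n C}.ncard < k := by
        rw [← hk]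
        refine ncard_lt_ncard ⟨fun D hD => ?_, fun hsub => ?_⟩ (hS.finite.subset (sep_subset _ _))
        · rcases hC' D hD.1 with h1 | h1
          exacts [⟨h1.1, hD.2⟩, absurd h1.1 hD.2]
        · have := hsub ⟨hC, hCn⟩
          rcases hC' C this.1 with h1 | h1
          exacts [h1.2 rfl, hCn h1.1]
      obtain ⟨𝒞'', h'', G'', hS'', hP'', hr⟩ := ih _ hlt 𝒞' h' G' hS' (fun D hD => by
        rcases hC' D hD with h1 | h1
        exacts [hP D h1.1, mono n D h1.1]) rfl
      refine ⟨𝒞'', h'', G'', hS'', hP'', fun D hD => ?_⟩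
      obtain ⟨D', hD', hDD'⟩ := hr D hD
      rcases hC' D' hD' with h1 | h1
      exacts [⟨D', h1.1, hDD'⟩, ⟨C, hC, hDD'.trans h1.2⟩]
  induction N generalizing 𝒞 h G with
  | zero => exact ⟨𝒞, h, G, hS, hP, fun C hC => ⟨C, hC, .refl C⟩⟩
  | succ n ih =>
    obtain ⟨𝒞', h', G', hS', hP', hr'⟩ := inner n _ 𝒞 h G hS hP rfl
    obtain ⟨𝒞'', h'', G'', hS'', hP'', hr''⟩ := ih hS' hP'
    refine ⟨𝒞'', h'', G'', hS'', hP'', fun D hD => ?_⟩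
    obtain ⟨D', hD', hDD'⟩ := hr'' D hD
    obtain ⟨D'', hD'', hDD''⟩ := hr' D' hD'
    exact ⟨D'', hD'', hDD'.trans hDD''⟩

end

/-! ### Refining the source -/

section
variable {X S : Type*} [MetricSpace X] [Planar X] [TopologicalSpace S] [T2Space S]
  {h : X → S} {G : Set X} {𝒞 : Set (Cell X S)} {ψ : ℂ → X}

/-- The family `𝒞'` refines `𝒞`. -/
def RefinesFam {X S : Type*} (𝒞' 𝒞 : Set (Cell X S)) : Prop := ∀ C' ∈ 𝒞', ∃ C ∈ 𝒞, C'.Refines C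

theorem RefinesFam.refl {X S : Type*} (𝒞 : Set (Cell X S)) : RefinesFam 𝒞 𝒞 :=
  fun C hC => ⟨C, hC, .refl C⟩

theorem RefinesFam.trans {X S : Type*} {𝒞₁ 𝒞₂ 𝒞₃ : Set (Cell X S)} (h₁ : RefinesFam 𝒞₁ 𝒞₂)
    (h₂ : RefinesFam 𝒞₂ 𝒞₃) : RefinesFam 𝒞₁ 𝒞₃ := fun C hC => by
  obtain ⟨D, hD, hCD⟩ := h₁ C hC
  obtain ⟨E, hE, hDE⟩ := h₂ D hD
  exact ⟨E, hE, hCD.trans hDE⟩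

theorem NArc.subset_closure_sdiff {X : Type*} [TopologicalSpace X] {A : Set X} {x y : X}
    (hA : NArc A x y) : A ⊆ closure (A \ {x, y}) := by
  obtain ⟨-, γ, hc, hi, rfl, rfl, rfl⟩ := hA
  have : γ '' Icc 0 1 \ {γ 0, γ 1} = γ '' Ioo 0 1 := by
    rw [← image_pair, ← hi.image_sdiff_subset (by simp [insert_subset_iff]), Icc_sdiff_both]
  rw [this, ← closure_Ioo zero_ne_one]
  exact ContinuousOn.image_closure (by rwa [closure_Ioo zero_ne_one])

theorem IsState.exists_avoid (hS : IsState 𝒞 h G) (z : X) :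
    ∃ 𝒞' h' G', IsState 𝒞' h' G' ∧ RefinesFam 𝒞' 𝒞 ∧ ∀ C ∈ 𝒞', z ∉ C.Q := by
  by_cases hz : ∀ C ∈ 𝒞, z ∉ C.Q
  · exact ⟨𝒞, h, G, hS, .refl _, hz⟩
  push Not at hz
  obtain ⟨C, hC, hzC⟩ := hz
  have hg := hS.good C hC
  obtain ⟨a, ha⟩ := hg.mcell.curve.infinite_flat.nonempty
  obtain ⟨b, hb, hba⟩ := (hg.mcell.curve.infinite_flat.sdiff (finite_singleton a)).nonempty
  obtain ⟨c, hc, hcQ, hzc⟩ := hg.mcell.exists_crosscut_through ha hb (Ne.symm hba) hzC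
  obtain ⟨h', C₁, C₂, hS', hr₁, hr₂⟩ := hS.cut_source hC hc hcQ ha.mem hb.mem
  refine ⟨_, h', _, hS', ?_, fun D hD hzD => ?_⟩
  · rintro D (rfl | rfl | ⟨hD, -⟩)
    exacts [⟨C, hC, hr₁⟩, ⟨C, hC, hr₂⟩, ⟨D, hD, .refl D⟩]
  · exact disjoint_left.1 (hS'.good D hD).disjoint hzD (.inr hzc)

theorem IsState.exists_local_refinement (hψ : IsOpenEmbedding ψ) (hS : IsState 𝒞 h G) :
    ∃ 𝒞' h' G', IsState 𝒞' h' G' ∧ RefinesFam 𝒞' 𝒞 ∧ ∀ C ∈ 𝒞', ∀ x ∈ C.Q,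
      x ∈ ψ '' closedBall 0 (1 / 2) → C.Q ⊆ ψ '' ball 0 2 := by
  obtain ⟨𝒞₁, h₁, G₁, hS₁, hr₁, hz₁⟩ := hS.exists_avoid (ψ 1)
  obtain ⟨𝒞₀, h₀, G₀, hS₀, hr₀, hz₀⟩ := hS₁.exists_avoid (ψ (-1))
  have hz₁' : ∀ C ∈ 𝒞₀, ψ 1 ∉ C.Q := fun C hC hz => by
    obtain ⟨D, hD, hCD⟩ := hr₀ C hC
    exact hz₁ D hD (hCD.subset hz)
  have := fun C : 𝒞₀ => exists_finite_crosscuts hψ (hS₀.good C C.2).mcell (hz₁' C C.2) (hz₀ C C.2)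
  choose 𝒢 hfin harc hdisj hmesh using this
  set P : ℕ → Cell X S → Prop := fun n C => ∃ D : 𝒞₀, C.Q ⊆ D.1.Q ∧
    (∀ g ∈ 𝒢 D, Disjoint g C.Q ∨ g ∩ D.1.Q ⊆ C.Q) ∧ {g ∈ 𝒢 D | ¬ Disjoint g C.Q}.ncard ≤ n with hP
  obtain ⟨N, hN⟩ : ∃ N, ∀ C ∈ 𝒞₀, P N C := by
    have : ∀ C ∈ 𝒞₀, ∃ N, P N C := fun C hC =>
      ⟨_, ⟨C, hC⟩, Subset.rfl, fun g hg => .inr inter_subset_right, le_rfl⟩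
    choose! f hf using this
    obtain ⟨N, hN⟩ := (hS₀.finite.image f).bddAbove
    refine ⟨N, fun C hC => ?_⟩
    obtain ⟨D, h1, h2, h3⟩ := hf C hC
    exact ⟨D, h1, h2, h3.trans (hN ⟨C, hC, rfl⟩)⟩
  have step : ∀ 𝒞 h G, IsState 𝒞 h G → ∀ n, ∀ C ∈ 𝒞, P (n + 1) C → ¬ P n C → ∃ 𝒞' h' G',
      IsState 𝒞' h' G' ∧ ∀ C' ∈ 𝒞', (C' ∈ 𝒞 ∧ C' ≠ C) ∨ (P n C' ∧ C'.Refines C) := by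
    intro 𝒞 h G hS n C hC hPC hnP
    obtain ⟨D, h1, h2, h3⟩ := hPC
    have hf : {g ∈ 𝒢 D | ¬ Disjoint g C.Q}.Finite := (hfin D).subset (sep_subset _ _)
    obtain ⟨g, hg, hgC⟩ : {g ∈ 𝒢 D | ¬ Disjoint g C.Q}.Nonempty := by
      rw [nonempty_iff_ne_empty]
      intro he
      exact hnP ⟨D, h1, h2, by rw [he, ncard_empty]; exact n.zero_le⟩
    have hopen : ∀ g ∈ 𝒢 D, ∃ a b, NArc g a b ∧ a ∉ D.1.Q ∧ b ∉ D.1.Q ∧ g \ {a, b} = g ∩ D.1.Q :=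
      fun g hg => by
        obtain ⟨a, b, hga, ha, hb, hgQ⟩ := harc D g hg
        refine ⟨a, b, hga, ha, hb, Subset.antisymm (fun x hx => ⟨hx.1, hgQ hx⟩) fun x hx =>
          ⟨hx.1, ?_⟩⟩
        rintro (rfl | rfl)
        exacts [ha hx.2, hb hx.2]
    obtain ⟨a, b, hga, ha, hb, hgQ⟩ := hopen g hg
    have hgC' : g \ {a, b} ⊆ C.Q := hgQ ▸ (h2 g hg).resolve_left hgC
    have hm := (hS.good C hC).mcell
    have hends : g ⊆ closure C.Q := hga.subset_closure_sdiff.trans (closure_mono hgC')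
    have hJ : ∀ x ∈ g, x ∉ D.1.Q → x ∈ C.J := fun x hx hxD => by
      have := hends hx
      rw [hm.closure_eq] at this
      exact this.resolve_left fun h => hxD (h1 h)
    obtain ⟨h', C₁, C₂, hS', hr₁, hr₂⟩ := hS.cut_source hC hga hgC' (hJ a hga.left_mem ha)
      (hJ b hga.right_mem hb)
    have key : ∀ E ∈ insert C₁ (insert C₂ (𝒞 \ {C})), E.Refines C → P n E := fun E hE hEC => by
      have hE' := hS'.good E hE
      have hsub : ∀ g' ∈ 𝒢 D, Disjoint g' C.Q → Disjoint g' E.Q := fun g' _ h =>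
        h.mono_right hEC.subset
      have hgE : Disjoint g E.Q := (hE'.disjoint.mono_right subset_union_right).symm
      refine ⟨D, hEC.subset.trans h1, fun g' hg' => ?_, ?_⟩
      · rcases h2 g' hg' with h' | h'
        · exact .inl (hsub g' hg' h')
        by_cases hgg : g' = g
        · exact .inl (hgg ▸ hgE)
        by_cases hne : (g' ∩ D.1.Q ∩ E.Q).Nonempty
        · right
          obtain ⟨a', b', hga', -, -, hgQ'⟩ := hopen g' hg'
          refine hE'.mcell.subset_of ?_ ?_ hne
          · rw [← hgQ']; exact hga'.isConnected_sdiff.isPreconnected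
          · refine Disjoint.mono_right hE'.subset (disjoint_union_right.2 ⟨?_, ?_⟩)
            · exact (hS.good C hC).disjoint.mono_left h'
            · rw [disjoint_left]
              intro x hx hxg
              exact disjoint_left.1 (hdisj D g' hg' g hg hgg) hx ⟨hxg, hx.2⟩
        · left
          rw [disjoint_left]
          intro x hx hxE
          exact hne ⟨x, ⟨hx, h1 (hEC.subset hxE)⟩, hxE⟩
      · refine Nat.le_of_lt_succ (lt_of_lt_of_le (ncard_lt_ncard ⟨?_, ?_⟩ hf) h3)
        · exact fun g' hg' => ⟨hg'.1, fun h => hg'.2 (hsub g' hg'.1 h)⟩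
        · exact fun hs => (hs ⟨hg, hgC⟩).2 hgE
    refine ⟨_, h', _, hS', ?_⟩
    rintro E hE
    rcases hE with rfl | rfl | ⟨hE, hEC⟩
    · exact .inr ⟨key _ (.inl rfl) hr₁, hr₁⟩
    · exact .inr ⟨key _ (.inr (.inl rfl)) hr₂, hr₂⟩
    · exact .inl ⟨hE, hEC⟩
  obtain ⟨𝒞', h', G', hS', hP', hr'⟩ := IsState.exists_refinement step hS₀ hN
    fun n C ⟨D, h1, h2, h3⟩ => ⟨D, h1, h2, h3.trans n.le_succ⟩
  refine ⟨𝒞', h', G', hS', (RefinesFam.trans hr' hr₀).trans hr₁, fun C hC x hx hxb => ?_⟩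
  obtain ⟨D, h1, h2, h3⟩ := hP' C hC
  refine hmesh D C.Q h1 (hS'.good C hC).mcell.isConnected.isPreconnected (fun g hg => ?_) x hx hxb
  by_contra hnd
  have hf : {g ∈ 𝒢 D | ¬ Disjoint g C.Q}.Finite := (hfin D).subset (sep_subset _ _)
  have := (ncard_eq_zero hf).1 (Nat.le_zero.1 h3)
  exact this.subset ⟨hg, fun h => hnd h.symm⟩

theorem IsState.exists_source_refinement [CompactSpace X] (hS : IsState 𝒞 h G) {ε : ℝ}
    (hε : 0 < ε) : ∃ 𝒞' h' G', IsState 𝒞' h' G' ∧ RefinesFam 𝒞' 𝒞 ∧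
      ∀ C ∈ 𝒞', ∀ x ∈ C.Q, ∀ y ∈ C.Q, dist x y ≤ ε := by
  have hch : ∀ x : X, ∃ ψ : ℂ → X, IsOpenEmbedding ψ ∧ ψ 0 = x ∧ range ψ ⊆ ball x (ε / 2) :=
    fun x => Surface.exists_small (ball_mem_nhds x (by linarith))
  choose ψ hψ hψ0 hψr using hch
  obtain ⟨T, hT⟩ := isCompact_univ.elim_nhds_subcover (fun x => ψ x '' closedBall 0 (1 / 2))
    fun x _ => by
      have := (hψ x).isOpenMap.image_mem_nhds (closedBall_mem_nhds (0 : ℂ) (one_half_pos (α := ℝ)))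
      rwa [hψ0] at this
  have main : ∀ T : Finset X, ∃ 𝒞' h' G', IsState 𝒞' h' G' ∧ RefinesFam 𝒞' 𝒞 ∧ ∀ x ∈ T, ∀ C ∈ 𝒞',
      ∀ y ∈ C.Q, y ∈ ψ x '' closedBall 0 (1 / 2) → C.Q ⊆ ψ x '' ball 0 2 := by
    classical
    intro T
    induction T using Finset.induction_on with
    | empty => exact ⟨𝒞, h, G, hS, .refl _, by simp⟩
    | insert x T hx ih =>
      obtain ⟨𝒞₁, h₁, G₁, hS₁, hr₁, hp₁⟩ := ih
      obtain ⟨𝒞₂, h₂, G₂, hS₂, hr₂, hp₂⟩ := hS₁.exists_local_refinement (hψ x)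
      refine ⟨𝒞₂, h₂, G₂, hS₂, hr₂.trans hr₁, fun x' hx' C hC y hy hyb => ?_⟩
      rcases Finset.mem_insert.1 hx' with rfl | hx'
      · exact hp₂ C hC y hy hyb
      · obtain ⟨D, hD, hCD⟩ := hr₂ C hC
        exact hCD.subset.trans (hp₁ x' hx' D hD y (hCD.subset hy) hyb)
  obtain ⟨𝒞', h', G', hS', hr', hp'⟩ := main T
  refine ⟨𝒞', h', G', hS', hr', fun C hC x hx y hy => ?_⟩
  obtain ⟨t, ht, hxt⟩ := mem_iUnion₂.1 (hT.2 (mem_univ x))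
  have hsub := (hp' t ht C hC x hx hxt).trans ((image_subset_range _ _).trans (hψr t))
  have h1 := mem_ball.1 (hsub hx)
  have h2 := mem_ball'.1 (hsub hy)
  linarith [dist_triangle x t y]

end

/-! ### Refining the target -/

theorem exists_level {K : Set ℂ} (hK : Convex ℝ K) (hKc : IsCompact K) (hne : (interior K).Nonempty)
    {L : ℂ →L[ℝ] ℝ} (hL : L ≠ 0) {F : Set ℂ} (hF : F.Finite) {D : ℝ}
    (hD : ∀ z ∈ K, ∀ w ∈ K, |L z - L w| ≤ 3 / 2 * D) :
    ∃ z ∈ interior K, L z ∉ L '' F ∧ (∀ w ∈ K, ∀ w' ∈ K, L w ≤ L z → L w' ≤ L z → |L w - L w'| ≤ D) ∧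
      ∀ w ∈ K, ∀ w' ∈ K, L z ≤ L w → L z ≤ L w' → |L w - L w'| ≤ D := by
  have hKne : K.Nonempty := hne.mono interior_subset
  obtain ⟨z₀, hz₀, hmin⟩ := hKc.exists_isMinOn hKne L.continuous.continuousOn
  obtain ⟨z₁, hz₁, hmax⟩ := hKc.exists_isMaxOn hKne L.continuous.continuousOn
  have hlow : ∀ w ∈ K, L z₀ ≤ L w := fun w hw => hmin hw
  have hupp : ∀ w ∈ K, L w ≤ L z₁ := fun w hw => hmax hw
  have hcl : K ⊆ closure (interior K) := by
    rw [hK.closure_interior_eq_closure_of_nonempty_interior hne]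
    exact subset_closure
  have hlt : L z₀ < L z₁ := by
    obtain ⟨c, hc⟩ := hne
    obtain ⟨w, hw, hwc⟩ := (exists_interior_lt hL hc rfl).1
    linarith [hlow w (interior_subset hw), hupp c (interior_subset hc)]
  have hinf : (Ioo (L z₀ + (L z₁ - L z₀) / 3) (L z₁ - (L z₁ - L z₀) / 3)).Infinite :=
    Ioo_infinite (by linarith)
  obtain ⟨r, ⟨hr₀, hr₁⟩, hrF⟩ := (hinf.sdiff (hF.image L)).nonempty
  obtain ⟨w₀, hw₀, hw₀K⟩ := mem_closure_iff.1 (hcl hz₀) {z | L z < r}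
    (isOpen_lt L.continuous continuous_const) (show L z₀ < r by linarith)
  obtain ⟨w₁, hw₁, hw₁K⟩ := mem_closure_iff.1 (hcl hz₁) {z | r < L z}
    (isOpen_lt continuous_const L.continuous) (show r < L z₁ by linarith)
  obtain ⟨z, hz, rfl⟩ := (hK.interior.isPreconnected.image L L.continuous.continuousOn).Icc_subset
    ⟨w₀, hw₀K, rfl⟩ ⟨w₁, hw₁K, rfl⟩ ⟨(show L w₀ < r from hw₀).le, (show r < L w₁ from hw₁).le⟩
  have hw : L z₁ - L z₀ ≤ 3 / 2 * D := (le_abs_self _).trans (hD z₁ hz₁ z₀ hz₀)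
  refine ⟨z, hz, hrF, fun w hw w' hw' h h' => ?_, fun w hw w' hw' h h' => ?_⟩
  · rw [abs_le]
    constructor <;> linarith [hlow w hw, hlow w' hw']
  · rw [abs_le]
    constructor <;> linarith [hupp w hw, hupp w' hw']

section
variable {X S : Type*} [TopologicalSpace X] [Planar X] [TopologicalSpace S] [T2Space S]
  {h : X → S} {G : Set X} {𝒞 : Set (Cell X S)} {C : Cell X S}

theorem IsState.halve_target (hS : IsState 𝒞 h G) (hC : C ∈ 𝒞) {L : ℂ →L[ℝ] ℝ} (hL : L ≠ 0)
    {D : ℝ} (hD : ∀ z ∈ C.K, ∀ w ∈ C.K, |L z - L w| ≤ 3 / 2 * D) :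
    ∃ 𝒞' h' G', IsState 𝒞' h' G' ∧ ∀ C' ∈ 𝒞', (C' ∈ 𝒞 ∧ C' ≠ C) ∨ (C'.Refines C ∧ C'.φ = C.φ ∧
      C'.K ⊆ C.K ∧ ∀ z ∈ C'.K, ∀ w ∈ C'.K, |L z - L w| ≤ D) := by
  have hg := hS.good C hC
  have hfK : frontier C.K ⊆ C.K := hg.isCompact.isClosed.frontier_subset
  set F : Set ℂ := C.K ∩ C.φ ⁻¹' (h '' {x ∈ C.J | ¬ Flat C.J x}) with hFdef
  have hF : F.Finite := by
    refine Finite.of_finite_image (f := C.φ) ((hg.mcell.curve.1.2.image h).subset ?_)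
      (hg.injOn.mono inter_subset_left)
    rintro _ ⟨z, hz, rfl⟩
    exact hz.2
  obtain ⟨z, hz, hzF, hle, hge⟩ := exists_level hg.convex hg.isCompact hg.nonempty hL hF hD
  obtain ⟨p, q, hch⟩ := Chord.of_interior hg.convex hg.isCompact hL hz
  have hflat : ∀ p ∈ frontier C.K, L p = L z → ∀ x ∈ C.J, h x = C.φ p → Flat C.J x :=
    fun p hp hpz x hx hxp => by
      by_contra hnf
      exact hzF ⟨p, ⟨hfK hp, x, ⟨hx, hnf⟩, hxp⟩, hpz⟩
  obtain ⟨h', G', Q₁, Q₂, J₁, J₂, hS', hr₁, hr₂⟩ := hS.cut_target hC hch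
    (hflat p hch.left_mem hch.apply_left) (hflat q hch.right_mem hch.apply_right)
  refine ⟨_, h', G', hS', ?_⟩
  rintro E (rfl | rfl | ⟨hE, hEC⟩)
  · exact .inr ⟨hr₁, rfl, inter_subset_left, fun w hw w' hw' => hle w hw.1 w' hw'.1 hw.2 hw'.2⟩
  · exact .inr ⟨hr₂, rfl, inter_subset_left, fun w hw w' hw' => hge w hw.1 w' hw'.1 hw.2 hw'.2⟩
  · exact .inl ⟨hE, hEC⟩

end

section
variable {X S : Type*} [TopologicalSpace X] [Planar X] [MetricSpace S]
  {h : X → S} {G : Set X} {𝒞 : Set (Cell X S)}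

theorem reCLM_ne_zero : Complex.reCLM ≠ 0 := fun h => by
  have : Complex.reCLM 1 = 0 := by rw [h]; rfl
  simp at this

theorem imCLM_ne_zero : Complex.imCLM ≠ 0 := fun h => by
  have : Complex.imCLM Complex.I = 0 := by rw [h]; rfl
  simp at this

theorem IsState.exists_target_refinement (hS : IsState 𝒞 h G) {ε : ℝ} (hε : 0 < ε) :
    ∃ 𝒞' h' G', IsState 𝒞' h' G' ∧ RefinesFam 𝒞' 𝒞 ∧
      ∀ C ∈ 𝒞', ∀ x ∈ C.target, ∀ y ∈ C.target, dist x y ≤ ε := by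
  have hδ : ∀ C : 𝒞, ∃ δ > 0, ∀ z ∈ C.1.K, ∀ w ∈ C.1.K, dist z w < δ →
      dist (C.1.φ z) (C.1.φ w) < ε := fun C => by
    have hg := hS.good C C.2
    exact Metric.uniformContinuousOn_iff.1
      (hg.isCompact.uniformContinuousOn_of_continuous hg.continuousOn) ε hε
  choose δ hδ0 hδ using hδ
  set P : ℕ → Cell X S → Prop := fun n C => ∃ D : 𝒞, C.φ = D.1.φ ∧ C.K ⊆ D.1.K ∧
    ∃ k l : ℕ, k + l ≤ n ∧
      (∀ z ∈ C.K, ∀ w ∈ C.K, |Complex.reCLM z - Complex.reCLM w| ≤ (3 / 2) ^ k * (δ D / 3)) ∧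
      ∀ z ∈ C.K, ∀ w ∈ C.K, |Complex.imCLM z - Complex.imCLM w| ≤ (3 / 2) ^ l * (δ D / 3) with hP
  have mono : ∀ m n C, m ≤ n → P m C → P n C := fun m n C hmn ⟨D, h1, h2, k, l, hkl, h3⟩ =>
    ⟨D, h1, h2, k, l, hkl.trans hmn, h3⟩
  obtain ⟨N, hN⟩ : ∃ N, ∀ C ∈ 𝒞, P N C := by
    have : ∀ C ∈ 𝒞, ∃ N, P N C := fun C hC => by
      have hg := hS.good C hC
      obtain ⟨R, hR⟩ := hg.isCompact.isBounded.subset_closedBall 0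
      obtain ⟨k, hk⟩ : ∃ k : ℕ, 2 * R / (δ ⟨C, hC⟩ / 3) < (3 / 2 : ℝ) ^ k :=
        pow_unbounded_of_one_lt _ (by norm_num)
      have hd : 0 < δ ⟨C, hC⟩ / 3 := by linarith [hδ0 ⟨C, hC⟩]
      rw [div_lt_iff₀ hd] at hk
      refine ⟨k + k, ⟨C, hC⟩, rfl, Subset.rfl, k, k, le_rfl, fun z hz w hw => ?_,
        fun z hz w hw => ?_⟩
      all_goals
        have h1 := mem_closedBall_zero_iff.1 (hR hz)
        have h2 := mem_closedBall_zero_iff.1 (hR hw)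
        refine (abs_sub _ _).trans ?_
      · simp only [Complex.reCLM_apply]
        linarith [Complex.abs_re_le_norm z, Complex.abs_re_le_norm w]
      · simp only [Complex.imCLM_apply]
        linarith [Complex.abs_im_le_norm z, Complex.abs_im_le_norm w]
    choose! f hf using this
    obtain ⟨N, hN⟩ := (hS.finite.image f).bddAbove
    exact ⟨N, fun C hC => mono _ _ _ (hN ⟨C, hC, rfl⟩) (hf C hC)⟩
  have step : ∀ 𝒞 h G, IsState 𝒞 h G → ∀ n, ∀ C ∈ 𝒞, P (n + 1) C → ¬ P n C → ∃ 𝒞' h' G',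
      IsState 𝒞' h' G' ∧ ∀ C' ∈ 𝒞', (C' ∈ 𝒞 ∧ C' ≠ C) ∨ (P n C' ∧ C'.Refines C) := by
    rintro 𝒞 h G hS n C hC ⟨D, h1, h2, k, l, hkl, h3, h4⟩ hn
    rcases k with _ | k
    · rcases l with _ | l
      · exact absurd ⟨D, h1, h2, 0, 0, n.zero_le, h3, h4⟩ hn
      · obtain ⟨𝒞', h', G', hS', hC'⟩ := hS.halve_target hC imCLM_ne_zero
          (D := (3 / 2) ^ l * (δ D / 3)) fun z hz w hw => (h4 z hz w hw).trans_eq (by ring)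
        refine ⟨𝒞', h', G', hS', fun E hE => (hC' E hE).imp_right fun ⟨hr, e1, e2, e3⟩ =>
          ⟨⟨D, e1.trans h1, e2.trans h2, 0, l, by omega, fun z hz w hw => h3 z (e2 hz) w (e2 hw),
            e3⟩, hr⟩⟩
    · obtain ⟨𝒞', h', G', hS', hC'⟩ := hS.halve_target hC reCLM_ne_zero
        (D := (3 / 2) ^ k * (δ D / 3)) fun z hz w hw => (h3 z hz w hw).trans_eq (by ring)
      refine ⟨𝒞', h', G', hS', fun E hE => (hC' E hE).imp_right fun ⟨hr, e1, e2, e3⟩ =>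
        ⟨⟨D, e1.trans h1, e2.trans h2, k, l, by omega, e3,
          fun z hz w hw => h4 z (e2 hz) w (e2 hw)⟩, hr⟩⟩
  obtain ⟨𝒞', h', G', hS', hP', hr'⟩ := IsState.exists_refinement step hS hN
    fun n C => mono n (n + 1) C n.le_succ
  refine ⟨𝒞', h', G', hS', hr', fun C hC => ?_⟩
  obtain ⟨D, h1, h2, k, l, hkl, h3, h4⟩ := hP' C hC
  obtain ⟨rfl, rfl⟩ : k = 0 ∧ l = 0 := by omega
  rintro _ ⟨z, hz, rfl⟩ _ ⟨w, hw, rfl⟩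
  rw [h1]
  refine (hδ D z (h2 hz) w (h2 hw) ?_).le
  have e3 := h3 z hz w hw
  have e4 := h4 z hz w hw
  rw [pow_zero, one_mul] at e3 e4
  rw [dist_eq_norm]
  refine (Complex.norm_le_abs_re_add_abs_im _).trans_lt ?_
  simp only [Complex.reCLM_apply, Complex.imCLM_apply, ← Complex.sub_re, ← Complex.sub_im] at e3 e4
  linarith [hδ0 D]

end

/-! ### Passing to the limit -/

theorem nonempty_homeomorph_of_antitone {X Y : Type*} [MetricSpace X] [CompactSpace X]
    [MetricSpace Y] [CompactSpace Y] {R : ℕ → Set (X × Y)} (hc : ∀ n, IsClosed (R n))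
    (hanti : ∀ n, R (n + 1) ⊆ R n) (hX : ∀ n x, ∃ y, (x, y) ∈ R n)
    (hY : ∀ n y, ∃ x, (x, y) ∈ R n)
    (hdX : ∀ ε > 0, ∃ n, ∀ x y y', (x, y) ∈ R n → (x, y') ∈ R n → dist y y' ≤ ε)
    (hdY : ∀ ε > 0, ∃ n, ∀ x x' y, (x, y) ∈ R n → (x', y) ∈ R n → dist x x' ≤ ε) :
    Nonempty (X ≃ₜ Y) := by
  have hR : IsCompact (⋂ n, R n) := (isClosed_iInter hc).isCompact
  have := isCompact_iff_compactSpace.1 hR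
  have h1 : Function.Bijective fun p : (⋂ n, R n : Set (X × Y)) => p.1.1 := by
    constructor
    · rintro ⟨⟨x, y⟩, hp⟩ ⟨⟨x', y'⟩, hq⟩ (rfl : x = x')
      rw [mem_iInter] at hp hq
      have : y = y' := eq_of_forall_dist_le fun ε hε => by
        obtain ⟨n, hn⟩ := hdX ε hε
        exact hn _ _ _ (hp n) (hq n)
      subst this
      rfl
    · intro x
      have hcl : ∀ n, IsClosed {y | (x, y) ∈ R n} := fun n =>
        (hc n).preimage (Continuous.prodMk_right x)
      obtain ⟨y, hy⟩ := IsCompact.nonempty_iInter_of_sequence_nonempty_isCompact_isClosed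
        (fun n => {y | (x, y) ∈ R n}) (fun n y hy => hanti n hy) (hX · x)
        (hcl 0).isCompact hcl
      rw [mem_iInter] at hy
      exact ⟨⟨(x, y), mem_iInter.2 hy⟩, rfl⟩
  have h2 : Function.Bijective fun p : (⋂ n, R n : Set (X × Y)) => p.1.2 := by
    constructor
    · rintro ⟨⟨x, y⟩, hp⟩ ⟨⟨x', y'⟩, hq⟩ (rfl : y = y')
      rw [mem_iInter] at hp hq
      have : x = x' := eq_of_forall_dist_le fun ε hε => by
        obtain ⟨n, hn⟩ := hdY ε hε
        exact hn _ _ _ (hp n) (hq n)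
      subst this
      rfl
    · intro y
      have hcl : ∀ n, IsClosed {x | (x, y) ∈ R n} := fun n =>
        (hc n).preimage (Continuous.prodMk_left y)
      obtain ⟨x, hx⟩ := IsCompact.nonempty_iInter_of_sequence_nonempty_isCompact_isClosed
        (fun n => {x | (x, y) ∈ R n}) (fun n x hx => hanti n hx) (hY · y)
        (hcl 0).isCompact hcl
      rw [mem_iInter] at hx
      exact ⟨⟨(x, y), mem_iInter.2 hx⟩, rfl⟩
  have c1 : Continuous (Equiv.ofBijective _ h1) := continuous_fst.comp continuous_subtype_val
  have c2 : Continuous (Equiv.ofBijective _ h2) := continuous_snd.comp continuous_subtype_val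
  exact ⟨c1.homeoOfEquivCompactToT2.symm.trans c2.homeoOfEquivCompactToT2⟩

/-- The relation approximating a homeomorphism which is determined by a family of cells. -/
def cellRel {X S : Type*} [TopologicalSpace X] (𝒞 : Set (Cell X S)) : Set (X × S) :=
  ⋃ C ∈ 𝒞, closure C.Q ×ˢ C.target

section
variable {X S : Type*} [MetricSpace X] [Planar X] [MetricSpace S]
  {h : X → S} {G : Set X} {𝒞 𝒞' : Set (Cell X S)} {C C' : Cell X S} {ε : ℝ}

theorem mem_cellRel {x : X} {y : S} :
    (x, y) ∈ cellRel 𝒞 ↔ ∃ C ∈ 𝒞, x ∈ closure C.Q ∧ y ∈ C.target := by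
  simp only [cellRel, mem_iUnion, mem_prod, exists_prop]

theorem RefinesFam.cellRel_subset (hr : RefinesFam 𝒞' 𝒞) : cellRel 𝒞' ⊆ cellRel 𝒞 := by
  rintro ⟨x, y⟩ hp
  obtain ⟨C', hC', hx, hy⟩ := mem_cellRel.1 hp
  obtain ⟨C, hC, hCC⟩ := hr C' hC'
  exact mem_cellRel.2 ⟨C, hC, closure_mono hCC.subset hx, hCC.target hy⟩

theorem Cell.Good.target_eq (hC : C.Good h G) : C.target = C.inner ∪ h '' C.J := by
  rw [hC.image_eq, Cell.inner, ← image_union, Cell.target,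
    ← closure_eq_interior_union_frontier, hC.isCompact.isClosed.closure_eq]

theorem IsState.isClosed_cellRel (hS : IsState 𝒞 h G) : IsClosed (cellRel 𝒞) :=
  hS.finite.isClosed_biUnion fun C hC => isClosed_closure.prod
    ((hS.good C hC).isCompact.image_of_continuousOn (hS.good C hC).continuousOn).isClosed

theorem IsState.mem_boundary (hS : IsState 𝒞 h G) (hC : C ∈ 𝒞) (hC' : C' ∈ 𝒞) (hne : C ≠ C')
    {x : X} (hx : x ∈ closure C.Q) (hx' : x ∈ closure C'.Q) : x ∈ C.J := by
  have hd := hS.disjoint C hC C' hC' hne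
  rw [(hS.good C hC).mcell.closure_eq] at hx
  refine hx.resolve_left fun h1 => ?_
  exact disjoint_left.1 (hd.closure_right (hS.good C hC).mcell.isOpen) h1 hx'

theorem IsState.mem_boundary_target (hS : IsState 𝒞 h G) (hC : C ∈ 𝒞) (hC' : C' ∈ 𝒞)
    (hne : C ≠ C') {y : S} (hy : y ∈ C.target) (hy' : y ∈ C'.target) : y ∈ h '' C.J := by
  rw [(hS.good C hC).target_eq] at hy
  refine hy.resolve_left fun h1 => ?_
  rw [(hS.good C' hC').target_eq] at hy'
  rcases hy' with h2 | h2
  · exact disjoint_left.1 (hS.disjoint_inner C hC C' hC' hne) h1 h2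
  · exact disjoint_left.1 (hS.good C hC).disjoint_image h1
      (image_mono (hS.good C' hC').subset h2)

theorem IsState.dist_target_le (hS : IsState 𝒞 h G)
    (hd : ∀ C ∈ 𝒞, ∀ x ∈ C.target, ∀ y ∈ C.target, dist x y ≤ ε) {x : X} {y y' : S}
    (hy : (x, y) ∈ cellRel 𝒞) (hy' : (x, y') ∈ cellRel 𝒞) : dist y y' ≤ ε + ε := by
  obtain ⟨C, hC, hxC, hyC⟩ := mem_cellRel.1 hy
  obtain ⟨C', hC', hxC', hyC'⟩ := mem_cellRel.1 hy'
  rcases eq_or_ne C C' with rfl | hne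
  · have := hd C hC y hyC y' hyC'
    linarith [dist_nonneg (x := y) (y := y')]
  · have key : ∀ D ∈ 𝒞, x ∈ D.J → h x ∈ D.target := fun D hD hx => by
      rw [(hS.good D hD).target_eq]
      exact .inr (mem_image_of_mem h hx)
    exact (dist_triangle _ (h x) _).trans (add_le_add
      (hd C hC _ hyC _ (key C hC (hS.mem_boundary hC hC' hne hxC hxC')))
      (hd C' hC' _ (key C' hC' (hS.mem_boundary hC' hC hne.symm hxC' hxC)) _ hyC'))

theorem IsState.dist_source_le (hS : IsState 𝒞 h G)
    (hd : ∀ C ∈ 𝒞, ∀ x ∈ C.Q, ∀ y ∈ C.Q, dist x y ≤ ε) {x x' : X} {y : S}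
    (hx : (x, y) ∈ cellRel 𝒞) (hx' : (x', y) ∈ cellRel 𝒞) : dist x x' ≤ ε + ε := by
  have hd' : ∀ C ∈ 𝒞, ∀ x ∈ closure C.Q, ∀ y ∈ closure C.Q, dist x y ≤ ε := by
    intro C hC x hx y hy
    have : (x, y) ∈ closure (C.Q ×ˢ C.Q) := by rw [closure_prod_eq]; exact ⟨hx, hy⟩
    exact closure_minimal (t := {p : X × X | dist p.1 p.2 ≤ ε})
      (fun p hp => hd C hC _ hp.1 _ hp.2)
      (isClosed_le continuous_dist continuous_const) this
  obtain ⟨C, hC, hxC, hyC⟩ := mem_cellRel.1 hx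
  obtain ⟨C', hC', hxC', hyC'⟩ := mem_cellRel.1 hx'
  rcases eq_or_ne C C' with rfl | hne
  · have := hd' C hC x hxC x' hxC'
    linarith [dist_nonneg (x := x) (y := x')]
  · obtain ⟨z, hz, hzy⟩ := hS.mem_boundary_target hC hC' hne hyC hyC'
    obtain ⟨z', hz', hzy'⟩ := hS.mem_boundary_target hC' hC hne.symm hyC' hyC
    obtain rfl := hS.injOn ((hS.good C hC).subset hz) ((hS.good C' hC').subset hz')
      (hzy.trans hzy'.symm)
    have key : ∀ D ∈ 𝒞, z ∈ D.J → z ∈ closure D.Q := fun D hD hz => by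
      rw [(hS.good D hD).mcell.closure_eq]
      exact .inr hz
    exact (dist_triangle _ z _).trans (add_le_add
      (hd' C hC _ hxC _ (key C hC hz)) (hd' C' hC' _ (key C' hC' hz') _ hxC'))

theorem IsState.exists_fine_refinement [CompactSpace X] (hS : IsState 𝒞 h G) (hε : 0 < ε) :
    ∃ 𝒞' h' G', IsState 𝒞' h' G' ∧ RefinesFam 𝒞' 𝒞 ∧
      (∀ C ∈ 𝒞', ∀ x ∈ C.Q, ∀ y ∈ C.Q, dist x y ≤ ε) ∧
      ∀ C ∈ 𝒞', ∀ x ∈ C.target, ∀ y ∈ C.target, dist x y ≤ ε := by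
  obtain ⟨𝒞₁, h₁, G₁, hS₁, hr₁, hd₁⟩ := hS.exists_source_refinement hε
  obtain ⟨𝒞₂, h₂, G₂, hS₂, hr₂, hd₂⟩ := hS₁.exists_target_refinement hε
  refine ⟨𝒞₂, h₂, G₂, hS₂, hr₂.trans hr₁, fun C hC x hx y hy => ?_, hd₂⟩
  obtain ⟨D, hD, hCD⟩ := hr₂ C hC
  exact hd₁ D hD x (hCD.subset hx) y (hCD.subset hy)

/-- Spaces admitting a pair of combinatorially equivalent cell decompositions are homeomorphic. -/
theorem IsState.nonempty_homeomorph [CompactSpace X] [CompactSpace S] (hS : IsState 𝒞 h G) :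
    Nonempty (X ≃ₜ S) := by
  let T := {p : Set (Cell X S) × (X → S) × Set X // IsState p.1 p.2.1 p.2.2}
  have step : ∀ (n : ℕ) (t : T), ∃ t' : T, RefinesFam t'.1.1 t.1.1 ∧
      (∀ C ∈ t'.1.1, ∀ x ∈ C.Q, ∀ y ∈ C.Q, dist x y ≤ 1 / ((n : ℝ) + 1)) ∧
      ∀ C ∈ t'.1.1, ∀ x ∈ C.target, ∀ y ∈ C.target, dist x y ≤ 1 / ((n : ℝ) + 1) := by
    rintro n ⟨⟨𝒞, h, G⟩, hS⟩
    obtain ⟨𝒞', h', G', hS', H⟩ := IsState.exists_fine_refinement hS (ε := 1 / ((n : ℝ) + 1))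
      (by positivity)
    exact ⟨⟨⟨𝒞', h', G'⟩, hS'⟩, H⟩
  choose f hf1 hf2 hf3 using step
  let u : ℕ → T := fun n => Nat.rec ⟨⟨𝒞, h, G⟩, hS⟩ f n
  have hu : ∀ n, u (n + 1) = f n (u n) := fun n => rfl
  have hsmall : ∀ ε > (0 : ℝ), ∃ n : ℕ, 1 / ((n : ℝ) + 1) + 1 / ((n : ℝ) + 1) ≤ ε := fun ε hε => by
    obtain ⟨n, hn⟩ := exists_nat_one_div_lt (half_pos hε)
    exact ⟨n, by linarith⟩
  refine nonempty_homeomorph_of_antitone (R := fun n => cellRel (u n).1.1)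
    (fun n => (u n).2.isClosed_cellRel) (fun n => ?_) (fun n x => ?_) (fun n y => ?_)
    (fun ε hε => ?_) (fun ε hε => ?_)
  · rw [hu]
    exact (hf1 _ _).cellRel_subset
  · obtain ⟨C, hC, hx⟩ := (u n).2.cover x
    obtain ⟨w, hw⟩ := ((u n).2.good C hC).nonempty
    exact ⟨C.φ w, mem_cellRel.2 ⟨C, hC, hx, w, interior_subset hw, rfl⟩⟩
  · obtain ⟨C, hC, hy⟩ := (u n).2.cover_target y
    obtain ⟨w, hw⟩ := ((u n).2.good C hC).mcell.isConnected.nonempty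
    exact ⟨w, mem_cellRel.2 ⟨C, hC, subset_closure hw, hy⟩⟩
  · obtain ⟨n, hn⟩ := hsmall ε hε
    refine ⟨n + 1, fun x y y' h1 h2 => (IsState.dist_target_le (u (n + 1)).2 ?_ h1 h2).trans hn⟩
    rw [hu]
    exact hf3 _ _
  · obtain ⟨n, hn⟩ := hsmall ε hε
    refine ⟨n + 1, fun x x' y h1 h2 => (IsState.dist_source_le (u (n + 1)).2 ?_ h1 h2).trans hn⟩
    rw [hu]
    exact hf2 _ _

end

/-! ### The initial decomposition -/

/-- A parametrisation of the sphere by stereographic projection from the pole `(0, 0, -e)`. -/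
noncomputable def stereo (e : ℝ) (z : ℂ) : EuclideanSpace ℝ (Fin 3) :=
  !₂[2 * z.re / (1 + ‖z‖ ^ 2), 2 * z.im / (1 + ‖z‖ ^ 2), e * (1 - ‖z‖ ^ 2) / (1 + ‖z‖ ^ 2)]

theorem stereo_mem {e : ℝ} (he : e ^ 2 = 1) (z : ℂ) :
    stereo e z ∈ sphere (0 : EuclideanSpace ℝ (Fin 3)) 1 := by
  rw [mem_sphere_zero_iff_norm, EuclideanSpace.norm_eq, Real.sqrt_eq_one, Fin.sum_univ_three]
  have h1 : (1 + ‖z‖ ^ 2) ≠ 0 := by positivity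
  have h2 : ‖z‖ ^ 2 = z.re ^ 2 + z.im ^ 2 := by
    rw [Complex.sq_norm, Complex.normSq_apply]; ring
  simp only [stereo, Real.norm_eq_abs, sq_abs]
  simp
  field_simp
  rw [he, h2]
  ring

theorem continuous_stereo (e : ℝ) : Continuous (stereo e) := by
  refine (PiLp.continuous_toLp 2 _).comp (continuous_pi fun i => ?_)
  have h1 (z : ℂ) : (1 + ‖z‖ ^ 2) ≠ 0 := by positivity
  fin_cases i <;> simp <;> fun_prop (disch := exact h1 _)

theorem stereo_two (e : ℝ) (z : ℂ) : stereo e z 2 = e * ((1 - ‖z‖ ^ 2) / (1 + ‖z‖ ^ 2)) := by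
  simp [stereo, mul_div_assoc]

theorem stereo_injective {e : ℝ} (he : e ^ 2 = 1) : Function.Injective (stereo e) := by
  have key (z : ℂ) : (1 + e * stereo e z 2) = 2 / (1 + ‖z‖ ^ 2) := by
    have h1 : (1 + ‖z‖ ^ 2) ≠ 0 := by positivity
    rw [stereo_two]
    field_simp
    rw [he]
    ring
  have key' (z : ℂ) : z.re = stereo e z 0 / (1 + e * stereo e z 2) ∧
      z.im = stereo e z 1 / (1 + e * stereo e z 2) := by
    have h1 : (1 + ‖z‖ ^ 2) ≠ 0 := by positivity
    rw [key]
    simp only [stereo]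
    simp
    constructor <;> field_simp
  intro z w hzw
  apply Complex.ext
  · rw [(key' z).1, (key' w).1, hzw]
  · rw [(key' z).2, (key' w).2, hzw]

theorem exists_stereo_eq {e : ℝ} (he : e ^ 2 = 1) {v : EuclideanSpace ℝ (Fin 3)}
    (hv : v ∈ sphere (0 : EuclideanSpace ℝ (Fin 3)) 1) (hev : 0 ≤ e * v 2) :
    ∃ z ∈ closedBall (0 : ℂ) 1, stereo e z = v := by
  rw [mem_sphere_zero_iff_norm, EuclideanSpace.norm_eq, Real.sqrt_eq_one,
    Fin.sum_univ_three] at hv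
  simp only [Real.norm_eq_abs, sq_abs] at hv
  have h0 : 1 + e * v 2 ≠ 0 := by positivity
  have hn : ‖(⟨v 0 / (1 + e * v 2), v 1 / (1 + e * v 2)⟩ : ℂ)‖ ^ 2 =
      (1 - e * v 2) / (1 + e * v 2) := by
    rw [Complex.sq_norm, Complex.normSq_apply]
    field_simp
    linear_combination hv + v 2 ^ 2 * he
  have hs : 1 + (1 - e * v 2) / (1 + e * v 2) = 2 / (1 + e * v 2) := by
    field_simp
    ring
  refine ⟨⟨v 0 / (1 + e * v 2), v 1 / (1 + e * v 2)⟩, ?_, ?_⟩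
  · rw [mem_closedBall_zero_iff, ← sq_le_one_iff₀ (norm_nonneg _), hn, div_le_one (by positivity)]
    linarith
  · ext i
    rw [stereo, hn, hs]
    fin_cases i <;> simp <;> field_simp
    linear_combination 2 * v 2 * he

/-- A parametrisation of the sphere by stereographic projection. -/
noncomputable def sphereChart {e : ℝ} (he : e ^ 2 = 1) (z : ℂ) :
    sphere (0 : EuclideanSpace ℝ (Fin 3)) 1 := ⟨stereo e z, stereo_mem he z⟩

theorem sphereChart_two_pos {e : ℝ} (he : e ^ 2 = 1) {z : ℂ} (hz : z ∈ ball (0 : ℂ) 1) :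
    0 < e * (sphereChart he z).1 2 := by
  rw [mem_ball_zero_iff] at hz
  rw [sphereChart, stereo_two, ← mul_assoc, ← sq, he, one_mul]
  have : ‖z‖ ^ 2 < 1 := by nlinarith [norm_nonneg z]
  exact div_pos (by linarith) (by positivity)

theorem sphereChart_two_eq {e : ℝ} (he : e ^ 2 = 1) {z : ℂ} (hz : z ∈ sphere (0 : ℂ) 1) :
    (sphereChart he z).1 2 = 0 := by
  rw [mem_sphere_zero_iff_norm] at hz
  simp [sphereChart, stereo_two, hz]

theorem sphereChart_eq {e e' : ℝ} (he : e ^ 2 = 1) (he' : e' ^ 2 = 1) {z : ℂ}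
    (hz : z ∈ sphere (0 : ℂ) 1) : sphereChart he z = sphereChart he' z := by
  rw [mem_sphere_zero_iff_norm] at hz
  simp [sphereChart, stereo, hz]

theorem good_sphereChart {X : Type*} [TopologicalSpace X] [Planar X] {e : ℝ} (he : e ^ 2 = 1)
    {Q J : Set X} (hQ : MCell Q J) {h : X → sphere (0 : EuclideanSpace ℝ (Fin 3)) 1}
    (hh : h '' J = sphereChart he '' sphere 0 1) :
    Cell.Good ⟨Q, J, closedBall 0 1, sphereChart he⟩ h J where
  mcell := hQ
  convex := convex_closedBall _ _
  isCompact := isCompact_closedBall _ _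
  nonempty := ⟨0, by rw [interior_closedBall _ one_ne_zero]; simp⟩
  continuousOn := ((continuous_stereo e).subtype_mk _).continuousOn
  injOn := fun z _ w _ hzw => stereo_injective he (congrArg Subtype.val hzw)
  image_eq := by rw [hh, frontier_closedBall _ one_ne_zero]
  subset := Subset.rfl
  disjoint := hQ.disjoint
  disjoint_image := by
    rw [hh, disjoint_left, Cell.inner, interior_closedBall _ one_ne_zero]
    rintro _ ⟨z, hz, rfl⟩ ⟨w, hw, hwz⟩
    have := sphereChart_two_pos he hz
    rw [← show sphereChart he w = sphereChart he z from hwz, sphereChart_two_eq he hw, mul_zero] at this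
    exact this.false

theorem exists_isState {X : Type*} [TopologicalSpace X] [Planar X] [Nonempty X] :
    ∃ (𝒞 : Set (Cell X (sphere (0 : EuclideanSpace ℝ (Fin 3)) 1))) (h : _) (G : _),
      IsState 𝒞 h G := by
  obtain ⟨ψ, hψ, -⟩ := Surface.exists_chart (Classical.arbitrary X)
  have h1 : (1 : ℝ) ^ 2 = 1 := by norm_num
  have h2 : (-1 : ℝ) ^ 2 = 1 := by norm_num
  have hQ := mcell_ball hψ
  obtain ⟨R, hR, hd, hu⟩ := hQ.exists_other
  obtain ⟨h, hh, hhs⟩ := exists_continuousOn_factor (isCompact_sphere (0 : ℂ) 1)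
    hψ.continuous.continuousOn hψ.injective.injOn
    (((continuous_stereo 1).subtype_mk (stereo_mem h1)).continuousOn)
  replace hhs : ∀ t ∈ sphere (0 : ℂ) 1, h (ψ t) = sphereChart h1 t := hhs
  have hJ1 : h '' (ψ '' sphere 0 1) = sphereChart h1 '' sphere 0 1 := by
    rw [image_image]
    exact image_congr hhs
  have hJ2 : h '' (ψ '' sphere 0 1) = sphereChart h2 '' sphere 0 1 :=
    hJ1.trans (image_congr fun t ht => sphereChart_eq h1 h2 ht)
  have hinn : Disjoint (sphereChart h1 '' ball 0 1) (sphereChart h2 '' ball 0 1) := by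
    rw [disjoint_left]
    rintro _ ⟨z, hz, rfl⟩ ⟨w, hw, hwz⟩
    have e1 := sphereChart_two_pos h1 hz
    have e2 := sphereChart_two_pos h2 hw
    rw [hwz] at e2
    linarith
  refine ⟨{⟨ψ '' ball 0 1, ψ '' sphere 0 1, closedBall 0 1, sphereChart h1⟩,
    ⟨R, ψ '' sphere 0 1, closedBall 0 1, sphereChart h2⟩}, h, ψ '' sphere 0 1, ?_, ?_, ?_, hh,
    ?_, ?_, ?_, fun x => ?_, fun y => ?_⟩
  · exact (finite_singleton _).insert _
  · rintro C (rfl | rfl)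
    · exact good_sphereChart h1 hQ hJ1
    · exact good_sphereChart h2 hR hJ2
  · exact ((isCompact_sphere _ _).image hψ.continuous).isClosed
  · rintro _ ⟨z, hz, rfl⟩ _ ⟨w, hw, rfl⟩ hzw
    rw [hhs z hz, hhs w hw] at hzw
    rw [stereo_injective h1 (congrArg Subtype.val hzw)]
  · rintro C (rfl | rfl) C' (rfl | rfl) hne
    exacts [(hne rfl).elim, hd, hd.symm, (hne rfl).elim]
  · simp only [Cell.inner]
    rintro C (rfl | rfl) C' (rfl | rfl) hne <;> simp only [interior_closedBall _ one_ne_zero]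
    exacts [(hne rfl).elim, hinn, hinn.symm, (hne rfl).elim]
  · by_cases hx : x ∈ ψ '' sphere 0 1
    · exact ⟨_, .inl rfl, by rw [hQ.closure_eq]; exact .inr hx⟩
    · rcases hu.ge hx with hx | hx
      · exact ⟨_, .inl rfl, subset_closure hx⟩
      · exact ⟨_, .inr rfl, subset_closure hx⟩
  · rcases le_total 0 (y.1 2) with hy | hy
    · obtain ⟨z, hz, hzy⟩ := exists_stereo_eq h1 y.2 (by linarith)
      exact ⟨_, .inl rfl, z, hz, Subtype.ext hzy⟩
    · obtain ⟨z, hz, hzy⟩ := exists_stereo_eq h2 y.2 (by linarith)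
      exact ⟨_, .inr rfl, z, hz, Subtype.ext hzy⟩

/-! ### Charted spaces -/

theorem surface_of_chartedSpace (M : Type*) [TopologicalSpace M]
    [ChartedSpace (EuclideanSpace ℝ (Fin 2)) M] : Surface M := by
  refine ⟨fun p => ?_⟩
  let f := chartAt (EuclideanSpace ℝ (Fin 2)) p
  let e : ℂ ≃ₜ EuclideanSpace ℝ (Fin 2) :=
    Complex.orthonormalBasisOneI.repr.toHomeomorph.trans (Homeomorph.addRight (f p))
  have h0 : e 0 = f p := by simp [e]
  have hopen : IsOpen (e ⁻¹' f.target) := f.open_target.preimage e.continuous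
  obtain ⟨r, hr, hrs⟩ := Metric.isOpen_iff.1 hopen 0 (by
    rw [mem_preimage, h0]
    exact f.map_source (mem_chart_source _ p))
  obtain ⟨σ, hσ, hσ0, hrange, -⟩ := exists_radial_embedding hr
  have hσt (z : ℂ) : e (σ z) ∈ f.target := hrs (hrange ▸ mem_range_self z)
  refine ⟨fun z => f.symm (e (σ z)), ?_, ?_⟩
  · refine .of_continuous_injective_isOpenMap ?_ ?_ fun U hU => ?_
    · exact continuousOn_univ.1 (f.continuousOn_symm.comp
        (e.continuous.comp hσ.continuous).continuousOn fun z _ => hσt z)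
    · intro z w hzw
      exact hσ.injective (e.injective (f.symm.injOn (hσt z) (hσt w) hzw))
    · have : (fun z => f.symm (e (σ z))) '' U = f.symm '' (e '' (σ '' U)) := by
        rw [image_image, image_image]
      rw [this]
      refine f.symm.isOpen_image_of_subset_source (e.isOpenMap _ (hσ.isOpenMap _ hU)) ?_
      rintro _ ⟨_, ⟨z, -, rfl⟩, rfl⟩
      exact hσt z
  · simp only [hσ0, h0]
    exact f.left_inv (mem_chart_source _ p)

end PlanarTopology

open PlanarTopology in
theorem stmt_12 (M : Type*) [TopologicalSpace M] [T2Space M]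
    [ChartedSpace (EuclideanSpace ℝ (Fin 2)) M]
    [CompactSpace M] [SimplyConnectedSpace M] :
    Nonempty (M ≃ₜ Metric.sphere (0 : EuclideanSpace ℝ (Fin 3)) 1) := by
  have := ChartedSpace.locallyPathConnectedSpace (EuclideanSpace ℝ (Fin 2)) M
  have := ChartedSpace.secondCountable_of_sigmaCompact (EuclideanSpace ℝ (Fin 2)) M
  let := TopologicalSpace.metrizableSpaceMetric M
  have := surface_of_chartedSpace M
  have : Planar M := { exists_sign := fun J hJc hJ h => exists_global_sign hJc hJ h }
  obtain ⟨𝒞, h, G, hS⟩ := exists_isState (X := M)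
  exact hS.nonempty_homeomorph
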